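/- Persistence of spatial analyticity for the Hirota–Satsuma system: Let a₁ be a real number with a₁ ≠ 0 and a₁ < 1/4, and let c₁₂ > 0. Let σ₀ > 0 and s ∈ ℝ, and let (u, v) be a pair of real-valued smooth functions on ℝ × ℝ solving pointwise the Hirota–Satsuma system u_t + a₁ u_{xxx} = −6a₁ u u_x + c₁₂ v v_x, v_t + v_{xxx} = −3 u v_x, such that u(t,·), v(t,·) are Schwartz for each t ∈ ℝ and ‖u(0)‖_{G^{σ₀,s}}, ‖v(0)‖_{G^{σ₀,s}} are finite. Then for every ε > 0 there exists a constant c > 0, depending on ε, σ₀ and the norms ‖u(0)‖_{G^{σ₀,s}}, ‖v(0)‖_{G^{σ₀,s}}, such that for every t ∈ ℝ the norms ‖u(t)‖_{G^{σ(t),s}} and ‖v(t)‖_{G^{σ(t),s}} are finite, where σ(t) = c (1+|t|)^{−4/3−ε}. -/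

import Mathlib

open MeasureTheory Set Filter
open scoped ENNReal

/-- One-dimensional (spatial) Fourier transform `f̂(ξ) = ∫ e^{-i x ξ} f(x) dx`. -/
noncomputable def FT1 (g : ℝ → ℂ) (ξ : ℝ) : ℂ :=
  ∫ x : ℝ, Complex.exp (-Complex.I * (x * ξ)) * g x

/-- Gevrey norm `‖g‖_{G^{σ,s}}`, valued in `ℝ≥0∞` (so that infinite norms are
meaningful). -/
noncomputable def gevreyNorm (σ s : ℝ) (g : ℝ → ℂ) : ℝ≥0∞ :=
  (∫⁻ ξ : ℝ, ENNReal.ofReal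
      (Real.exp (2 * σ * |ξ|) * (1 + |ξ|) ^ (2 * s) * ‖FT1 g ξ‖ ^ 2)) ^ (1/2 : ℝ)

open MeasureTheory Set Filter
open scoped ENNReal

namespace HS

/-- Admissible profile for the multiplier. -/
structure WOK (A : ℝ) (W : ℝ → ℝ) : Prop where
  one_le_A : 1 ≤ A
  one_le : ∀ s, 1 ≤ s → 1 ≤ W s
  mono : ∀ s t, 1 ≤ s → s ≤ t → W s ≤ W t
  sub : ∀ s t, 1 ≤ s → 1 ≤ t → W (s + t) ≤ A * W s * W t
  lip : ∀ s t, 1 ≤ t → t ≤ s → W s ^ 2 - W t ^ 2 ≤ A * (s - t) * W s ^ 2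
  meas : Measurable W

/-- Japanese bracket at scale `σ`. -/
noncomputable def jb (σ ξ : ℝ) : ℝ := Real.sqrt (1 + (σ * ξ) ^ 2)

lemma jb_sq (σ ξ : ℝ) : jb σ ξ ^ 2 = 1 + (σ * ξ) ^ 2 := by
  unfold jb; rw [Real.sq_sqrt (by positivity)]

lemma one_le_jb (σ ξ : ℝ) : 1 ≤ jb σ ξ := by
  unfold jb; rw [Real.one_le_sqrt]; nlinarith [sq_nonneg (σ * ξ)]

lemma jb_pos (σ ξ : ℝ) : 0 < jb σ ξ := lt_of_lt_of_le one_pos (one_le_jb σ ξ)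

lemma jb_neg (σ ξ : ℝ) : jb σ (-ξ) = jb σ ξ := by
  unfold jb; congr 1; ring

lemma abs_le_jb (σ ξ : ℝ) : |σ * ξ| ≤ jb σ ξ := by
  unfold jb; apply Real.abs_le_sqrt; linarith

lemma jb_add_le (σ x y : ℝ) : jb σ (x + y) ≤ jb σ x + jb σ y := by
  have h1 := one_le_jb σ x
  have h2 := one_le_jb σ y
  have h3 := jb_sq σ x
  have h4 := jb_sq σ y
  have h5 : (σ * x) * (σ * y) ≤ jb σ x * jb σ y := by
    have := mul_le_mul (abs_le_jb σ x) (abs_le_jb σ y) (abs_nonneg _) (by linarith)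
    rw [← abs_mul] at this
    exact (le_abs_self _).trans this
  have h6 := jb_sq σ (x + y)
  apply le_of_sq_le_sq _ (by linarith)
  rw [h6]
  nlinarith

lemma jb_meas (σ : ℝ) : Measurable (jb σ) := by
  unfold jb; fun_prop

lemma jb_sub (σ x y : ℝ) : (jb σ x - jb σ y) * (jb σ x + jb σ y) = σ ^ 2 * ((x - y) * (x + y)) := by
  have h3 := jb_sq σ x
  have h4 := jb_sq σ y
  nlinarith

/-- The multiplier. -/
noncomputable def mm (σ : ℝ) (W : ℝ → ℝ) (ξ : ℝ) : ℝ := jb σ ξ ^ 2 * W (jb σ ξ)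

section
variable {A σ : ℝ} {W : ℝ → ℝ}

lemma mm_neg (ξ : ℝ) : mm σ W (-ξ) = mm σ W ξ := by
  unfold mm; rw [jb_neg]

lemma one_le_mm (h : WOK A W) (ξ : ℝ) : 1 ≤ mm σ W ξ := by
  unfold mm
  have h1 := one_le_jb σ ξ
  have h2 := h.one_le _ h1
  nlinarith

lemma mm_pos (h : WOK A W) (ξ : ℝ) : 0 < mm σ W ξ := lt_of_lt_of_le one_pos (one_le_mm h ξ)

lemma mm_meas (h : WOK A W) : Measurable (mm σ W) := by
  unfold mm
  have := h.meas.comp (jb_meas σ)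
  exact ((jb_meas σ).pow_const 2).mul this

lemma mm_add (h : WOK A W) (x y : ℝ) :
    mm σ W (x + y) * min (jb σ x) (jb σ y) ^ 2 ≤ 4 * A * (mm σ W x * mm σ W y) := by
  unfold mm
  have hx := one_le_jb σ x
  have hy := one_le_jb σ y
  have hxy := one_le_jb σ (x + y)
  have hadd := jb_add_le σ x y
  have hA := h.one_le_A
  set a := jb σ x
  set b := jb σ y
  set c := jb σ (x + y)
  have hW : W c ≤ A * W a * W b :=
    (h.mono _ _ hxy hadd).trans (h.sub _ _ hx hy)
  have hc := h.one_le _ hxy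
  have key : c * min a b ≤ 2 * (a * b) := by
    rcases le_total a b with hab | hab
    · rw [min_eq_left hab]; nlinarith
    · rw [min_eq_right hab]; nlinarith
  have hm : 0 ≤ c * min a b := mul_nonneg (by linarith) (le_min (by linarith) (by linarith))
  have key2 : (c * min a b) ^ 2 ≤ (2 * (a * b)) ^ 2 := pow_le_pow_left₀ hm key 2
  calc c ^ 2 * W c * min a b ^ 2 = (c * min a b) ^ 2 * W c := by ring
    _ ≤ (2 * (a * b)) ^ 2 * (A * W a * W b) := by
        apply mul_le_mul key2 hW (by linarith) (by positivity)
    _ = _ := by ring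

lemma mm_add' (h : WOK A W) (x y : ℝ) :
    mm σ W (x + y) ≤ 4 * A * (mm σ W x * mm σ W y) := by
  refine le_trans ?_ (mm_add h x y)
  have : 1 ≤ min (jb σ x) (jb σ y) := le_min (one_le_jb _ _) (one_le_jb _ _)
  have h2 := mm_pos (σ := σ) h (x + y)
  nlinarith [mul_le_mul_of_nonneg_left (one_le_pow₀ this (n := 2)) h2.le]

lemma mu_lip_aux (h : WOK A W) (x y : ℝ) (hxy : jb σ y ≤ jb σ x) :
    |mm σ W x ^ 2 - mm σ W y ^ 2| ≤ 5 * A * (jb σ x - jb σ y) * mm σ W x ^ 2 := by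
  unfold mm
  have hx := one_le_jb σ x
  have hy := one_le_jb σ y
  have hA := h.one_le_A
  set a := jb σ x
  set b := jb σ y
  have h1 := h.lip a b hy hxy
  have h2 := h.mono b a hy hxy
  have h3 := h.one_le b hy
  have hpow : b ^ 2 ≤ a ^ 2 := pow_le_pow_left₀ (by linarith) hxy 2
  have hmono : b ^ 2 * W b ≤ a ^ 2 * W a :=
    mul_le_mul hpow h2 (by linarith) (by positivity)
  have hsq : (b ^ 2 * W b) ^ 2 ≤ (a ^ 2 * W a) ^ 2 :=
    pow_le_pow_left₀ (by positivity) hmono 2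
  rw [abs_of_nonneg (by linarith)]
  have hb4 : a ^ 4 - b ^ 4 ≤ 4 * (a - b) * a ^ 4 := by
    have e : a ^ 4 - b ^ 4 = (a - b) * ((a + b) * (a ^ 2 + b ^ 2)) := by ring
    rw [e]
    have : (a + b) * (a ^ 2 + b ^ 2) ≤ 4 * a ^ 4 := by
      have e1 : (a + b) * (a ^ 2 + b ^ 2) ≤ (2 * a) * (2 * a ^ 2) :=
        mul_le_mul (by linarith) (by linarith) (by positivity) (by positivity)
      have e2 : a ^ 3 ≤ a ^ 4 := pow_le_pow_right₀ hx (by norm_num)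
      nlinarith
    nlinarith [mul_le_mul_of_nonneg_left this (sub_nonneg.2 hxy)]
  have hb4' : b ^ 4 ≤ a ^ 4 := pow_le_pow_left₀ (by linarith) hxy 4
  have hn : 0 ≤ A * (a - b) * W a ^ 2 := by
    have := sub_nonneg.2 hxy
    positivity
  calc (a ^ 2 * W a) ^ 2 - (b ^ 2 * W b) ^ 2
      = (a ^ 4 - b ^ 4) * W a ^ 2 + b ^ 4 * (W a ^ 2 - W b ^ 2) := by ring
    _ ≤ (4 * (a - b) * a ^ 4) * W a ^ 2 + a ^ 4 * (A * (a - b) * W a ^ 2) := by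
        apply add_le_add
        · exact mul_le_mul_of_nonneg_right hb4 (by positivity)
        · calc _ ≤ b ^ 4 * (A * (a - b) * W a ^ 2) := mul_le_mul_of_nonneg_left h1 (by positivity)
            _ ≤ _ := mul_le_mul_of_nonneg_right hb4' hn
    _ = (4 + A) * ((a - b) * (a ^ 4 * W a ^ 2)) := by ring
    _ ≤ (5 * A) * ((a - b) * (a ^ 4 * W a ^ 2)) := by
        apply mul_le_mul_of_nonneg_right (by linarith)
        have := sub_nonneg.2 hxy
        positivity
    _ = _ := by ring

/-- Main difference estimate for `μ = m²`. -/
lemma mu_lip (h : WOK A W) (x y : ℝ) (B : ℝ) (hx : mm σ W x ^ 2 ≤ B) (hy : mm σ W y ^ 2 ≤ B) :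
    |mm σ W x ^ 2 - mm σ W y ^ 2| * (jb σ x + jb σ y) ≤ 5 * A * (σ ^ 2 * (|x - y| * |x + y|)) * B := by
  have key : |mm σ W x ^ 2 - mm σ W y ^ 2| ≤ 5 * A * |jb σ x - jb σ y| * B := by
    have hA := h.one_le_A
    rcases le_total (jb σ y) (jb σ x) with hxy | hxy
    · rw [abs_of_nonneg (sub_nonneg.2 hxy)]
      refine (mu_lip_aux h x y hxy).trans ?_
      have := sub_nonneg.2 hxy
      gcongr
    · rw [abs_sub_comm, abs_sub_comm (jb σ x), abs_of_nonneg (sub_nonneg.2 hxy)]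
      refine (mu_lip_aux h y x hxy).trans ?_
      have := sub_nonneg.2 hxy
      gcongr
  have hp : 0 < jb σ x + jb σ y := add_pos (jb_pos _ _) (jb_pos _ _)
  have e : |jb σ x - jb σ y| * (jb σ x + jb σ y) = σ ^ 2 * (|x - y| * |x + y|) := by
    have e0 : |jb σ x - jb σ y| * (jb σ x + jb σ y) = |(jb σ x - jb σ y) * (jb σ x + jb σ y)| := by
      rw [abs_mul, abs_of_pos hp]
    rw [e0, jb_sub, abs_mul, abs_mul, abs_of_nonneg (sq_nonneg σ)]
  calc _ ≤ (5 * A * |jb σ x - jb σ y| * B) * (jb σ x + jb σ y) :=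
        mul_le_mul_of_nonneg_right key hp.le
    _ = 5 * A * (|jb σ x - jb σ y| * (jb σ x + jb σ y)) * B := by ring
    _ = _ := by rw [e]

end

lemma WOK_exp (K : ℝ) (hK : 1 ≤ K) : WOK 2 (fun s => Real.exp (min s K)) where
  one_le_A := by norm_num
  one_le s hs := Real.one_le_exp (le_min (by linarith) (by linarith))
  mono s t _ hst := Real.exp_le_exp.2 (min_le_min_right _ hst)
  sub s t hs ht := by
    have : min (s + t) K ≤ min s K + min t K := by
      rcases le_total s K with h | h <;> rcases le_total t K with h' | h' <;>
        simp only [min_eq_left h, min_eq_left h', min_eq_right h, min_eq_right h']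
      · exact min_le_left _ _
      · exact (min_le_right _ _).trans (by linarith)
      · exact (min_le_right _ _).trans (by linarith)
      · exact (min_le_right _ _).trans (by linarith)
    have h2 := Real.exp_le_exp.2 this
    rw [Real.exp_add] at h2
    have := mul_pos (Real.exp_pos (min s K)) (Real.exp_pos (min t K))
    linarith
  lip s t ht hst := by
    have h0 : min t K ≤ min s K := min_le_min_right _ hst
    have h1 : min s K - min t K ≤ s - t := by
      rcases le_total s K with h | h <;> rcases le_total t K with h' | h' <;>
        simp only [min_eq_left h, min_eq_left h', min_eq_right h, min_eq_right h'] <;> linarith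
    rw [← Real.exp_nat_mul, ← Real.exp_nat_mul]
    set p := min s K
    set q := min t K
    have h2 := Real.add_one_le_exp (2 * (q - p))
    have h3 : Real.exp ((2:ℕ) * q) = Real.exp ((2:ℕ) * p) * Real.exp (2 * (q - p)) := by
      rw [← Real.exp_add]; congr 1; push_cast; ring
    rw [h3]
    have h4 := Real.exp_pos ((2:ℕ) * p)
    nlinarith [mul_le_mul_of_nonneg_left h2 h4.le, mul_le_mul_of_nonneg_left h1 h4.le]
  meas := by fun_prop

lemma pow16_lip (p q : ℝ) (hq : 1 ≤ q) (hqp : q ≤ p) : p ^ 16 - q ^ 16 ≤ 16 * (p - q) * p ^ 16 := by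
  have e : p ^ 16 - q ^ 16 = (p - q) * ((p + q) * (p ^ 2 + q ^ 2) * (p ^ 4 + q ^ 4) * (p ^ 8 + q ^ 8)) := by
    ring
  have h2 : q ^ 2 ≤ p ^ 2 := pow_le_pow_left₀ (by linarith) hqp 2
  have h4 : q ^ 4 ≤ p ^ 4 := pow_le_pow_left₀ (by linarith) hqp 4
  have h8 : q ^ 8 ≤ p ^ 8 := pow_le_pow_left₀ (by linarith) hqp 8
  have hp : 0 ≤ p := by linarith
  have hq0 : 0 ≤ q := by linarith
  have hb : (p + q) * (p ^ 2 + q ^ 2) * (p ^ 4 + q ^ 4) * (p ^ 8 + q ^ 8) ≤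
      (p + p) * (p ^ 2 + p ^ 2) * (p ^ 4 + p ^ 4) * (p ^ 8 + p ^ 8) := by
    gcongr
  have h15 : p ^ 15 ≤ p ^ 16 := pow_le_pow_right₀ (by linarith) (by norm_num)
  have : (p + p) * (p ^ 2 + p ^ 2) * (p ^ 4 + p ^ 4) * (p ^ 8 + p ^ 8) = 16 * p ^ 15 := by ring
  rw [e]
  have hs := sub_nonneg.2 hqp
  calc _ ≤ (p - q) * (16 * p ^ 16) := by
        apply mul_le_mul_of_nonneg_left _ hs; linarith
    _ = _ := by ring

lemma WOK_pow8 (K : ℝ) (hK : 1 ≤ K) : WOK 256 (fun s => (min s K) ^ 8) where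
  one_le_A := by norm_num
  one_le s hs := one_le_pow₀ (le_min hs hK)
  mono s t hs hst := pow_le_pow_left₀ (le_min (by linarith) (by linarith)) (min_le_min_right _ hst) 8
  sub s t hs ht := by
    have h1 : 1 ≤ min s K := le_min hs hK
    have h2 : 1 ≤ min t K := le_min ht hK
    have : min (s + t) K ≤ 2 * (min s K * min t K) := by
      have : min (s + t) K ≤ min s K + min t K := by
        rcases le_total s K with h | h <;> rcases le_total t K with h' | h' <;>
          simp only [min_eq_left h, min_eq_left h', min_eq_right h, min_eq_right h']
        · exact min_le_left _ _
        · exact (min_le_right _ _).trans (by linarith)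
        · exact (min_le_right _ _).trans (by linarith)
        · exact (min_le_right _ _).trans (by linarith)
      nlinarith
    calc (min (s + t) K) ^ 8 ≤ (2 * (min s K * min t K)) ^ 8 :=
          pow_le_pow_left₀ (le_min (by linarith) (by linarith)) this 8
      _ = _ := by ring
  lip s t ht hst := by
    have h0 : min t K ≤ min s K := min_le_min_right _ hst
    have h1 : min s K - min t K ≤ s - t := by
      rcases le_total s K with h | h <;> rcases le_total t K with h' | h' <;>
        simp only [min_eq_left h, min_eq_left h', min_eq_right h, min_eq_right h'] <;> linarith
    have h2 : 1 ≤ min t K := le_min ht hK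
    have h3 := pow16_lip (min s K) (min t K) h2 h0
    set p := min s K
    set q := min t K
    have h4 : 0 ≤ p ^ 16 := by positivity
    calc (p ^ 8) ^ 2 - (q ^ 8) ^ 2 = p ^ 16 - q ^ 16 := by ring
      _ ≤ 16 * (p - q) * p ^ 16 := h3
      _ ≤ 256 * (s - t) * p ^ 16 := by
          apply mul_le_mul_of_nonneg_right _ h4
          linarith
      _ = _ := by ring
  meas := by fun_prop

/-- Pure powers (unbounded profile). -/
lemma WOK_pow (q : ℕ) : WOK (2 ^ q * (1 + 2 * q)) (fun s => s ^ q) where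
  one_le_A := by
    have h1 : (1:ℝ) ≤ 2 ^ q := one_le_pow₀ (by norm_num)
    have h2 : (0:ℝ) ≤ q := by positivity
    nlinarith
  one_le s hs := one_le_pow₀ hs
  mono s t hs hst := pow_le_pow_left₀ (by linarith) hst q
  sub s t hs ht := by
    have h1 : s + t ≤ 2 * (s * t) := by nlinarith
    have h2 : (0:ℝ) ≤ q := by positivity
    have h3 : 0 ≤ s ^ q * t ^ q := by positivity
    have h4 : (0:ℝ) ≤ 2 ^ q := by positivity
    calc (s + t) ^ q ≤ (2 * (s * t)) ^ q := pow_le_pow_left₀ (by linarith) h1 q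
      _ = 2 ^ q * (s ^ q * t ^ q) := by rw [mul_pow, mul_pow]
      _ ≤ 2 ^ q * (1 + 2 * q) * (s ^ q * t ^ q) := by
          apply mul_le_mul_of_nonneg_right _ h3
          nlinarith
      _ = _ := by ring
  lip s t ht hst := by
    have hs : 1 ≤ s := ht.trans hst
    have h0 := sub_nonneg.2 hst
    rw [← pow_mul, ← pow_mul]
    have hb : 1 + ((q * 2 : ℕ) : ℝ) * (t / s - 1) ≤ (1 + (t / s - 1)) ^ (q * 2) := by
      apply one_add_mul_le_pow
      have : 0 ≤ t / s := by positivity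
      linarith
    have e : (1 + (t / s - 1)) ^ (q * 2) * s ^ (q * 2) = t ^ (q * 2) := by
      rw [← mul_pow]; congr 1; field_simp; ring
    have hp : 0 ≤ s ^ (q * 2) := by positivity
    have h5 : t / s - 1 ≥ -(s - t) := by
      have : t / s - 1 = -(s - t) / s := by field_simp; ring
      rw [this, ge_iff_le, le_div_iff₀ (by linarith)]
      nlinarith
    have h1 : (1:ℝ) ≤ 2 ^ q := one_le_pow₀ (by norm_num)
    have h2 : (0:ℝ) ≤ q := by positivity
    have h6 := mul_le_mul_of_nonneg_right hb hp
    rw [e] at h6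
    push_cast at h6
    have h7 : s ^ (q * 2) - t ^ (q * 2) ≤ (2 * q) * (s - t) * s ^ (q * 2) := by
      have : (q:ℝ) * 2 * (t / s - 1) ≥ (q * 2) * (-(s - t)) := by
        apply mul_le_mul_of_nonneg_left h5; positivity
      nlinarith [mul_le_mul_of_nonneg_right this hp]
    refine h7.trans ?_
    apply mul_le_mul_of_nonneg_right _ hp
    apply mul_le_mul_of_nonneg_right _ h0
    nlinarith
  meas := by fun_prop

end HS

open MeasureTheory Set Filter
open scoped ENNReal

namespace HS

section
variable {A σ : ℝ} {W : ℝ → ℝ}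

/-- Upper bound for `μ` by the product of the three multipliers. -/
lemma mu_le_prod (h : WOK A W) (x y z : ℝ) (hs : x + y + z = 0) :
    mm σ W x ^ 2 ≤ 4 * A * (mm σ W x * mm σ W y * mm σ W z) := by
  have h1 := mm_add' (σ := σ) h y z
  have e : mm σ W (y + z) = mm σ W x := by
    rw [show y + z = -x by linarith, mm_neg]
  rw [e] at h1
  have h2 := mm_pos (σ := σ) h x
  nlinarith [mul_le_mul_of_nonneg_left h1 h2.le]

lemma jb_sum_le (x y z : ℝ) (hs : x + y + z = 0) : jb σ x ≤ jb σ y + jb σ z := by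
  have h1 := jb_add_le σ y z
  rwa [show y + z = -x by linarith, jb_neg] at h1

lemma mu_diff (h : WOK A W) (x y z : ℝ) (hs : x + y + z = 0) :
    |mm σ W y ^ 2 - mm σ W z ^ 2| * (jb σ x + jb σ y + jb σ z) ≤
      40 * A ^ 2 * σ ^ 2 * (|y - z| * |x|) * (mm σ W x * mm σ W y * mm σ W z) := by
  have hy := mu_le_prod (σ := σ) h y x z (by linarith)
  have hz := mu_le_prod (σ := σ) h z x y (by linarith)
  have h1 := mu_lip (σ := σ) h y z (4 * A * (mm σ W x * mm σ W y * mm σ W z))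
    (by linarith) (by linarith)
  have h2 := jb_sum_le (σ := σ) x y z hs
  rw [show y + z = -x by linarith, abs_neg] at h1
  have h3 := abs_nonneg (mm σ W y ^ 2 - mm σ W z ^ 2)
  calc _ ≤ |mm σ W y ^ 2 - mm σ W z ^ 2| * (2 * (jb σ y + jb σ z)) :=
        mul_le_mul_of_nonneg_left (by linarith) h3
    _ ≤ _ := by linarith

lemma Mv_bound (h : WOK A W) (x y z : ℝ) (hs : x + y + z = 0) :
    |mm σ W x ^ 2 * x + mm σ W z ^ 2 * y + mm σ W y ^ 2 * z| * (jb σ x + jb σ y + jb σ z) ≤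
      160 * A ^ 2 * σ ^ 2 * (|x| * (x ^ 2 + y ^ 2 + z ^ 2)) * (mm σ W x * mm σ W y * mm σ W z) := by
  have h1 := mu_diff (σ := σ) h x y z hs
  have h2 := mu_diff (σ := σ) h y x z (by linarith)
  have hm : 0 < mm σ W x * mm σ W y * mm σ W z :=
    mul_pos (mul_pos (mm_pos h x) (mm_pos h y)) (mm_pos h z)
  have hJ : 0 < jb σ x + jb σ y + jb σ z :=
    add_pos (add_pos (jb_pos _ _) (jb_pos _ _)) (jb_pos _ _)
  have e : mm σ W x ^ 2 * x + mm σ W z ^ 2 * y + mm σ W y ^ 2 * z =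
    z * (mm σ W y ^ 2 - mm σ W z ^ 2) + x * (mm σ W x ^ 2 - mm σ W z ^ 2) := by
    have : y = -x - z := by linarith
    generalize mm σ W x ^ 2 = a at *
    generalize mm σ W y ^ 2 = b at *
    generalize mm σ W z ^ 2 = c at *
    rw [this]; ring
  rw [e]
  set m := mm σ W x * mm σ W y * mm σ W z
  have h2' : |mm σ W x ^ 2 - mm σ W z ^ 2| * (jb σ x + jb σ y + jb σ z) ≤
      40 * A ^ 2 * σ ^ 2 * (|x - z| * |y|) * m := by
    have e1 : mm σ W y * mm σ W x * mm σ W z = m := by simp only [m]; ring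
    rw [e1] at h2
    linarith
  have b1 : |z| * |y - z| ≤ 2 * (x ^ 2 + y ^ 2 + z ^ 2) := by
    rw [← abs_mul, abs_le]; constructor <;> nlinarith [sq_nonneg (y - z), sq_nonneg (y + z), sq_nonneg x]
  have b2 : |x - z| * |y| ≤ 2 * (x ^ 2 + y ^ 2 + z ^ 2) := by
    rw [← abs_mul, abs_le]
    constructor <;> nlinarith [sq_nonneg (x - y), sq_nonneg (x + y), sq_nonneg (z - y), sq_nonneg (z + y)]
  have hA : 0 ≤ 40 * A ^ 2 * σ ^ 2 * m * |x| := by positivity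
  calc _ ≤ (|z| * |mm σ W y ^ 2 - mm σ W z ^ 2| + |x| * |mm σ W x ^ 2 - mm σ W z ^ 2|)
        * (jb σ x + jb σ y + jb σ z) := by
        apply mul_le_mul_of_nonneg_right _ hJ.le
        rw [← abs_mul, ← abs_mul]; exact abs_add_le _ _
    _ = |z| * (|mm σ W y ^ 2 - mm σ W z ^ 2| * (jb σ x + jb σ y + jb σ z)) +
        |x| * (|mm σ W x ^ 2 - mm σ W z ^ 2| * (jb σ x + jb σ y + jb σ z)) := by ring
    _ ≤ |z| * (40 * A ^ 2 * σ ^ 2 * (|y - z| * |x|) * m) +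
        |x| * (40 * A ^ 2 * σ ^ 2 * (|x - z| * |y|) * m) :=
        add_le_add (mul_le_mul_of_nonneg_left h1 (abs_nonneg _))
          (mul_le_mul_of_nonneg_left h2' (abs_nonneg _))
    _ = (40 * A ^ 2 * σ ^ 2 * m * |x|) * (|z| * |y - z|) +
        (40 * A ^ 2 * σ ^ 2 * m * |x|) * (|x - z| * |y|) := by ring
    _ ≤ (40 * A ^ 2 * σ ^ 2 * m * |x|) * (2 * (x ^ 2 + y ^ 2 + z ^ 2)) +
        (40 * A ^ 2 * σ ^ 2 * m * |x|) * (2 * (x ^ 2 + y ^ 2 + z ^ 2)) :=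
        add_le_add (mul_le_mul_of_nonneg_left b1 hA) (mul_le_mul_of_nonneg_left b2 hA)
    _ = _ := by ring

lemma Mu_bound (h : WOK A W) (x y z : ℝ) (hs : x + y + z = 0) :
    |mm σ W x ^ 2 * x + mm σ W y ^ 2 * y + mm σ W z ^ 2 * z| * (jb σ x + jb σ y + jb σ z) ≤
      160 * A ^ 2 * σ ^ 2 * (|x| * (x ^ 2 + y ^ 2 + z ^ 2)) * (mm σ W x * mm σ W y * mm σ W z) := by
  have h1 := mu_diff (σ := σ) h x y z hs
  have h2 := mu_diff (σ := σ) h y x z (by linarith)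
  have hm : 0 < mm σ W x * mm σ W y * mm σ W z :=
    mul_pos (mul_pos (mm_pos h x) (mm_pos h y)) (mm_pos h z)
  have hJ : 0 < jb σ x + jb σ y + jb σ z :=
    add_pos (add_pos (jb_pos _ _) (jb_pos _ _)) (jb_pos _ _)
  have e : mm σ W x ^ 2 * x + mm σ W y ^ 2 * y + mm σ W z ^ 2 * z =
    y * (mm σ W y ^ 2 - mm σ W z ^ 2) + x * (mm σ W x ^ 2 - mm σ W z ^ 2) := by
    have : z = -x - y := by linarith
    generalize mm σ W x ^ 2 = a at *
    generalize mm σ W y ^ 2 = b at *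
    generalize mm σ W z ^ 2 = c at *
    rw [this]; ring
  rw [e]
  set m := mm σ W x * mm σ W y * mm σ W z
  have h2' : |mm σ W x ^ 2 - mm σ W z ^ 2| * (jb σ x + jb σ y + jb σ z) ≤
      40 * A ^ 2 * σ ^ 2 * (|x - z| * |y|) * m := by
    have e1 : mm σ W y * mm σ W x * mm σ W z = m := by simp only [m]; ring
    rw [e1] at h2
    linarith
  have b1 : |y| * |y - z| ≤ 2 * (x ^ 2 + y ^ 2 + z ^ 2) := by
    rw [← abs_mul, abs_le]; constructor <;> nlinarith [sq_nonneg (y - z), sq_nonneg (y + z), sq_nonneg x]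
  have b2 : |x - z| * |y| ≤ 2 * (x ^ 2 + y ^ 2 + z ^ 2) := by
    rw [← abs_mul, abs_le]
    constructor <;> nlinarith [sq_nonneg (x - y), sq_nonneg (x + y), sq_nonneg (z - y), sq_nonneg (z + y)]
  have hA : 0 ≤ 40 * A ^ 2 * σ ^ 2 * m * |x| := by positivity
  calc _ ≤ (|y| * |mm σ W y ^ 2 - mm σ W z ^ 2| + |x| * |mm σ W x ^ 2 - mm σ W z ^ 2|)
        * (jb σ x + jb σ y + jb σ z) := by
        apply mul_le_mul_of_nonneg_right _ hJ.le
        rw [← abs_mul, ← abs_mul]; exact abs_add_le _ _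
    _ = |y| * (|mm σ W y ^ 2 - mm σ W z ^ 2| * (jb σ x + jb σ y + jb σ z)) +
        |x| * (|mm σ W x ^ 2 - mm σ W z ^ 2| * (jb σ x + jb σ y + jb σ z)) := by ring
    _ ≤ |y| * (40 * A ^ 2 * σ ^ 2 * (|y - z| * |x|) * m) +
        |x| * (40 * A ^ 2 * σ ^ 2 * (|x - z| * |y|) * m) :=
        add_le_add (mul_le_mul_of_nonneg_left h1 (abs_nonneg _))
          (mul_le_mul_of_nonneg_left h2' (abs_nonneg _))
    _ = (40 * A ^ 2 * σ ^ 2 * m * |x|) * (|y| * |y - z|) +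
        (40 * A ^ 2 * σ ^ 2 * m * |x|) * (|x - z| * |y|) := by ring
    _ ≤ (40 * A ^ 2 * σ ^ 2 * m * |x|) * (2 * (x ^ 2 + y ^ 2 + z ^ 2)) +
        (40 * A ^ 2 * σ ^ 2 * m * |x|) * (2 * (x ^ 2 + y ^ 2 + z ^ 2)) :=
        add_le_add (mul_le_mul_of_nonneg_left b1 hA) (mul_le_mul_of_nonneg_left b2 hA)
    _ = _ := by ring

end

/-- Algebra for the smallest frequency. -/
lemma min_freq_aux (x y z : ℝ) (hs : x + y + z = 0) (h1 : |x| ≤ |y|) (h2 : |x| ≤ |z|) :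
    |x| * (x ^ 2 + y ^ 2 + z ^ 2) ≤ 5 * |x * y * z| := by
  have hy : |y| ≤ 2 * |z| := by
    have : |y| ≤ |x| + |z| := by
      rw [show y = -(x + z) by linarith, abs_neg]; exact abs_add_le _ _
    linarith
  have hz : |z| ≤ 2 * |y| := by
    have : |z| ≤ |x| + |y| := by
      rw [show z = -(x + y) by linarith, abs_neg]; exact abs_add_le _ _
    linarith
  rw [abs_mul, abs_mul, ← sq_abs x, ← sq_abs y, ← sq_abs z]
  have := abs_nonneg x
  have := abs_nonneg y
  have := abs_nonneg z
  have h3 : |x| ^ 2 + |y| ^ 2 + |z| ^ 2 ≤ 5 * (|y| * |z|) := by nlinarith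
  nlinarith [mul_le_mul_of_nonneg_left h3 (abs_nonneg x)]

section
variable (a θ σ : ℝ) (W : ℝ → ℝ)

noncomputable def Mu (k x : ℝ) : ℝ :=
  mm σ W k ^ 2 * k + mm σ W x ^ 2 * x + mm σ W (-k - x) ^ 2 * (-k - x)
noncomputable def Mv (k x : ℝ) : ℝ :=
  mm σ W k ^ 2 * k + mm σ W (-k - x) ^ 2 * x + mm σ W x ^ 2 * (-k - x)
/-- cubic resonance function with leading coefficient `c` for the first frequency,
and `d` for the other two -/
def al (c d : ℝ) (k x : ℝ) : ℝ := θ * (c * k ^ 3 + d * x ^ 3 + d * (-k - x) ^ 3)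
noncomputable def Gu (k x : ℝ) : ℝ := Mu σ W k x / al θ a a k x
noncomputable def Gv (k x : ℝ) : ℝ := Mv σ W k x / al θ a 1 k x

/-- The size statement used for both cubic symbols. -/
def GOK (C : ℝ) (G : ℝ → ℝ → ℝ) : Prop :=
  ∀ k x, |G k x| * (jb σ k + jb σ x + jb σ (-k - x)) ≤
    C * σ ^ 2 * (mm σ W k * mm σ W x * mm σ W (-k - x))

variable {a θ σ W} {A : ℝ}

lemma Mu_bound' (h : WOK A W) (k x : ℝ) :
    |Mu σ W k x| * (jb σ k + jb σ x + jb σ (-k - x)) ≤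
      800 * A ^ 2 * σ ^ 2 * |k * x * (-k - x)| * (mm σ W k * mm σ W x * mm σ W (-k - x)) := by
  have hm : 0 < mm σ W k * mm σ W x * mm σ W (-k - x) :=
    mul_pos (mul_pos (mm_pos h _) (mm_pos h _)) (mm_pos h _)
  unfold Mu
  obtain ⟨z, hz⟩ : ∃ z, z = -k - x := ⟨_, rfl⟩
  rw [← hz] at hm ⊢
  have hs : k + x + z = 0 := by rw [hz]; ring
  have fin : ∀ q, q ≤ 5 * |k * x * z| →
      160 * A ^ 2 * σ ^ 2 * q * (mm σ W k * mm σ W x * mm σ W z) ≤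
      800 * A ^ 2 * σ ^ 2 * |k * x * z| * (mm σ W k * mm σ W x * mm σ W z) := by
    intro q hq
    apply mul_le_mul_of_nonneg_right _ hm.le
    have : 0 ≤ 160 * A ^ 2 * σ ^ 2 := by positivity
    nlinarith
  have c1 : |k| ≤ |x| → |k| ≤ |z| → |mm σ W k ^ 2 * k + mm σ W x ^ 2 * x + mm σ W z ^ 2 * z| *
     (jb σ k + jb σ x + jb σ z) ≤
      800 * A ^ 2 * σ ^ 2 * |k * x * z| * (mm σ W k * mm σ W x * mm σ W z) := fun h1 h2 =>
    (Mu_bound (σ := σ) h k x z hs).trans (fin _ (min_freq_aux k x z hs h1 h2))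
  have c2 : |x| ≤ |k| → |x| ≤ |z| → |mm σ W k ^ 2 * k + mm σ W x ^ 2 * x + mm σ W z ^ 2 * z| *
     (jb σ k + jb σ x + jb σ z) ≤
      800 * A ^ 2 * σ ^ 2 * |k * x * z| * (mm σ W k * mm σ W x * mm σ W z) := fun h1 h2 => by
    have := Mu_bound (σ := σ) h x k z (by linarith)
    have e := fin _ ((min_freq_aux x k z (by linarith) h1 h2).trans_eq (by rw [mul_comm x k]))
    rw [add_comm (mm σ W x ^ 2 * x), add_comm (jb σ x), mul_comm (mm σ W x) (mm σ W k)] at this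
    exact this.trans e
  have c3 : |z| ≤ |k| → |z| ≤ |x| → |mm σ W k ^ 2 * k + mm σ W x ^ 2 * x + mm σ W z ^ 2 * z| *
     (jb σ k + jb σ x + jb σ z) ≤
      800 * A ^ 2 * σ ^ 2 * |k * x * z| * (mm σ W k * mm σ W x * mm σ W z) := fun h1 h2 => by
    have := Mu_bound (σ := σ) h z k x (by linarith)
    have e := fin _ ((min_freq_aux z k x (by linarith) h1 h2).trans_eq
      (by rw [show z * k * x = k * x * z by ring]))
    rw [show mm σ W z ^ 2 * z + mm σ W k ^ 2 * k + mm σ W x ^ 2 * x =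
      mm σ W k ^ 2 * k + mm σ W x ^ 2 * x + mm σ W z ^ 2 * z by ring,
      show jb σ z + jb σ k + jb σ x = jb σ k + jb σ x + jb σ z by ring,
      show mm σ W z * mm σ W k * mm σ W x = mm σ W k * mm σ W x * mm σ W z by ring] at this
    exact this.trans e
  rcases le_total |k| |x| with h1 | h1 <;> rcases le_total |k| |z| with h2 | h2 <;>
    rcases le_total |x| |z| with h3 | h3
  · exact c1 h1 h2
  · exact c1 h1 h2
  · exact c3 h2 (h2.trans h1)
  · exact c3 h2 h3
  · exact c2 h1 h3
  · exact c3 (h3.trans h1) h3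
  · exact c2 h1 h3
  · exact c3 h2 h3

lemma al_u (k x : ℝ) : al θ a a k x = 3 * θ * a * (k * x * (-k - x)) := by
  unfold al; ring

lemma abs_al_v (ha' : a < 1 / 4) (hθ : 0 < θ) (k x : ℝ) :
    θ * min 1 (1 - 4 * a) / 6 * (|k| * (k ^ 2 + x ^ 2 + (-k - x) ^ 2)) ≤ |al θ a 1 k x| := by
  have e : al θ a 1 k x = θ * (-k * ((x ^ 2 - x * (-k - x) + (-k - x) ^ 2) - a * k ^ 2)) := by
    unfold al; ring
  obtain ⟨q, hq⟩ : ∃ q, q = x ^ 2 - x * (-k - x) + (-k - x) ^ 2 := ⟨_, rfl⟩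
  have hq1 : k ^ 2 ≤ 4 * q := by rw [hq]; nlinarith [sq_nonneg (k + 2 * x)]
  have hq2 : k ^ 2 + x ^ 2 + (-k - x) ^ 2 ≤ 6 * q := by
    rw [hq]; nlinarith [sq_nonneg (k + 2 * x), sq_nonneg k]
  have hq0 : 0 ≤ q := by nlinarith [sq_nonneg k]
  have h3 : min 1 (1 - 4 * a) * q ≤ q - a * k ^ 2 := by
    rcases le_total a 0 with h | h
    · have : min 1 (1 - 4 * a) * q ≤ 1 * q := mul_le_mul_of_nonneg_right (min_le_left _ _) hq0
      nlinarith [sq_nonneg k]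
    · have : min 1 (1 - 4 * a) * q ≤ (1 - 4 * a) * q := mul_le_mul_of_nonneg_right (min_le_right _ _) hq0
      nlinarith [sq_nonneg k]
  have hmin : 0 < min 1 (1 - 4 * a) := lt_min one_pos (by linarith)
  rw [e, ← hq, abs_mul, abs_mul, abs_of_pos hθ, abs_neg]
  have h4 : 0 ≤ q - a * k ^ 2 := le_trans (by positivity) h3
  rw [abs_of_nonneg h4]
  calc _ = θ * (|k| * (min 1 (1 - 4 * a) * ((k ^ 2 + x ^ 2 + (-k - x) ^ 2) / 6))) := by ring
    _ ≤ θ * (|k| * (min 1 (1 - 4 * a) * q)) := by gcongr; linarith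
    _ ≤ _ := by gcongr

lemma Mu_eq (h : WOK A W) (ha : a ≠ 0) (hθ : 0 < θ) (k x : ℝ) :
    Gu a θ σ W k x * al θ a a k x = Mu σ W k x := by
  unfold Gu
  by_cases h0 : al θ a a k x = 0
  · have h1 := Mu_bound' (σ := σ) h k x
    rw [al_u] at h0
    have : k * x * (-k - x) = 0 := by
      rcases mul_eq_zero.1 h0 with h' | h'
      · exfalso
        rcases mul_eq_zero.1 h' with h'' | h''
        · linarith
        · exact ha h''
      · exact h'
    rw [this] at h1
    simp only [abs_zero, mul_zero, zero_mul] at h1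
    have hJ : 0 < jb σ k + jb σ x + jb σ (-k - x) :=
      add_pos (add_pos (jb_pos _ _) (jb_pos _ _)) (jb_pos _ _)
    have h2 : |Mu σ W k x| ≤ 0 := by
      by_contra hc
      push Not at hc
      nlinarith [mul_pos hc hJ]
    rw [abs_nonpos_iff.1 h2]; simp
  · field_simp

lemma Mv_bound' (h : WOK A W) (k x : ℝ) :
    |Mv σ W k x| * (jb σ k + jb σ x + jb σ (-k - x)) ≤
      160 * A ^ 2 * σ ^ 2 * (|k| * (k ^ 2 + x ^ 2 + (-k - x) ^ 2)) *
        (mm σ W k * mm σ W x * mm σ W (-k - x)) :=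
  Mv_bound h k x (-k - x) (by ring)

lemma Mv_eq (h : WOK A W) (ha' : a < 1 / 4) (hθ : 0 < θ) (k x : ℝ) :
    Gv a θ σ W k x * al θ a 1 k x = Mv σ W k x := by
  unfold Gv
  by_cases h0 : al θ a 1 k x = 0
  · have h1 := Mv_bound' (σ := σ) h k x
    have h3 := abs_al_v ha' hθ k x
    rw [h0, abs_zero] at h3
    have hmin : 0 < min 1 (1 - 4 * a) := lt_min one_pos (by linarith)
    have hP : 0 ≤ |k| * (k ^ 2 + x ^ 2 + (-k - x) ^ 2) := by positivity
    have : |k| * (k ^ 2 + x ^ 2 + (-k - x) ^ 2) = 0 := by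
      have hc : 0 < θ * min 1 (1 - 4 * a) / 6 := by positivity
      nlinarith
    rw [this] at h1
    simp only [mul_zero, zero_mul] at h1
    have hJ : 0 < jb σ k + jb σ x + jb σ (-k - x) :=
      add_pos (add_pos (jb_pos _ _) (jb_pos _ _)) (jb_pos _ _)
    have h2 : |Mv σ W k x| ≤ 0 := by
      by_contra hc
      push Not at hc
      nlinarith [mul_pos hc hJ]
    rw [abs_nonpos_iff.1 h2]; simp
  · field_simp

lemma GOK_aux {M α J c P m D : ℝ} (hD : 0 ≤ D) (hm : 0 < m) (hc : 0 < c)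
    (hM : |M| * J ≤ D * P * m) (hα : c * P ≤ |α|) (hα0 : α ≠ 0) : |M / α| * J ≤ D / c * m := by
  have hpos := abs_pos.2 hα0
  rw [abs_div, div_mul_eq_mul_div, div_le_iff₀ hpos]
  refine hM.trans ?_
  have : P ≤ |α| / c := by rw [le_div_iff₀ hc]; linarith
  calc D * P * m ≤ D * (|α| / c) * m := by gcongr
    _ = _ := by ring

lemma GOK_Gu (h : WOK A W) (ha : a ≠ 0) (hθ : 0 < θ) :
    GOK σ W (800 * A ^ 2 / (3 * θ * |a|)) (Gu a θ σ W) := by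
  intro k x
  have hm : 0 < mm σ W k * mm σ W x * mm σ W (-k - x) :=
    mul_pos (mul_pos (mm_pos h _) (mm_pos h _)) (mm_pos h _)
  have hc : 0 < 3 * θ * |a| := by have := abs_pos.2 ha; positivity
  by_cases h0 : al θ a a k x = 0
  · unfold Gu; rw [h0]; simp; positivity
  · have := GOK_aux (D := 800 * A ^ 2 * σ ^ 2) (P := |k * x * (-k - x)|) (c := 3 * θ * |a|) (α := al θ a a k x)
      (by positivity) hm hc (Mu_bound' (σ := σ) h k x) (by
        rw [al_u, abs_mul (3 * θ * a), abs_mul (3 * θ), abs_of_pos (by positivity : 0 < 3 * θ)]) h0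
    unfold Gu
    refine this.trans_eq ?_
    ring

lemma GOK_Gv (h : WOK A W) (ha' : a < 1 / 4) (hθ : 0 < θ) :
    GOK σ W (160 * A ^ 2 / (θ * min 1 (1 - 4 * a) / 6)) (Gv a θ σ W) := by
  intro k x
  have hm : 0 < mm σ W k * mm σ W x * mm σ W (-k - x) :=
    mul_pos (mul_pos (mm_pos h _) (mm_pos h _)) (mm_pos h _)
  have hmin : 0 < min 1 (1 - 4 * a) := lt_min one_pos (by linarith)
  have hc : 0 < θ * min 1 (1 - 4 * a) / 6 := by positivity
  by_cases h0 : al θ a 1 k x = 0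
  · unfold Gv; rw [h0]; simp; positivity
  · have := GOK_aux (D := 160 * A ^ 2 * σ ^ 2) (c := θ * min 1 (1 - 4 * a) / 6)
      (α := al θ a 1 k x)
      (by positivity) hm hc (Mv_bound' (σ := σ) h k x) (abs_al_v ha' hθ k x) h0
    unfold Gv
    refine this.trans_eq ?_
    ring

lemma Gu_swap (k x : ℝ) : Gu a θ σ W k x = Gu a θ σ W x k := by
  unfold Gu Mu al
  rw [show -k - x = -x - k by ring]
  congr 1 <;> ring

lemma Gu_refl (k x : ℝ) : Gu a θ σ W k (-k - x) = Gu a θ σ W k x := by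
  unfold Gu Mu al
  rw [show -k - (-k - x) = x by ring]
  congr 1 <;> ring

lemma Gv_refl (k x : ℝ) : Gv a θ σ W k (-k - x) = Gv a θ σ W k x := by
  unfold Gv Mv al
  rw [show -k - (-k - x) = x by ring]
  congr 1 <;> ring

lemma Mu_meas (h : WOK A W) : Measurable (fun p : ℝ × ℝ => Mu σ W p.1 p.2) := by
  unfold Mu
  have := mm_meas (σ := σ) h
  fun_prop

lemma Mv_meas (h : WOK A W) : Measurable (fun p : ℝ × ℝ => Mv σ W p.1 p.2) := by
  unfold Mv
  have := mm_meas (σ := σ) h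
  fun_prop

lemma al_meas (c d : ℝ) : Measurable (fun p : ℝ × ℝ => al θ c d p.1 p.2) := by
  unfold al; fun_prop

lemma Gu_meas (h : WOK A W) : Measurable (fun p : ℝ × ℝ => Gu a θ σ W p.1 p.2) :=
  (Mu_meas h).div (al_meas a a)

lemma Gv_meas (h : WOK A W) : Measurable (fun p : ℝ × ℝ => Gv a θ σ W p.1 p.2) :=
  (Mv_meas h).div (al_meas a 1)

end
end HS

open MeasureTheory Set Filter
open scoped ENNReal

namespace HS

/-- distance to the roots of a quadratic -/
lemma quad_dist (ζ D : ℝ) :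
    ∃ ρ, (ρ = Real.sqrt D ∨ ρ = -Real.sqrt D) ∧ (ζ - ρ) ^ 2 ≤ |ζ ^ 2 - D| ∧
      |ζ| * |ζ - ρ| ≤ |ζ ^ 2 - D| := by
  rcases le_total D 0 with hD | hD
  · refine ⟨Real.sqrt D, Or.inl rfl, ?_, ?_⟩
    · rw [Real.sqrt_eq_zero_of_nonpos hD, abs_of_nonneg (by nlinarith [sq_nonneg ζ])]
      nlinarith
    · rw [Real.sqrt_eq_zero_of_nonpos hD, sub_zero, ← sq, sq_abs]
      exact le_trans (by linarith) (le_abs_self _)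
  · have hr := Real.sqrt_nonneg D
    have hr2 := Real.sq_sqrt hD
    set r := Real.sqrt D
    have e : ζ ^ 2 - D = (ζ - r) * (ζ + r) := by rw [← hr2]; ring
    rw [e, abs_mul]
    rcases le_total 0 ζ with hζ | hζ
    · refine ⟨r, Or.inl rfl, ?_, ?_⟩
      · rw [← sq_abs, sq]
        apply mul_le_mul_of_nonneg_left _ (abs_nonneg _)
        rw [abs_of_nonneg (by linarith : 0 ≤ ζ + r), abs_le]; constructor <;> linarith
      · rw [abs_of_nonneg hζ, abs_of_nonneg (by linarith : 0 ≤ ζ + r), mul_comm]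
        apply mul_le_mul_of_nonneg_left _ (abs_nonneg _); linarith
    · refine ⟨-r, Or.inr rfl, ?_, ?_⟩
      · rw [← sq_abs, sq, sub_neg_eq_add]
        apply mul_le_mul_of_nonneg_right _ (abs_nonneg _)
        rw [abs_of_nonpos (by linarith : ζ - r ≤ 0), abs_le]; constructor <;> linarith
      · rw [sub_neg_eq_add, abs_of_nonpos hζ, abs_of_nonpos (by linarith : ζ - r ≤ 0)]
        apply mul_le_mul_of_nonneg_right _ (abs_nonneg _); linarith

/-- Resonance lemma for the mixed quartic phase in reduced variables. -/
lemma res_reduced (a : ℝ) (ha : a ≠ 0) (η : ℝ) (hη : 0 < η) (hη1 : η ≤ 1 / 10) (hη2 : η ≤ |a| / 2)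
    (Z k : ℝ) (X : ℝ) :
    ∃ p, (p = Z ∨ p = -Z / 2 + Real.sqrt (3 * a * k ^ 2 - 3 / 4 * Z ^ 2) ∨
        p = -Z / 2 - Real.sqrt (3 * a * k ^ 2 - 3 / 4 * Z ^ 2)) ∧
      η * ((|X| + |Z| + |k|) * (X - p) ^ 2) ≤
        |X - Z| * |X ^ 2 + X * Z + Z ^ 2 - 3 * a * k ^ 2| := by
  obtain ⟨ρ, hρ, hd1, hd2⟩ := quad_dist (X + Z / 2) (3 * a * k ^ 2 - 3 / 4 * Z ^ 2)
  have e : (X + Z / 2) ^ 2 - (3 * a * k ^ 2 - 3 / 4 * Z ^ 2) =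
    X ^ 2 + X * Z + Z ^ 2 - 3 * a * k ^ 2 := by ring
  rw [e] at hd1 hd2
  set q := X ^ 2 + X * Z + Z ^ 2 - 3 * a * k ^ 2 with hq
  obtain ⟨s, hs⟩ : ∃ s, s = |X| + |Z| + |k| := ⟨_, rfl⟩
  rw [← hs]
  have hs0 : 0 ≤ s := by rw [hs]; positivity
  have hXZ : |X - Z| ≤ s := by
    rw [hs]; have := abs_sub X Z; have := abs_nonneg k; linarith
  have hpt : (-Z / 2 + ρ = Z ∨ -Z / 2 + ρ = -Z / 2 + Real.sqrt (3 * a * k ^ 2 - 3 / 4 * Z ^ 2) ∨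
        -Z / 2 + ρ = -Z / 2 - Real.sqrt (3 * a * k ^ 2 - 3 / 4 * Z ^ 2)) := by
    rcases hρ with h | h
    · right; left; rw [h]
    · right; right; rw [h]; ring
  have hdd : (X - (-Z / 2 + ρ)) = X + Z / 2 - ρ := by ring
  by_cases h1 : η * s ≤ |X - Z|
  · refine ⟨-Z / 2 + ρ, hpt, ?_⟩
    rw [hdd, ← mul_assoc]
    exact mul_le_mul h1 hd1 (sq_nonneg _) (abs_nonneg _)
  by_cases h2 : η * s ^ 2 ≤ |q|
  · refine ⟨Z, Or.inl rfl, ?_⟩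
    rw [← sq_abs (X - Z)]
    have h3 : η * s * |X - Z| ≤ |q| := by
      refine le_trans ?_ h2
      have : 0 ≤ η * s := by positivity
      nlinarith [mul_le_mul_of_nonneg_left hXZ this]
    nlinarith [mul_le_mul_of_nonneg_left h3 (abs_nonneg (X - Z))]
  push Not at h1 h2
  have hspos : 0 < s := by
    rcases hs0.eq_or_lt with h | h
    · exfalso; rw [← h] at h1; simp at h1; linarith [abs_nonneg (X - Z)]
    · exact h
  have h3 : η * s ≤ |X + Z / 2| := by
    by_contra hc
    push Not at hc
    have hZ : |Z| ≤ 4 / 3 * (η * s) := by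
      have : Z = 2 / 3 * ((X + Z / 2) - (X - Z)) := by ring
      rw [this, abs_mul, abs_of_pos (by norm_num : (0:ℝ) < 2 / 3)]
      have := abs_sub (X + Z / 2) (X - Z)
      linarith
    have hX : |X| ≤ 7 / 3 * (η * s) := by
      have : |X| ≤ |X - Z| + |Z| := by
        have := abs_add_le (X - Z) Z; rwa [sub_add_cancel] at this
      linarith
    have hk : s / 2 ≤ |k| := by
      have : η * s ≤ 1 / 10 * s := mul_le_mul_of_nonneg_right hη1 hs0
      rw [hs] at this hX hZ ⊢
      linarith
    have hk2 : s ^ 2 / 4 ≤ k ^ 2 := by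
      rw [← sq_abs k]; nlinarith
    have hq2 : 3 * |a| * k ^ 2 ≤ |q| + ((X + Z / 2) ^ 2 + 3 / 4 * Z ^ 2) := by
      have : 3 * a * k ^ 2 = ((X + Z / 2) ^ 2 + 3 / 4 * Z ^ 2) - q := by rw [hq]; ring
      have h4 : |3 * a * k ^ 2| = 3 * |a| * k ^ 2 := by
        rw [abs_mul, abs_mul, abs_of_nonneg (sq_nonneg k), abs_of_pos (by norm_num : (0:ℝ) < 3)]
      rw [← h4, this]
      refine (abs_sub _ _).trans ?_
      rw [abs_of_nonneg (by positivity : 0 ≤ (X + Z / 2) ^ 2 + 3 / 4 * Z ^ 2)]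
      linarith
    have hz2 : Z ^ 2 ≤ (4 / 3 * (η * s)) ^ 2 := by
      rw [← sq_abs Z]; exact pow_le_pow_left₀ (abs_nonneg _) hZ 2
    have hζ2 : (X + Z / 2) ^ 2 ≤ (η * s) ^ 2 := by
      rw [← sq_abs (X + Z / 2)]; exact pow_le_pow_left₀ (abs_nonneg _) hc.le 2
    have hs2 : 0 < s ^ 2 := by positivity
    have h5 : 3 * |a| * k ^ 2 ≥ 3 * (2 * η) * (s ^ 2 / 4) := by
      apply mul_le_mul _ hk2 (by positivity) (by positivity)
      linarith
    have h6 : η ^ 2 * s ^ 2 ≤ (1 / 10) * η * s ^ 2 := by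
      apply mul_le_mul_of_nonneg_right _ hs2.le
      nlinarith
    nlinarith [mul_pos hη hs2]
  rcases le_total |X - Z| |X + Z / 2 - ρ| with h4 | h4
  · refine ⟨Z, Or.inl rfl, ?_⟩
    rw [← sq_abs (X - Z)]
    have h5 : η * s * |X - Z| ≤ |q| := le_trans (mul_le_mul h3 h4 (abs_nonneg _) (abs_nonneg _)) hd2
    nlinarith [mul_le_mul_of_nonneg_left h5 (abs_nonneg (X - Z))]
  · refine ⟨-Z / 2 + ρ, hpt, ?_⟩
    rw [hdd, ← sq_abs]
    have h5 : η * s * |X + Z / 2 - ρ| ≤ |q| :=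
      le_trans (mul_le_mul_of_nonneg_right h3 (abs_nonneg _)) hd2
    calc η * (s * |X + Z / 2 - ρ| ^ 2) = |X + Z / 2 - ρ| * (η * s * |X + Z / 2 - ρ|) := by ring
      _ ≤ |X - Z| * |q| := mul_le_mul h4 h5 (by positivity) (abs_nonneg _)

/-- Resonance lemma for the mixed phase. -/
lemma res_mixed (a : ℝ) (ha : a ≠ 0) (ha' : a < 1 / 4) : ∃ C : ℝ, 0 < C ∧ ∀ k z : ℝ,
    ∃ p : Fin 3 → ℝ, ∀ x, ∃ i, (|x| + |z| + |k|) * (x - p i) ^ 2 ≤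
      C * |(z - x) * ((1 - a) * (x ^ 2 + x * z + z ^ 2) + 3 * k * (x + z) + 3 * k ^ 2)| := by
  have hb : 0 < 1 - a := by linarith
  set b := 1 - a with hbdef
  set η := min (1 / 10) (|a| / 2) with hη
  have hη0 : 0 < η := lt_min (by norm_num) (by have := abs_pos.2 ha; linarith)
  refine ⟨(2 + b) / (η * b), by positivity, fun k z => ?_⟩
  set k' := k / b with hk'
  have hkk : k = b * k' := by rw [hk']; field_simp
  set Z := z + k'
  refine ⟨![Z - k', -Z / 2 + Real.sqrt (3 * a * k' ^ 2 - 3 / 4 * Z ^ 2) - k',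
    -Z / 2 - Real.sqrt (3 * a * k' ^ 2 - 3 / 4 * Z ^ 2) - k'], fun x => ?_⟩
  obtain ⟨p, hp, hb'⟩ := res_reduced a ha η hη0 (min_le_left _ _) (min_le_right _ _) Z k' (x + k')
  have hQ : (b * (x ^ 2 + x * z + z ^ 2) + 3 * k * (x + z) + 3 * k ^ 2) =
      b * ((x + k') ^ 2 + (x + k') * Z + Z ^ 2 - 3 * a * k' ^ 2) := by
    have : a = 1 - b := by rw [hbdef]; ring
    rw [hkk, this]; simp only [Z]; ring
  have hs : |x| + |z| + |k| ≤ (2 + b) * (|x + k'| + |Z| + |k'|) := by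
    have h1 : |x| ≤ |x + k'| + |k'| := by
      have := abs_sub (x + k') k'; rwa [add_sub_cancel_right] at this
    have h2 : |z| ≤ |Z| + |k'| := by
      have := abs_sub (z + k') k'; rwa [add_sub_cancel_right] at this
    have h3 : |k| = b * |k'| := by rw [hkk, abs_mul, abs_of_pos hb]
    rw [h3]
    nlinarith [abs_nonneg (x + k'), abs_nonneg Z, abs_nonneg k']
  have key : ∀ P, x - P = x + k' - p → (|x| + |z| + |k|) * (x - P) ^ 2 ≤ (2 + b) / (η * b) *
      |(z - x) * (b * (x ^ 2 + x * z + z ^ 2) + 3 * k * (x + z) + 3 * k ^ 2)| := by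
    intro P hP
    rw [hP, hQ, abs_mul, abs_mul b, abs_of_pos hb]
    have e1 : |z - x| = |x + k' - Z| := by
      rw [abs_sub_comm]; congr 1; simp only [Z]; ring
    rw [e1]
    rw [div_mul_eq_mul_div, le_div_iff₀ (by positivity)]
    calc _ ≤ (2 + b) * (|x + k'| + |Z| + |k'|) * (x + k' - p) ^ 2 * (η * b) := by gcongr
      _ = (2 + b) * b * (η * ((|x + k'| + |Z| + |k'|) * (x + k' - p) ^ 2)) := by ring
      _ ≤ (2 + b) * b * (|x + k' - Z| * |(x + k') ^ 2 + (x + k') * Z + Z ^ 2 - 3 * a * k' ^ 2|) := by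
          gcongr
      _ = _ := by ring
  rcases hp with h | h | h
  · exact ⟨0, key _ (by simp [h]; ring)⟩
  · exact ⟨1, key _ (by simp [h]; ring)⟩
  · exact ⟨2, key _ (by simp [h]; ring)⟩

/-- Resonance lemma for a quadratic polynomial. -/
lemma res_quad (c : ℝ) (hc : c ≠ 0) (β r : ℝ) : ∃ p : Fin 3 → ℝ, ∀ x, ∃ i,
    (x - p i) ^ 2 ≤ (1 / |c|) * |c * (x ^ 2 + β * x) + r| := by
  refine ⟨![-β / 2 + Real.sqrt (β ^ 2 / 4 - r / c), -β / 2 - Real.sqrt (β ^ 2 / 4 - r / c), 0], fun x => ?_⟩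
  obtain ⟨ρ, hρ, hd, -⟩ := quad_dist (x + β / 2) (β ^ 2 / 4 - r / c)
  have e : c * (x ^ 2 + β * x) + r = c * ((x + β / 2) ^ 2 - (β ^ 2 / 4 - r / c)) := by
    field_simp; ring
  have hcp := abs_pos.2 hc
  rw [e, abs_mul, ← mul_assoc, one_div_mul_cancel hcp.ne', one_mul]
  rcases hρ with h | h
  · refine ⟨0, le_trans (le_of_eq ?_) hd⟩
    simp [h]; ring
  · refine ⟨1, le_trans (le_of_eq ?_) hd⟩
    simp [h]; ring

/-! Schur integrals -/

lemma lorentz_lint (B C p : ℝ) (hB : 0 < B) (hC : 0 < C) :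
    ∫⁻ x : ℝ, ENNReal.ofReal (2 / (B + (x - p) ^ 2 / C)) =
      ENNReal.ofReal (2 * Real.pi * Real.sqrt C / Real.sqrt B) := by
  set d := Real.sqrt (B * C) with hd
  have hd0 : 0 < d := Real.sqrt_pos.2 (by positivity)
  have hd2 : d ^ 2 = B * C := Real.sq_sqrt (by positivity)
  have e : ∀ x : ℝ, 2 / (B + (x - p) ^ 2 / C) = (2 / B) * (1 + (d⁻¹ * (x - p)) ^ 2)⁻¹ := by
    intro x
    rw [mul_pow, inv_pow, hd2]; field_simp
  simp only [e]
  have hi : Integrable (fun x : ℝ => (2 / B) * (1 + (d⁻¹ * (x - p)) ^ 2)⁻¹) :=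
    ((integrable_inv_one_add_sq.comp_mul_left' (inv_pos.2 hd0).ne').comp_sub_right p).const_mul _
  rw [← ofReal_integral_eq_lintegral_ofReal hi (Eventually.of_forall fun x => by positivity)]
  congr 1
  rw [integral_const_mul]
  have h1 := integral_sub_right_eq_self (fun x : ℝ => (1 + (d⁻¹ * x) ^ 2)⁻¹) (μ := volume) p
  rw [h1]
  have h2 := Measure.integral_comp_mul_left (fun x : ℝ => (1 + x ^ 2)⁻¹) d⁻¹
  rw [h2, integral_univ_inv_one_add_sq, inv_inv, abs_of_pos hd0, smul_eq_mul, hd,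
    Real.sqrt_mul hB.le]
  have := Real.sq_sqrt hB.le
  have hb := Real.sqrt_pos.2 hB
  field_simp
  rw [this]

lemma schur_near (κ Φ : ℝ → ℝ) (hκ : ∀ x, 0 ≤ κ x) (B C : ℝ) (hB : 0 < B) (hC : 0 < C)
    (p : Fin 3 → ℝ) (h : ∀ x, ∃ i, κ x * (x - p i) ^ 2 ≤ C * |Φ x|) :
    ∫⁻ x, ({x | κ x ≠ 0 ∧ |Φ x| ≤ κ x * B} : Set ℝ).indicator 1 x ≤
      ENNReal.ofReal (6 * Real.sqrt C * Real.sqrt B) := by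
  have hsub : ({x | κ x ≠ 0 ∧ |Φ x| ≤ κ x * B} : Set ℝ) ⊆
      ⋃ i, Icc (p i - Real.sqrt (C * B)) (p i + Real.sqrt (C * B)) := by
    rintro x ⟨h1, h2⟩
    obtain ⟨i, hi⟩ := h x
    have hpos : 0 < κ x := lt_of_le_of_ne (hκ x) (Ne.symm h1)
    have h3 : (x - p i) ^ 2 ≤ C * B := by
      have : κ x * (x - p i) ^ 2 ≤ κ x * (C * B) := by nlinarith
      exact le_of_mul_le_mul_left this hpos
    have h4 := abs_le.1 (Real.abs_le_sqrt h3)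
    exact mem_iUnion.2 ⟨i, by constructor <;> linarith [h4.1, h4.2]⟩
  calc _ ≤ ∫⁻ x, (⋃ i, Icc (p i - Real.sqrt (C * B)) (p i + Real.sqrt (C * B))).indicator 1 x :=
        lintegral_mono fun x => indicator_le_indicator_of_subset hsub (fun _ => zero_le) x
    _ = volume (⋃ i, Icc (p i - Real.sqrt (C * B)) (p i + Real.sqrt (C * B))) :=
        lintegral_indicator_one (MeasurableSet.iUnion fun _ => measurableSet_Icc)
    _ ≤ ∑ i : Fin 3, volume (Icc (p i - Real.sqrt (C * B)) (p i + Real.sqrt (C * B))) :=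
        measure_iUnion_fintype_le _ _
    _ = ENNReal.ofReal (6 * Real.sqrt C * Real.sqrt B) := by
        simp only [Real.volume_Icc]
        have : ∀ i, p i + Real.sqrt (C * B) - (p i - Real.sqrt (C * B)) = 2 * Real.sqrt (C * B) :=
          fun i => by ring
        simp only [this, Finset.sum_const, Finset.card_univ, Fintype.card_fin, nsmul_eq_mul]
        rw [← ENNReal.ofReal_natCast, ← ENNReal.ofReal_mul (by positivity), Real.sqrt_mul hC.le]
        congr 1; push_cast; ring

lemma schur_far (κ Φ : ℝ → ℝ) (hκ : ∀ x, 0 ≤ κ x) (B C : ℝ) (hB : 0 < B) (hC : 0 < C)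
    (p : Fin 3 → ℝ) (h : ∀ x, ∃ i, κ x * (x - p i) ^ 2 ≤ C * |Φ x|) :
    ∫⁻ x, ({x | κ x * B < |Φ x|} : Set ℝ).indicator (fun x => ENNReal.ofReal (κ x / |Φ x|)) x ≤
      ENNReal.ofReal (6 * Real.pi * Real.sqrt C / Real.sqrt B) := by
  have hpt : ∀ x, ({x | κ x * B < |Φ x|} : Set ℝ).indicator (fun x => ENNReal.ofReal (κ x / |Φ x|)) x ≤
      ∑ i : Fin 3, ENNReal.ofReal (2 / (B + (x - p i) ^ 2 / C)) := by
    intro x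
    by_cases hx : κ x * B < |Φ x|
    · rw [indicator_of_mem (by exact hx)]
      obtain ⟨i, hi⟩ := h x
      refine le_trans ?_ (Finset.single_le_sum (fun j _ => zero_le) (Finset.mem_univ i))
      apply ENNReal.ofReal_le_ofReal
      have hΦ : 0 < |Φ x| := lt_of_le_of_lt (mul_nonneg (hκ x) hB.le) hx
      rw [div_le_div_iff₀ hΦ (by positivity)]
      have : κ x * (x - p i) ^ 2 / C ≤ |Φ x| := by
        rw [div_le_iff₀ hC]; linarith
      have e : κ x * ((x - p i) ^ 2 / C) = κ x * (x - p i) ^ 2 / C := by ring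
      rw [mul_add, e]; linarith
    · rw [indicator_of_notMem (by exact hx)]; exact zero_le
  calc _ ≤ ∫⁻ x, ∑ i : Fin 3, ENNReal.ofReal (2 / (B + (x - p i) ^ 2 / C)) := lintegral_mono hpt
    _ = ∑ i : Fin 3, ∫⁻ x, ENNReal.ofReal (2 / (B + (x - p i) ^ 2 / C)) :=
        lintegral_finsetSum _ (fun i _ => by fun_prop)
    _ = _ := by
        simp only [lorentz_lint B C _ hB hC, Finset.sum_const, Finset.card_univ, Fintype.card_fin,
          nsmul_eq_mul]
        rw [← ENNReal.ofReal_natCast, ← ENNReal.ofReal_mul (by positivity)]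
        congr 1; push_cast; ring

end HS

open MeasureTheory Set Filter
open scoped ENNReal

namespace HS

section L2
variable {α : Type*} [MeasurableSpace α]

/-- `L²` size of a nonnegative function. -/
noncomputable def L2n (ν : Measure α) (F : α → ℝ≥0∞) : ℝ≥0∞ := (∫⁻ x, F x ^ (2:ℝ) ∂ν) ^ (1/2:ℝ)

lemma L2n_sq (ν : Measure α) (F : α → ℝ≥0∞) : L2n ν F ^ (2:ℝ) = ∫⁻ x, F x ^ (2:ℝ) ∂ν := by
  unfold L2n; rw [← ENNReal.rpow_mul]; norm_num

lemma L2n_CS (ν : Measure α) (F G : α → ℝ≥0∞) (hF : AEMeasurable F ν) (hG : AEMeasurable G ν) :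
    ∫⁻ x, F x * G x ∂ν ≤ L2n ν F * L2n ν G := by
  have := ENNReal.lintegral_mul_le_Lp_mul_Lq ν (p := 2) (q := 2)
    (by constructor <;> norm_num) hF hG
  simpa [L2n] using this

lemma L2n_mono (ν : Measure α) {F G : α → ℝ≥0∞} (h : ∀ x, F x ≤ G x) : L2n ν F ≤ L2n ν G := by
  unfold L2n
  gcongr with x
  exact h x

lemma L2n_add (ν : Measure α) (F G : α → ℝ≥0∞) (hF : AEMeasurable F ν) (hG : AEMeasurable G ν) :
    L2n ν (fun x => F x + G x) ≤ L2n ν F + L2n ν G := by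
  have := ENNReal.lintegral_Lp_add_le (p := 2) hF hG (by norm_num)
  simpa [L2n] using this

lemma L2n_const_mul (ν : Measure α) (c : ℝ≥0∞) (hc : c ≠ ⊤) (F : α → ℝ≥0∞) :
    L2n ν (fun x => c * F x) = c * L2n ν F := by
  unfold L2n
  have : ∀ x, (c * F x) ^ (2:ℝ) = c ^ (2:ℝ) * F x ^ (2:ℝ) := fun x =>
    ENNReal.mul_rpow_of_nonneg _ _ (by norm_num)
  simp only [this]
  rw [lintegral_const_mul' _ _ (ENNReal.rpow_ne_top_of_nonneg (by norm_num) hc),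
    ENNReal.mul_rpow_of_nonneg _ _ (by norm_num), ← ENNReal.rpow_mul]
  norm_num

lemma L2n_le_of_sq (ν : Measure α) (F : α → ℝ≥0∞) (c : ℝ≥0∞)
    (h : ∫⁻ x, F x ^ (2:ℝ) ∂ν ≤ c ^ (2:ℝ)) : L2n ν F ≤ c := by
  unfold L2n
  calc _ ≤ (c ^ (2:ℝ)) ^ (1/2:ℝ) := by gcongr
    _ = c := by rw [← ENNReal.rpow_mul]; norm_num

end L2

lemma rpow_two_mul (a b : ℝ≥0∞) : (a * b) ^ (2:ℝ) = a ^ (2:ℝ) * b ^ (2:ℝ) :=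
  ENNReal.mul_rpow_of_nonneg _ _ (by norm_num)

lemma half_sq (a : ℝ≥0∞) : (a ^ (1/2:ℝ)) ^ (2:ℝ) = a := by
  rw [← ENNReal.rpow_mul]; norm_num

lemma half_mul_half (a : ℝ≥0∞) : a ^ (1/2:ℝ) * a ^ (1/2:ℝ) = a := by
  rw [← ENNReal.rpow_add_of_nonneg _ _ (by norm_num) (by norm_num)]; norm_num

/-- `∫ F(x) G(s - x) dx` type product integrals. -/
lemma lint_shift (F G : ℝ → ℝ≥0∞) (hF : Measurable F) (hG : Measurable G) :
    ∫⁻ k : ℝ, ∫⁻ x : ℝ, F x * G (-k - x) = (∫⁻ x, F x) * ∫⁻ x, G x := by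
  rw [lintegral_lintegral_swap (by fun_prop)]
  have : ∀ x : ℝ, ∫⁻ k : ℝ, F x * G (-k - x) = F x * ∫⁻ k, G k := by
    intro x
    rw [lintegral_const_mul _ (by fun_prop)]
    congr 1
    have h1 := lintegral_sub_left_eq_self (μ := volume) G (-x)
    rw [← h1]; congr 1; ext k; congr 1; ring
  simp only [this]
  rw [lintegral_mul_const _ hF]

lemma lint_shift' (F G : ℝ → ℝ≥0∞) (hF : Measurable F) (hG : Measurable G) :
    ∫⁻ k : ℝ, ∫⁻ x : ℝ, F x * G (k - x) = (∫⁻ x, F x) * ∫⁻ x, G x := by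
  rw [lintegral_lintegral_swap (by fun_prop)]
  have : ∀ x : ℝ, ∫⁻ k : ℝ, F x * G (k - x) = F x * ∫⁻ k, G k := by
    intro x
    rw [lintegral_const_mul _ (by fun_prop)]
    congr 1
    exact lintegral_sub_right_eq_self (μ := volume) G x
  simp only [this]
  rw [lintegral_mul_const _ hF]

abbrev R3 := (ℝ × ℝ) × ℝ

/-- Schur test for the quartic form. -/
lemma schur4 (κ : R3 → ℝ≥0∞) (hκ : Measurable κ) (D : ℝ≥0∞)
    (h1 : ∀ k x, ∫⁻ y, κ ((k, x), y) ≤ D) (h2 : ∀ k y, ∫⁻ x, κ ((k, x), y) ≤ D)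
    (F1 F2 F3 F4 : ℝ → ℝ≥0∞) (m1 : Measurable F1) (m2 : Measurable F2) (m3 : Measurable F3)
    (m4 : Measurable F4) :
    ∫⁻ p : R3, κ p * (F1 p.1.2 * F2 (-p.1.1 - p.1.2) * F3 p.2 * F4 (p.1.1 - p.2)) ≤
      D * (L2n volume F1 * L2n volume F2 * L2n volume F3 * L2n volume F4) := by
  have e : ∀ p : R3, κ p * (F1 p.1.2 * F2 (-p.1.1 - p.1.2) * F3 p.2 * F4 (p.1.1 - p.2)) =
      (κ p ^ (1/2:ℝ) * (F1 p.1.2 * F2 (-p.1.1 - p.1.2))) *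
      (κ p ^ (1/2:ℝ) * (F3 p.2 * F4 (p.1.1 - p.2))) := by
    intro p
    calc _ = (κ p ^ (1/2:ℝ) * κ p ^ (1/2:ℝ)) *
        (F1 p.1.2 * F2 (-p.1.1 - p.1.2) * F3 p.2 * F4 (p.1.1 - p.2)) := by rw [half_mul_half]
      _ = _ := by ring
  simp only [e]
  refine (L2n_CS _ _ _ (by fun_prop) (by fun_prop)).trans ?_
  have b1 : L2n volume (fun p : R3 => κ p ^ (1/2:ℝ) * (F1 p.1.2 * F2 (-p.1.1 - p.1.2))) ≤
      D ^ (1/2:ℝ) * (L2n volume F1 * L2n volume F2) := by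
    apply L2n_le_of_sq
    simp only [rpow_two_mul, half_sq, L2n_sq]
    rw [Measure.volume_eq_prod, lintegral_prod _ (by fun_prop), Measure.volume_eq_prod, lintegral_prod _ (by fun_prop)]
    rw [← lint_shift (fun x => F1 x ^ (2:ℝ)) (fun x => F2 x ^ (2:ℝ)) (by fun_prop) (by fun_prop)]
    rw [← lintegral_const_mul _ (by fun_prop)]
    apply lintegral_mono; intro k
    dsimp only
    rw [← lintegral_const_mul _ (by fun_prop)]
    apply lintegral_mono; intro x
    dsimp only
    rw [lintegral_mul_const _ (by fun_prop)]
    gcongr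
    exact h1 k x
  have b2 : L2n volume (fun p : R3 => κ p ^ (1/2:ℝ) * (F3 p.2 * F4 (p.1.1 - p.2))) ≤
      D ^ (1/2:ℝ) * (L2n volume F3 * L2n volume F4) := by
    apply L2n_le_of_sq
    simp only [rpow_two_mul, half_sq, L2n_sq]
    rw [Measure.volume_eq_prod, lintegral_prod _ (by fun_prop), Measure.volume_eq_prod, lintegral_prod _ (by fun_prop)]
    rw [← lint_shift' (fun x => F3 x ^ (2:ℝ)) (fun x => F4 x ^ (2:ℝ)) (by fun_prop) (by fun_prop)]
    rw [← lintegral_const_mul _ (by fun_prop)]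
    apply lintegral_mono; intro k
    dsimp only
    rw [lintegral_lintegral_swap (by fun_prop), ← lintegral_const_mul _ (by fun_prop)]
    apply lintegral_mono; intro y
    dsimp only
    rw [lintegral_mul_const _ (by fun_prop)]
    gcongr
    exact h2 k y
  calc _ ≤ (D ^ (1/2:ℝ) * (L2n volume F1 * L2n volume F2)) *
        (D ^ (1/2:ℝ) * (L2n volume F3 * L2n volume F4)) := mul_le_mul' b1 b2
    _ = (D ^ (1/2:ℝ) * D ^ (1/2:ℝ)) * (L2n volume F1 * L2n volume F2 * L2n volume F3 * L2n volume F4) := by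
        ring
    _ = _ := by rw [half_mul_half]

lemma L2n_comp_neg_sub (F : ℝ → ℝ≥0∞) (k : ℝ) :
    L2n volume (fun x => F (k - x)) = L2n volume F := by
  unfold L2n
  congr 1
  exact lintegral_sub_left_eq_self (μ := volume) (fun x => F x ^ (2:ℝ)) k

/-- Cubic estimate. -/
lemma cubic3 (F1 F2 F3 : ℝ → ℝ≥0∞) (m1 : Measurable F1) (m2 : Measurable F2) (m3 : Measurable F3) :
    ∫⁻ p : ℝ × ℝ, F1 p.1 * F2 p.2 * F3 (-p.1 - p.2) ≤
      (∫⁻ x, F1 x) * (L2n volume F2 * L2n volume F3) := by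
  rw [Measure.volume_eq_prod, lintegral_prod _ (by fun_prop), ← lintegral_mul_const _ (by fun_prop)]
  apply lintegral_mono; intro k
  dsimp only
  simp only [mul_assoc]
  rw [lintegral_const_mul _ (by fun_prop)]
  gcongr
  refine (L2n_CS _ _ _ (by fun_prop) (by fun_prop)).trans ?_
  rw [L2n_comp_neg_sub F3 (-k)]

/-- Young's inequality `L¹ * L² → L²`. -/
lemma young12 (G F : ℝ → ℝ≥0∞) (mG : Measurable G) (mF : Measurable F) :
    L2n volume (fun ξ => ∫⁻ y, F y * G (ξ - y)) ≤ (∫⁻ x, G x) * L2n volume F := by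
  apply L2n_le_of_sq
  have hpt : ∀ ξ, (∫⁻ y, F y * G (ξ - y)) ^ (2:ℝ) ≤
      (∫⁻ x, G x) * ∫⁻ y, F y ^ (2:ℝ) * G (ξ - y) := by
    intro ξ
    have e : ∀ y, F y * G (ξ - y) = (F y * G (ξ - y) ^ (1/2:ℝ)) * G (ξ - y) ^ (1/2:ℝ) := by
      intro y; rw [mul_assoc, half_mul_half]
    have h := L2n_CS volume (fun y => F y * G (ξ - y) ^ (1/2:ℝ)) (fun y => G (ξ - y) ^ (1/2:ℝ))
      (by fun_prop) (by fun_prop)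
    simp only [← e] at h
    have h2 := ENNReal.rpow_le_rpow h (by norm_num : (0:ℝ) ≤ 2)
    rw [rpow_two_mul, L2n_sq, L2n_sq] at h2
    simp only [rpow_two_mul, half_sq] at h2
    rw [lintegral_sub_left_eq_self (μ := volume) G ξ, mul_comm] at h2
    exact h2
  calc _ ≤ ∫⁻ ξ, (∫⁻ x, G x) * ∫⁻ y, F y ^ (2:ℝ) * G (ξ - y) := lintegral_mono hpt
    _ = (∫⁻ x, G x) * ((∫⁻ x, F x ^ (2:ℝ)) * ∫⁻ x, G x) := by
        rw [lintegral_const_mul _ (by fun_prop), lint_shift' (fun x => F x ^ (2:ℝ)) G (by fun_prop) mG]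
    _ = _ := by
        rw [rpow_two_mul, L2n_sq, ← mul_assoc, mul_comm (∫⁻ x, G x), mul_assoc, mul_comm]
        congr 1
        rw [show (2:ℝ) = ((2:ℕ):ℝ) by norm_num, ENNReal.rpow_natCast, sq]

lemma young12' (G F : ℝ → ℝ≥0∞) (mG : Measurable G) (mF : Measurable F) :
    L2n volume (fun ξ => ∫⁻ y, G y * F (ξ - y)) ≤ (∫⁻ x, G x) * L2n volume F := by
  refine le_trans (le_of_eq ?_) (young12 G F mG mF)
  congr 1; ext ξ
  rw [← lintegral_sub_left_eq_self (μ := volume) (fun y => G y * F (ξ - y)) ξ]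
  congr 1; ext y
  rw [sub_sub_cancel, mul_comm]

/-- `∫ F / J`. -/
lemma lint_div_jb (σ : ℝ) (hσ : 0 < σ) (F : ℝ → ℝ≥0∞) (mF : Measurable F) :
    ∫⁻ x, ENNReal.ofReal (1 / jb σ x) * F x ≤ ENNReal.ofReal (Real.sqrt (Real.pi / σ)) * L2n volume F := by
  have mJ := jb_meas σ
  refine (L2n_CS _ _ _ (by fun_prop) (by fun_prop)).trans ?_
  gcongr
  apply L2n_le_of_sq
  have e : ∀ x, ENNReal.ofReal (1 / jb σ x) ^ (2:ℝ) = ENNReal.ofReal ((1 + (σ * x) ^ 2)⁻¹) := by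
    intro x
    rw [ENNReal.ofReal_rpow_of_nonneg (by have := jb_pos σ x; positivity) (by norm_num)]
    congr 1
    rw [show (2:ℝ) = ((2:ℕ):ℝ) by norm_num, Real.rpow_natCast, div_pow, jb_sq]; simp
  simp only [e]
  have hi : Integrable (fun x : ℝ => (1 + (σ * x) ^ 2)⁻¹) :=
    integrable_inv_one_add_sq.comp_mul_left' hσ.ne'
  rw [← ofReal_integral_eq_lintegral_ofReal hi (Eventually.of_forall fun x => by positivity),
    Measure.integral_comp_mul_left (fun x : ℝ => (1 + x ^ 2)⁻¹) σ, integral_univ_inv_one_add_sq,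
    ENNReal.ofReal_rpow_of_nonneg (Real.sqrt_nonneg _) (by norm_num)]
  apply ENNReal.ofReal_le_ofReal
  rw [show (2:ℝ) = ((2:ℕ):ℝ) by norm_num, Real.rpow_natCast, Real.sq_sqrt (by positivity),
    abs_of_pos (inv_pos.2 hσ), smul_eq_mul]
  apply le_of_eq; field_simp

end HS

open MeasureTheory Set Filter
open scoped ENNReal

namespace HS

/-- Weighted `L²` size. -/
noncomputable def wn (w : ℝ → ℝ) (h : ℝ → ℂ) : ℝ≥0∞ :=
  L2n volume (fun ξ => ENNReal.ofReal (w ξ) * ‖h ξ‖ₑ)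

/-- the basic weight -/
def w1 (ξ : ℝ) : ℝ := 1 + ξ ^ 2

lemma w1_pos (ξ : ℝ) : 0 < w1 ξ := by unfold w1; positivity
lemma one_le_w1 (ξ : ℝ) : 1 ≤ w1 ξ := by unfold w1; nlinarith [sq_nonneg ξ]

lemma w1_temp : Function.HasTemperateGrowth w1 := by
  unfold w1; fun_prop

/-- Multiplication of a Schwartz function by a real function of temperate growth. -/
noncomputable def smS (w : ℝ → ℝ) : SchwartzMap ℝ ℂ →L[ℝ] SchwartzMap ℝ ℂ :=
  SchwartzMap.smulLeftCLM ℂ w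

lemma smS_apply {w : ℝ → ℝ} (hw : Function.HasTemperateGrowth w) (f : SchwartzMap ℝ ℂ) (x : ℝ) :
    smS w f x = (w x : ℂ) * f x := by
  unfold smS
  rw [SchwartzMap.smulLeftCLM_apply_apply hw]
  simp

/-- Schwartz functions with the norm of `L²((1+ξ²)² dξ)`. -/
def S2 : Type := SchwartzMap ℝ ℂ

noncomputable instance : AddCommGroup S2 := inferInstanceAs (AddCommGroup (SchwartzMap ℝ ℂ))
noncomputable instance : Module ℝ S2 := inferInstanceAs (Module ℝ (SchwartzMap ℝ ℂ))
instance : FunLike S2 ℝ ℂ := inferInstanceAs (FunLike (SchwartzMap ℝ ℂ) ℝ ℂ)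

lemma S2.add_apply (f g : S2) (x : ℝ) : (f + g) x = f x + g x := rfl
lemma S2.sub_apply (f g : S2) (x : ℝ) : (f - g) x = f x - g x := rfl
lemma S2.smul_apply (c : ℝ) (f : S2) (x : ℝ) : (c • f) x = (c : ℂ) * f x := by
  change c • (f x) = _
  simp
lemma S2.continuous (f : S2) : Continuous (fun x => f x) := SchwartzMap.continuous (f : SchwartzMap ℝ ℂ)
lemma S2.measurable (f : S2) : Measurable (fun x => f x) := f.continuous.measurable
lemma S2.ext' {f g : S2} (h : ∀ x, f x = g x) : f = g := SchwartzMap.ext (f := (f : SchwartzMap ℝ ℂ)) h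

noncomputable def S2.toL2 : S2 →ₗ[ℝ] Lp ℂ 2 (volume : Measure ℝ) :=
  (SchwartzMap.toLpCLM ℝ ℂ 2 (volume : Measure ℝ)).toLinearMap ∘ₗ (smS w1).toLinearMap

lemma S2.toL2_inj : Function.Injective S2.toL2 := by
  intro f g h
  have h1 : smS w1 f = smS w1 g := SchwartzMap.injective_toLp 2 volume h
  apply S2.ext'
  intro x
  have h2 : smS w1 f x = smS w1 g x := by rw [h1]
  replace h2 : (w1 x : ℂ) * f x = (w1 x : ℂ) * g x :=
    (smS_apply w1_temp f x).symm.trans (h2.trans (smS_apply w1_temp g x))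
  have : (w1 x : ℂ) ≠ 0 := by exact_mod_cast (w1_pos x).ne'
  exact mul_left_cancel₀ this h2

noncomputable instance : NormedAddCommGroup S2 :=
  NormedAddCommGroup.induced S2 (Lp ℂ 2 (volume : Measure ℝ)) S2.toL2.toAddMonoidHom S2.toL2_inj

noncomputable instance : NormedSpace ℝ S2 :=
  NormedSpace.induced ℝ S2 (Lp ℂ 2 (volume : Measure ℝ)) S2.toL2

lemma L2n_eq_eLpNorm (h : ℝ → ℂ) : L2n volume (fun ξ => ‖h ξ‖ₑ) = eLpNorm h 2 volume := by
  rw [eLpNorm_eq_lintegral_rpow_enorm_toReal (by norm_num) (by norm_num)]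
  unfold L2n
  simp

lemma wn_eq_eLpNorm {w : ℝ → ℝ} (hw : ∀ ξ, 0 ≤ w ξ) (h : ℝ → ℂ) :
    wn w h = eLpNorm (fun ξ => (w ξ : ℂ) * h ξ) 2 volume := by
  rw [← L2n_eq_eLpNorm]
  unfold wn
  congr 1; ext ξ
  rw [enorm_mul]
  congr 1
  rw [← ofReal_norm]; simp [abs_of_nonneg (hw ξ)]

lemma wn_schwartz {w : ℝ → ℝ} (hw : Function.HasTemperateGrowth w) (h0 : ∀ ξ, 0 ≤ w ξ)
    (h : SchwartzMap ℝ ℂ) : wn w h = eLpNorm (smS w h) 2 volume := by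
  rw [wn_eq_eLpNorm h0]
  congr 1; ext ξ; rw [smS_apply hw]

lemma wn_schwartz_lt {w : ℝ → ℝ} (hw : Function.HasTemperateGrowth w) (h0 : ∀ ξ, 0 ≤ w ξ)
    (h : SchwartzMap ℝ ℂ) : wn w h < ⊤ := by
  rw [wn_schwartz hw h0]
  exact SchwartzMap.eLpNorm_lt_top _ _ _

lemma S2.norm_eq (h : S2) : ENNReal.ofReal ‖h‖ = wn w1 h := by
  refine Eq.trans ?_ (wn_schwartz w1_temp (fun ξ => (w1_pos ξ).le) h).symm
  change ENNReal.ofReal ‖(smS w1 h).toLp 2 volume‖ = _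
  rw [SchwartzMap.norm_toLp, ENNReal.ofReal_toReal]
  exact (SchwartzMap.eLpNorm_lt_top _ _ _).ne

noncomputable def evalLM (ξ : ℝ) : S2 →ₗ[ℝ] ℂ where
  toFun f := f ξ
  map_add' f g := rfl
  map_smul' c f := rfl

section Lam
variable {α : Type*} [MeasurableSpace α] {n : ℕ}

/-- A general multilinear form. -/
noncomputable def Lam (ν : Measure α) (K : α → ℂ) (e : Fin n → α → ℝ) (h : Fin n → S2) : ℂ :=
  ∫ p, K p * ∏ i, h i (e i p) ∂ν

structure LamOK (ν : Measure α) (K : α → ℂ) (e : Fin n → α → ℝ) (C : ℝ) : Prop where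
  measK : Measurable K
  mease : ∀ i, Measurable (e i)
  C_nonneg : 0 ≤ C
  bound : ∀ h : Fin n → S2, ∫⁻ p, ‖K p‖ₑ * ∏ i, ‖h i (e i p)‖ₑ ∂ν ≤
    ENNReal.ofReal C * ∏ i, ENNReal.ofReal ‖h i‖

variable {ν : Measure α} {K : α → ℂ} {e : Fin n → α → ℝ} {C : ℝ}

lemma enorm_integrand (h : Fin n → S2) (p : α) :
    ‖K p * ∏ i, h i (e i p)‖ₑ = ‖K p‖ₑ * ∏ i, ‖h i (e i p)‖ₑ := by
  rw [enorm_mul]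
  congr 1
  simp only [← ofReal_norm]
  rw [norm_prod, ENNReal.ofReal_prod_of_nonneg (fun i _ => norm_nonneg _)]

lemma LamOK.integrable (ok : LamOK ν K e C) (h : Fin n → S2) :
    Integrable (fun p => K p * ∏ i, h i (e i p)) ν := by
  constructor
  · have h1 := ok.measK
    have h2 : ∀ i, Measurable (fun p => h i (e i p)) := fun i => (h i).measurable.comp (ok.mease i)
    exact (h1.mul (Finset.measurable_prod _ fun i _ => h2 i)).aestronglyMeasurable
  · unfold HasFiniteIntegral
    simp only [enorm_integrand]
    refine (ok.bound h).trans_lt ?_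
    apply ENNReal.mul_lt_top ENNReal.ofReal_lt_top
    exact ENNReal.prod_lt_top (fun i _ => ENNReal.ofReal_lt_top)

noncomputable def prodLM (e : Fin n → α → ℝ) (p : α) : MultilinearMap ℝ (fun _ : Fin n => S2) ℂ :=
  (MultilinearMap.mkPiAlgebra ℝ (Fin n) ℂ).compLinearMap (fun j => evalLM (e j p))

lemma prodLM_apply (p : α) (h : Fin n → S2) : prodLM e p h = ∏ i, h i (e i p) := by
  rw [prodLM, MultilinearMap.compLinearMap_apply, MultilinearMap.mkPiAlgebra_apply]
  rfl

noncomputable def LamM (ok : LamOK ν K e C) : MultilinearMap ℝ (fun _ : Fin n => S2) ℂ where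
  toFun h := Lam ν K e h
  map_update_add' := by
    intro _ h i x y
    unfold Lam
    rw [← integral_add]
    · congr 1; ext p
      simp only [← prodLM_apply]
      rw [← mul_add]
      congr 1
      convert (prodLM e p).map_update_add h i x y
    · convert ok.integrable _
    · convert ok.integrable _
  map_update_smul' := by
    intro _ h i c x
    unfold Lam
    rw [← integral_smul]
    congr 1; ext p
    simp only [← prodLM_apply]
    have := (prodLM e p).map_update_smul h i c x
    rw [← mul_smul_comm]
    congr 1

lemma LamM_apply (ok : LamOK ν K e C) (h : Fin n → S2) : LamM ok h = Lam ν K e h := rfl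

lemma norm_Lam_le_lint (h : Fin n → S2) :
    ENNReal.ofReal ‖Lam ν K e h‖ ≤ ∫⁻ p, ‖K p‖ₑ * ∏ i, ‖h i (e i p)‖ₑ ∂ν := by
  simp only [← enorm_integrand]
  rw [ofReal_norm]
  exact enorm_integral_le_lintegral_enorm _

lemma LamOK.norm_le (ok : LamOK ν K e C) (h : Fin n → S2) : ‖Lam ν K e h‖ ≤ C * ∏ i, ‖h i‖ := by
  have h1 := (norm_Lam_le_lint (ν := ν) (K := K) (e := e) h).trans (ok.bound h)
  rw [← ENNReal.ofReal_prod_of_nonneg (fun i _ => norm_nonneg _), ← ENNReal.ofReal_mul ok.C_nonneg] at h1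
  have hp : 0 ≤ ∏ i, ‖h i‖ := Finset.prod_nonneg fun i _ => norm_nonneg _
  exact (ENNReal.ofReal_le_ofReal_iff (mul_nonneg ok.C_nonneg hp)).1 h1

noncomputable def LamC (ok : LamOK ν K e C) : ContinuousMultilinearMap ℝ (fun _ : Fin n => S2) ℂ :=
  (LamM ok).mkContinuous C (fun h => ok.norm_le h)

lemma Lam_update_add (ok : LamOK ν K e C) (h : Fin n → S2) (i : Fin n) (x y : S2) :
    Lam ν K e (Function.update h i (x + y)) =
      Lam ν K e (Function.update h i x) + Lam ν K e (Function.update h i y) :=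
  (LamM ok).map_update_add h i x y

theorem Lam_hasDeriv (ok : LamOK ν K e C) (h : Fin n → ℝ → S2) (h' P N : Fin n → S2) (φ : Fin n → ℝ → ℝ)
    (Φ : α → ℝ) (s : Set ℝ) (t : ℝ)
    (hd : ∀ i, HasDerivWithinAt (h i) (h' i) s t)
    (hdec : ∀ i, h' i = P i + N i)
    (hP : ∀ i ξ, P i ξ = Complex.I * φ i ξ * h i t ξ)
    (hΦ : ∀ p, Φ p = ∑ i, φ i (e i p)) :
    HasDerivWithinAt (fun τ => Lam ν K e (fun i => h i τ))
      (Complex.I * Lam ν (fun p => K p * Φ p) e (fun i => h i t) +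
        ∑ i, Lam ν K e (Function.update (fun j => h j t) i (N i))) s t := by
  have h1 : HasDerivWithinAt (fun τ => (fun i => h i τ)) (fun i => h' i) s t :=
    hasDerivWithinAt_pi.2 hd
  have h2 := ((LamC ok).hasFDerivAt (fun i => h i t)).comp_hasDerivWithinAt t h1
  have e1 : ((LamC ok).linearDeriv (fun i => h i t)) (fun i => h' i) =
      Complex.I * Lam ν (fun p => K p * Φ p) e (fun i => h i t) +
        ∑ i, Lam ν K e (Function.update (fun j => h j t) i (N i)) := by
    rw [ContinuousMultilinearMap.linearDeriv_apply]
    have : ∀ i, LamC ok (Function.update (fun j => h j t) i (h' i)) =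
        Lam ν K e (Function.update (fun j => h j t) i (P i)) +
        Lam ν K e (Function.update (fun j => h j t) i (N i)) := by
      intro i
      rw [hdec, ← Lam_update_add ok]; rfl
    simp only [this, Finset.sum_add_distrib]
    congr 1
    unfold Lam
    rw [← integral_finsetSum _ (fun i _ => ok.integrable _), ← integral_const_mul]
    congr 1; ext p
    have e2 : ∀ i, ∏ j, (Function.update (fun j => h j t) i (P i) j) (e j p) =
        Complex.I * φ i (e i p) * ∏ j, h j t (e j p) := by
      intro i
      rw [← Finset.mul_prod_erase _ _ (Finset.mem_univ i),
        ← Finset.mul_prod_erase _ (fun j => h j t (e j p)) (Finset.mem_univ i)]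
      rw [Function.update_self, hP, mul_assoc]
      congr 2
      apply Finset.prod_congr rfl
      intro j hj
      rw [Function.update_of_ne (Finset.ne_of_mem_erase hj)]
    simp only [e2, hΦ]
    rw [← Finset.mul_sum, ← Finset.sum_mul, ← Finset.mul_sum]
    push_cast
    ring
  rw [e1] at h2
  exact h2

lemma Lam_phase_integrable (ok : LamOK ν K e C) (h : Fin n → S2) (P : Fin n → S2) (φ : Fin n → ℝ → ℝ)
    (Φ : α → ℝ) (hP : ∀ i ξ, P i ξ = Complex.I * φ i ξ * h i ξ)
    (hΦ : ∀ p, Φ p = ∑ i, φ i (e i p)) :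
    Integrable (fun p => K p * Φ p * ∏ i, h i (e i p)) ν := by
  have h1 : Integrable (fun p => ∑ i, K p * ∏ j, (Function.update h i (P i) j) (e j p)) ν :=
    integrable_finsetSum _ (fun i _ => ok.integrable _)
  have h2 := h1.const_mul (-Complex.I)
  refine h2.congr (Eventually.of_forall fun p => ?_)
  have e2 : ∀ i, ∏ j, (Function.update h i (P i) j) (e j p) =
      Complex.I * φ i (e i p) * ∏ j, h j (e j p) := by
    intro i
    rw [← Finset.mul_prod_erase _ _ (Finset.mem_univ i),
      ← Finset.mul_prod_erase _ (fun j => h j (e j p)) (Finset.mem_univ i)]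
    rw [Function.update_self, hP, mul_assoc]
    congr 2
    apply Finset.prod_congr rfl
    intro j hj
    rw [Function.update_of_ne (Finset.ne_of_mem_erase hj)]
  simp only [e2, hΦ]
  rw [← Finset.mul_sum, ← Finset.sum_mul, ← Finset.mul_sum]
  push_cast
  linear_combination (-(K p * (∑ i, (φ i (e i p) : ℂ)) * ∏ i, h i (e i p))) * Complex.I_sq
end Lam

end HS

open MeasureTheory Set Filter
open scoped ENNReal

namespace HS

/-- The four frequencies. -/
def e4 : Fin 4 → R3 → ℝ := ![fun p => p.1.2, fun p => -p.1.1 - p.1.2, fun p => p.2, fun p => p.1.1 - p.2]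

lemma e4_meas (i : Fin 4) : Measurable (e4 i) := by
  fin_cases i <;> simp only [e4] <;> simp <;> fun_prop

lemma prod_e4 {M : Type*} [CommMonoid M] (F : Fin 4 → ℝ → M) (p : R3) :
    ∏ i, F i (e4 i p) = F 0 p.1.2 * F 1 (-p.1.1 - p.1.2) * F 2 p.2 * F 3 (p.1.1 - p.2) := by
  rw [Fin.prod_univ_four]; rfl

lemma quart_bound (κ : R3 → ℝ≥0∞) (hκ : Measurable κ) (D : ℝ≥0∞)
    (h1 : ∀ k x, ∫⁻ y, κ ((k, x), y) ≤ D) (h2 : ∀ k y, ∫⁻ x, κ ((k, x), y) ≤ D)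
    (w : Fin 4 → ℝ → ℝ) (hw : ∀ i, Measurable (w i)) (K : R3 → ℂ)
    (hK : ∀ p, ‖K p‖ₑ ≤ κ p * ∏ i, ENNReal.ofReal (w i (e4 i p))) (h : Fin 4 → S2) :
    ∫⁻ p, ‖K p‖ₑ * ∏ i, ‖h i (e4 i p)‖ₑ ≤ D * ∏ i, wn (w i) (h i) := by
  have mh : ∀ i, Measurable (fun ξ => ENNReal.ofReal (w i ξ) * ‖h i ξ‖ₑ) := by
    intro i
    have h1 := hw i
    have h2 := (h i).measurable
    fun_prop
  have := schur4 κ hκ D h1 h2 _ _ _ _ (mh 0) (mh 1) (mh 2) (mh 3)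
  refine le_trans ?_ (this.trans (le_of_eq ?_))
  · apply lintegral_mono; intro p
    dsimp only
    rw [← prod_e4 (fun i ξ => ENNReal.ofReal (w i ξ) * ‖h i ξ‖ₑ), Finset.prod_mul_distrib, ← mul_assoc]
    gcongr
    exact hK p
  · rw [Fin.prod_univ_four]; rfl

/-- Quartic kernels. -/
structure QOK (σ : ℝ) (W : ℝ → ℝ) (C : ℝ) (K κ Φ : R3 → ℝ) : Prop where
  C_pos : 0 < C
  mK : Measurable K
  mκ : Measurable κ
  mΦ : Measurable Φ
  κ_nonneg : ∀ p, 0 ≤ κ p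
  q1 : ∀ p, |K p| ≤ C * σ * ∏ i, mm σ W (e4 i p)
  q2 : ∀ p j, |K p| * jb σ (e4 j p) ≤ C * σ ^ 2 * κ p * ∏ i, mm σ W (e4 i p)
  rx : ∀ k y, ∃ q : Fin 3 → ℝ, ∀ x, ∃ i, κ ((k, x), y) * (x - q i) ^ 2 ≤ C * |Φ ((k, x), y)|
  ry : ∀ k x, ∃ q : Fin 3 → ℝ, ∀ y, ∃ i, κ ((k, x), y) * (y - q i) ^ 2 ≤ C * |Φ ((k, x), y)|

noncomputable def Kfar (B : ℝ) (K κ Φ : R3 → ℝ) (p : R3) : ℂ :=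
  (({p | κ p * B < |Φ p|} : Set R3).indicator (fun p => K p / Φ p) p : ℝ)

noncomputable def Knear (B : ℝ) (K κ Φ : R3 → ℝ) (p : R3) : ℂ :=
  (({p | |Φ p| ≤ κ p * B} : Set R3).indicator K p : ℝ)

section
variable {A σ C B : ℝ} {W : ℝ → ℝ} {K κ Φ : R3 → ℝ}

lemma Kfar_meas (q : QOK σ W C K κ Φ) : Measurable (Kfar B K κ Φ) := by
  have h1 := q.mK
  have h2 := q.mκ
  have h3 := q.mΦ
  have : MeasurableSet ({p | κ p * B < |Φ p|} : Set R3) :=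
    measurableSet_lt (by fun_prop) (by fun_prop)
  exact Complex.measurable_ofReal.comp ((h1.div h3).indicator this)

lemma Knear_meas (q : QOK σ W C K κ Φ) : Measurable (Knear B K κ Φ) := by
  have h1 := q.mK
  have h2 := q.mκ
  have h3 := q.mΦ
  have : MeasurableSet ({p | |Φ p| ≤ κ p * B} : Set R3) :=
    measurableSet_le (by fun_prop) (by fun_prop)
  exact Complex.measurable_ofReal.comp (h1.indicator this)

lemma K_split (q : QOK σ W C K κ Φ) (hB : 0 < B) (p : R3) :
    (K p : ℂ) = Knear B K κ Φ p + Kfar B K κ Φ p * Φ p := by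
  unfold Knear Kfar
  have hk := q.κ_nonneg p
  by_cases hp : κ p * B < |Φ p|
  · rw [indicator_of_notMem (by simpa using hp), indicator_of_mem (by exact hp)]
    have : Φ p ≠ 0 := by
      intro h0; rw [h0, abs_zero] at hp; nlinarith
    have : (Φ p : ℂ) ≠ 0 := by exact_mod_cast this
    push_cast; field_simp; simp
  · rw [indicator_of_notMem (s := {p | κ p * B < |Φ p|}) (by exact hp),
      indicator_of_mem (by simpa using hp)]
    simp

lemma enorm_real (x : ℝ) : ‖(x : ℂ)‖ₑ = ENNReal.ofReal |x| := by
  rw [← ofReal_norm]; simp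

lemma near_bound (h : WOK A W) (q : QOK σ W C K κ Φ) (hσ : 0 < σ) (hB : 0 < B) (hs : Fin 4 → S2) :
    ∫⁻ p, ‖Knear B K κ Φ p‖ₑ * ∏ i, ‖hs i (e4 i p)‖ₑ ≤
      ENNReal.ofReal (C * σ) * ENNReal.ofReal (6 * Real.sqrt C * Real.sqrt B) * ∏ i, wn (mm σ W) (hs i) := by
  have hC := q.C_pos
  have m1 := q.mK
  have m2 := q.mκ
  have m3 := q.mΦ
  set S : Set R3 := {p | κ p ≠ 0 ∧ |Φ p| ≤ κ p * B} with hS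
  have mS : MeasurableSet S := by
    apply MeasurableSet.inter
    · exact m2 (measurableSet_singleton 0).compl
    · exact measurableSet_le (f := fun p => |Φ p|) (g := fun p => κ p * B) (by fun_prop) (by fun_prop)
  refine quart_bound (fun p => ENNReal.ofReal (C * σ) * S.indicator 1 p) ?_ _ ?_ ?_
    (fun _ => mm σ W) (fun _ => mm_meas h) _ ?_ hs
  · exact (measurable_one.indicator mS).const_mul _
  · intro k x
    rw [lintegral_const_mul']
    · gcongr
      obtain ⟨z, hz⟩ := q.ry k x
      exact schur_near (fun y => κ ((k, x), y)) (fun y => Φ ((k, x), y)) (fun _ => q.κ_nonneg _) B C hB hC z hz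
    · exact ENNReal.ofReal_ne_top
  · intro k y
    rw [lintegral_const_mul']
    · gcongr
      obtain ⟨z, hz⟩ := q.rx k y
      exact schur_near (fun x => κ ((k, x), y)) (fun x => Φ ((k, x), y)) (fun _ => q.κ_nonneg _) B C hB hC z hz
    · exact ENNReal.ofReal_ne_top
  · intro p
    have hpos : ∀ i, 0 < mm σ W (e4 i p) := fun i => mm_pos h _
    rw [← ENNReal.ofReal_prod_of_nonneg (fun i _ => (hpos i).le)]
    unfold Knear
    rw [enorm_real]
    by_cases hp : |Φ p| ≤ κ p * B
    · rw [indicator_of_mem (by exact hp)]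
      by_cases hk : κ p = 0
      · have := q.q2 p 0
        rw [hk] at this
        have h0 := jb_pos σ (e4 0 p)
        have : |K p| = 0 := by
          have := abs_nonneg (K p)
          nlinarith
        rw [this]; simp
      · rw [indicator_of_mem (by exact ⟨hk, hp⟩), Pi.one_apply, mul_one, ← ENNReal.ofReal_mul (by positivity)]
        exact ENNReal.ofReal_le_ofReal (q.q1 p)
    · rw [indicator_of_notMem (by exact hp)]; simp

lemma far_bound (h : WOK A W) (q : QOK σ W C K κ Φ) (hB : 0 < B) (j : Fin 4) (hs : Fin 4 → S2) :
    ∫⁻ p, ‖Kfar B K κ Φ p‖ₑ * ∏ i, ‖hs i (e4 i p)‖ₑ ≤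
      ENNReal.ofReal (C * σ ^ 2) * ENNReal.ofReal (6 * Real.pi * Real.sqrt C / Real.sqrt B) *
        ∏ i, wn (fun ξ => if i = j then mm σ W ξ / jb σ ξ else mm σ W ξ) (hs i) := by
  have hC := q.C_pos
  have m1 := q.mK
  have m2 := q.mκ
  have m3 := q.mΦ
  have mJ := jb_meas σ
  have mM := mm_meas (σ := σ) h
  set S : Set R3 := {p | κ p * B < |Φ p|} with hS
  have mS : MeasurableSet S := measurableSet_lt (by fun_prop) (by fun_prop)
  refine quart_bound (fun p => ENNReal.ofReal (C * σ ^ 2) *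
    S.indicator (fun p => ENNReal.ofReal (κ p / |Φ p|)) p) ?_ _ ?_ ?_
    (fun i ξ => if i = j then mm σ W ξ / jb σ ξ else mm σ W ξ) ?_ _ ?_ hs
  · refine Measurable.const_mul (Measurable.indicator ?_ mS) _
    fun_prop
  · intro k x
    rw [lintegral_const_mul']
    · gcongr
      obtain ⟨z, hz⟩ := q.ry k x
      exact schur_far (fun y => κ ((k, x), y)) (fun y => Φ ((k, x), y)) (fun _ => q.κ_nonneg _) B C hB hC z hz
    · exact ENNReal.ofReal_ne_top
  · intro k y
    rw [lintegral_const_mul']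
    · gcongr
      obtain ⟨z, hz⟩ := q.rx k y
      exact schur_far (fun x => κ ((k, x), y)) (fun x => Φ ((k, x), y)) (fun _ => q.κ_nonneg _) B C hB hC z hz
    · exact ENNReal.ofReal_ne_top
  · intro i
    by_cases hij : i = j
    · simp only [hij, if_true]; fun_prop
    · simp only [hij, if_false]; fun_prop
  · intro p
    have hpos : ∀ i, 0 < mm σ W (e4 i p) := fun i => mm_pos h _
    have hJ := jb_pos σ (e4 j p)
    have hpos' : ∀ i, 0 ≤ (if i = j then mm σ W (e4 i p) / jb σ (e4 i p) else mm σ W (e4 i p)) := by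
      intro i
      have := hpos i
      have := jb_pos σ (e4 i p)
      split_ifs <;> positivity
    rw [← ENNReal.ofReal_prod_of_nonneg (fun i _ => hpos' i)]
    have hprod : (∏ i, if i = j then mm σ W (e4 i p) / jb σ (e4 i p) else mm σ W (e4 i p)) =
        (∏ i, mm σ W (e4 i p)) / jb σ (e4 j p) := by
      rw [← Finset.mul_prod_erase _ _ (Finset.mem_univ j),
        ← Finset.mul_prod_erase _ (fun i => mm σ W (e4 i p)) (Finset.mem_univ j)]
      rw [if_pos rfl, Finset.prod_congr rfl (g := fun i => mm σ W (e4 i p))]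
      · ring
      · intro i hi
        rw [if_neg (Finset.ne_of_mem_erase hi)]
    rw [hprod]
    unfold Kfar
    rw [enorm_real]
    by_cases hp : p ∈ S
    · rw [indicator_of_mem hp, indicator_of_mem hp, ← ENNReal.ofReal_mul (by positivity), ← ENNReal.ofReal_mul
        (by have := q.κ_nonneg p; positivity)]
      apply ENNReal.ofReal_le_ofReal
      have hΦ : 0 < |Φ p| := lt_of_le_of_lt (mul_nonneg (q.κ_nonneg p) hB.le) hp
      rw [abs_div, div_le_iff₀ hΦ]
      have := q.q2 p j
      rw [← le_div_iff₀ hJ] at this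
      refine this.trans (le_of_eq ?_)
      field_simp
    · rw [indicator_of_notMem hp]; simp

end
end HS

open MeasureTheory Set Filter
open scoped ENNReal

namespace HS
section
variable {A σ C a θ : ℝ} {W : ℝ → ℝ} {G : ℝ → ℝ → ℝ}

lemma jb_min (x y ξ : ℝ) (hξ : ξ = x + y) : jb σ x ≤ 2 * jb σ ξ * min (jb σ x) (jb σ y) ∧
    jb σ y ≤ 2 * jb σ ξ * min (jb σ x) (jb σ y) := by
  have h1 := jb_sum_le (σ := σ) x y (-ξ) (by rw [hξ]; ring)
  have h2 := jb_sum_le (σ := σ) y x (-ξ) (by rw [hξ]; ring)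
  rw [jb_neg] at h1 h2
  have := one_le_jb σ x
  have := one_le_jb σ y
  have := one_le_jb σ ξ
  rcases le_total (jb σ x) (jb σ y) with h | h
  · rw [min_eq_left h]; constructor <;> nlinarith
  · rw [min_eq_right h]; constructor <;> nlinarith

lemma core_G (h : WOK A W) (hG : GOK σ W C G) (hC : 0 ≤ C) (k x y : ℝ) (j : Fin 4) :
    |G k x| * jb σ (e4 j ((k, x), y)) ≤ 8 * A * C * σ ^ 2 * ∏ i, mm σ W (e4 i ((k, x), y)) := by
  have hg := hG k x
  have hA := h.one_le_A
  rw [prod_e4 (fun _ => mm σ W)]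
  dsimp only
  have hm := mm_add (σ := σ) h y (k - y)
  rw [show y + (k - y) = k by ring] at hm
  have hj := jb_min (σ := σ) y (k - y) k (by ring)
  have m1 := one_le_jb σ y
  have m2 := one_le_jb σ (k - y)
  set μ := min (jb σ y) (jb σ (k - y)) with hμ
  have hμ1 : 1 ≤ μ := le_min m1 m2
  have hμ2 : 1 ≤ μ ^ 2 := one_le_pow₀ hμ1
  have j1 := one_le_jb σ k
  have j2 := one_le_jb σ x
  have j3 := one_le_jb σ (-k - x)
  have hJ : jb σ (e4 j ((k, x), y)) ≤ 2 * (jb σ k + jb σ x + jb σ (-k - x)) * μ ^ 2 := by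
    fin_cases j
    · change jb σ x ≤ _
      nlinarith
    · change jb σ (-k - x) ≤ _
      nlinarith
    · change jb σ y ≤ _
      refine hj.1.trans ?_
      nlinarith [mul_nonneg (by linarith : 0 ≤ μ) (by linarith : 0 ≤ μ - 1), mul_pos (by linarith : 0 < jb σ k) (by linarith : 0 < μ)]
    · change jb σ (k - y) ≤ _
      refine hj.2.trans ?_
      nlinarith [mul_nonneg (by linarith : 0 ≤ μ) (by linarith : 0 ≤ μ - 1), mul_pos (by linarith : 0 < jb σ k) (by linarith : 0 < μ)]
  have p1 := mm_pos (σ := σ) h x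
  have p2 := mm_pos (σ := σ) h (-k - x)
  calc |G k x| * jb σ (e4 j ((k, x), y))
      ≤ |G k x| * (2 * (jb σ k + jb σ x + jb σ (-k - x)) * μ ^ 2) := by gcongr
    _ = 2 * (|G k x| * (jb σ k + jb σ x + jb σ (-k - x))) * μ ^ 2 := by ring
    _ ≤ 2 * (C * σ ^ 2 * (mm σ W k * mm σ W x * mm σ W (-k - x))) * μ ^ 2 := by gcongr
    _ = 2 * C * σ ^ 2 * (mm σ W x * mm σ W (-k - x)) * (mm σ W k * μ ^ 2) := by ring
    _ ≤ 2 * C * σ ^ 2 * (mm σ W x * mm σ W (-k - x)) * (4 * A * (mm σ W y * mm σ W (k - y))) := by gcongr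
    _ = _ := by ring

/-- First family of quartic kernels. -/
def KA (G : ℝ → ℝ → ℝ) (p : R3) : ℝ := p.1.1 * G p.1.1 p.1.2
def ΦA (θ c d : ℝ) (p : R3) : ℝ :=
  θ * c * p.1.2 ^ 3 + θ * c * (-p.1.1 - p.1.2) ^ 3 + θ * d * p.2 ^ 3 + θ * d * (p.1.1 - p.2) ^ 3
/-- Second family. -/
def KB (G : ℝ → ℝ → ℝ) (p : R3) : ℝ := p.2 * G p.1.1 p.1.2
def ΦB (θ a : ℝ) (p : R3) : ℝ :=
  θ * a * p.1.2 ^ 3 + θ * 1 * (-p.1.1 - p.1.2) ^ 3 + θ * 1 * p.2 ^ 3 + θ * a * (p.1.1 - p.2) ^ 3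

lemma res_A (c β r s k x : ℝ) (hc : c ≠ 0) (E : ℝ) (hE : 1 / |c| ≤ E) {p : ℝ}
    (h : (x - p) ^ 2 ≤ (1 / |c|) * |c * (x ^ 2 + β * x) + r|) (hs : s = k * (c * (x ^ 2 + β * x) + r)) :
    |k| * (x - p) ^ 2 ≤ E * |s| := by
  rw [hs, abs_mul]
  calc |k| * (x - p) ^ 2 ≤ |k| * ((1 / |c|) * |c * (x ^ 2 + β * x) + r|) := by gcongr
    _ ≤ |k| * (E * |c * (x ^ 2 + β * x) + r|) := by gcongr
    _ = _ := by ring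

lemma QOK_A (h : WOK A W) (hσ : 0 < σ) (hG : GOK σ W C G) (hC : 0 ≤ C)
    (mG : Measurable (fun p : ℝ × ℝ => G p.1 p.2)) (hθ : 0 < θ) (c d : ℝ) (hc : c ≠ 0) (hd : d ≠ 0) (E : ℝ)
    (h1 : 8 * A * C ≤ E) (h2 : 1 / |3 * θ * c| ≤ E) (h3 : 1 / |3 * θ * d| ≤ E) :
    QOK σ W E (KA G) (fun p => |p.1.1|) (ΦA θ c d) where
  C_pos := by
    have : 0 < 1 / |3 * θ * c| := by positivity
    linarith
  mK := by
    unfold KA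
    exact (measurable_fst.fst).mul (mG.comp measurable_fst)
  mκ := by fun_prop
  mΦ := by unfold ΦA; fun_prop
  κ_nonneg p := abs_nonneg _
  q1 p := by
    obtain ⟨⟨k, x⟩, y⟩ := p
    have hA := h.one_le_A
    have hm : 0 < ∏ i, mm σ W (e4 i ((k, x), y)) := Finset.prod_pos fun i _ => mm_pos h _
    have hg := hG k x
    have hj := abs_le_jb σ k
    have hma := mm_add' (σ := σ) h y (k - y)
    rw [show y + (k - y) = k by ring] at hma
    rw [prod_e4 (fun _ => mm σ W)] at hm ⊢
    dsimp only at hm ⊢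
    unfold KA
    dsimp only
    rw [abs_mul]
    rw [abs_mul, abs_of_pos hσ] at hj
    have p1 := mm_pos (σ := σ) h x
    have p2 := mm_pos (σ := σ) h (-k - x)
    have := one_le_jb σ x
    have := one_le_jb σ (-k - x)
    have key : σ * (|k| * |G k x|) ≤ σ * (E * σ * (mm σ W x * mm σ W (-k - x) * mm σ W y * mm σ W (k - y))) := by
      calc σ * (|k| * |G k x|) = |G k x| * (σ * |k|) := by ring
        _ ≤ |G k x| * (jb σ k + jb σ x + jb σ (-k - x)) := by gcongr; linarith
        _ ≤ C * σ ^ 2 * (mm σ W k * mm σ W x * mm σ W (-k - x)) := hg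
        _ ≤ C * σ ^ 2 * (4 * A * (mm σ W y * mm σ W (k - y)) * mm σ W x * mm σ W (-k - x)) := by gcongr
        _ = (4 * A * C) * (σ ^ 2 * (mm σ W x * mm σ W (-k - x) * mm σ W y * mm σ W (k - y))) := by ring
        _ ≤ E * (σ ^ 2 * (mm σ W x * mm σ W (-k - x) * mm σ W y * mm σ W (k - y))) := by
            gcongr
            nlinarith [mul_nonneg (by linarith : 0 ≤ A) hC]
        _ = _ := by ring
    exact le_of_mul_le_mul_left key hσ
  q2 p j := by
    obtain ⟨⟨k, x⟩, y⟩ := p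
    have hm : 0 < ∏ i, mm σ W (e4 i ((k, x), y)) := Finset.prod_pos fun i _ => mm_pos h _
    have hg := core_G h hG hC k x y j
    unfold KA
    rw [abs_mul]
    dsimp only
    calc |k| * |G k x| * jb σ (e4 j ((k, x), y)) = |k| * (|G k x| * jb σ (e4 j ((k, x), y))) := by ring
      _ ≤ |k| * (8 * A * C * σ ^ 2 * ∏ i, mm σ W (e4 i ((k, x), y))) := by gcongr
      _ ≤ |k| * (E * σ ^ 2 * ∏ i, mm σ W (e4 i ((k, x), y))) := by gcongr
      _ = _ := by ring
  rx k y := by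
    obtain ⟨q, hq⟩ := res_quad (-(3 * θ * c)) (by
      have : 3 * θ * c ≠ 0 := by positivity
      simpa using this) k
      (θ * (-c * k ^ 2 + d * (3 * y ^ 2 - 3 * k * y + k ^ 2)))
    refine ⟨q, fun x => ?_⟩
    obtain ⟨i, hi⟩ := hq x
    refine ⟨i, res_A _ _ _ _ k x ?_ E ?_ hi ?_⟩
    · have : 3 * θ * c ≠ 0 := by positivity
      simpa using this
    · rwa [abs_neg]
    · unfold ΦA; dsimp only; ring
  ry k x := by
    obtain ⟨q, hq⟩ := res_quad (3 * θ * d) (by positivity) (-k)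
      (θ * (d * k ^ 2 - c * (3 * x ^ 2 + 3 * k * x + k ^ 2)))
    refine ⟨q, fun y => ?_⟩
    obtain ⟨i, hi⟩ := hq y
    refine ⟨i, res_A _ _ _ _ k y (by positivity) E h3 hi ?_⟩
    unfold ΦA; dsimp only; ring

lemma QOK_B (h : WOK A W) (hσ : 0 < σ) (hG : GOK σ W C G) (hC : 0 ≤ C)
    (mG : Measurable (fun p : ℝ × ℝ => G p.1 p.2)) (hθ : 0 < θ) (D E : ℝ) (hD : 0 < D)
    (hres : ∀ k z : ℝ,
    ∃ p : Fin 3 → ℝ, ∀ x, ∃ i, (|x| + |z| + |k|) * (x - p i) ^ 2 ≤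
      D * |(z - x) * ((1 - a) * (x ^ 2 + x * z + z ^ 2) + 3 * k * (x + z) + 3 * k ^ 2)|)
    (h1 : 8 * A * C ≤ E) (h2 : D / θ ≤ E) :
    QOK σ W E (KB G) (fun p => |p.1.2| + |p.2 - p.1.1| + |p.1.1|) (ΦB θ a) where
  C_pos := by
    have : 0 < D / θ := by positivity
    linarith
  mK := by
    unfold KB
    exact (measurable_snd).mul (mG.comp measurable_fst)
  mκ := by fun_prop
  mΦ := by unfold ΦB; fun_prop
  κ_nonneg p := by positivity
  q1 p := by
    obtain ⟨⟨k, x⟩, y⟩ := p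
    have hm : 0 < ∏ i, mm σ W (e4 i ((k, x), y)) := Finset.prod_pos fun i _ => mm_pos h _
    have hg : |G k x| * jb σ y ≤ _ := core_G h hG hC k x y 2
    have hj := abs_le_jb σ y
    rw [abs_mul, abs_of_pos hσ] at hj
    unfold KB
    rw [abs_mul]
    dsimp only
    have key : σ * (|y| * |G k x|) ≤ σ * (E * σ * ∏ i, mm σ W (e4 i ((k, x), y))) := by
      calc σ * (|y| * |G k x|) = |G k x| * (σ * |y|) := by ring
        _ ≤ |G k x| * jb σ y := by gcongr
        _ ≤ 8 * A * C * σ ^ 2 * ∏ i, mm σ W (e4 i ((k, x), y)) := hg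
        _ ≤ E * σ ^ 2 * ∏ i, mm σ W (e4 i ((k, x), y)) := by gcongr
        _ = _ := by ring
    exact le_of_mul_le_mul_left key hσ
  q2 p j := by
    obtain ⟨⟨k, x⟩, y⟩ := p
    have hm : 0 < ∏ i, mm σ W (e4 i ((k, x), y)) := Finset.prod_pos fun i _ => mm_pos h _
    have hg := core_G h hG hC k x y j
    have hA := h.one_le_A
    unfold KB
    rw [abs_mul]
    dsimp only
    have hy : |y| ≤ |x| + |y - k| + |k| := by
      have := abs_add_le (y - k) k
      rw [sub_add_cancel] at this
      linarith [abs_nonneg x]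
    calc |y| * |G k x| * jb σ (e4 j ((k, x), y)) = |y| * (|G k x| * jb σ (e4 j ((k, x), y))) := by ring
      _ ≤ (|x| + |y - k| + |k|) * (8 * A * C * σ ^ 2 * ∏ i, mm σ W (e4 i ((k, x), y))) := by
          gcongr
          have := jb_pos σ (e4 j ((k, x), y))
          positivity
      _ ≤ (|x| + |y - k| + |k|) * (E * σ ^ 2 * ∏ i, mm σ W (e4 i ((k, x), y))) := by gcongr
      _ = _ := by ring
  rx k y := by
    obtain ⟨q, hq⟩ := hres k (y - k)
    refine ⟨q, fun x => ?_⟩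
    obtain ⟨i, hi⟩ := hq x
    refine ⟨i, hi.trans ?_⟩
    have e : ΦB θ a ((k, x), y) = θ * ((y - k - x) * ((1 - a) * (x ^ 2 + x * (y - k) + (y - k) ^ 2) + 3 * k * (x + (y - k)) + 3 * k ^ 2)) := by
      unfold ΦB; dsimp only; ring
    rw [e, abs_mul θ, abs_of_pos hθ, ← mul_assoc]
    gcongr
    rwa [div_le_iff₀ hθ] at h2
  ry k x := by
    obtain ⟨q, hq⟩ := hres k x
    refine ⟨fun i => q i + k, fun y => ?_⟩
    obtain ⟨i, hi⟩ := hq (y - k)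
    refine ⟨i, ?_⟩
    dsimp only
    rw [show y - (q i + k) = y - k - q i by ring, show |x| + |y - k| + |k| = |y - k| + |x| + |k| by ring]
    refine hi.trans ?_
    have e : ΦB θ a ((k, x), y) = -θ * ((x - (y - k)) * ((1 - a) * ((y - k) ^ 2 + (y - k) * x + x ^ 2) + 3 * k * ((y - k) + x) + 3 * k ^ 2)) := by
      unfold ΦB; dsimp only; ring
    rw [e, abs_mul (-θ), abs_neg, abs_of_pos hθ, ← mul_assoc]
    gcongr
    rwa [div_le_iff₀ hθ] at h2

/-- Bilinear estimate. -/
lemma bil_pt (h : WOK A W) (hσ : 0 < σ) (ξ y ω : ℝ) (hω : ω = ξ ∨ ω = y) :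
    mm σ W ξ / jb σ ξ * |ω| ≤ 8 * A / σ * (mm σ W y * mm σ W (ξ - y)) * (1 / jb σ y + 1 / jb σ (ξ - y)) := by
  have hA := h.one_le_A
  have hm := mm_add (σ := σ) h y (ξ - y)
  rw [show y + (ξ - y) = ξ by ring] at hm
  have hj := (jb_min (σ := σ) y (ξ - y) ξ (by ring)).1
  have m1 := one_le_jb σ y
  have m2 := one_le_jb σ (ξ - y)
  have m3 := one_le_jb σ ξ
  have hinv : 1 / min (jb σ y) (jb σ (ξ - y)) ≤ 1 / jb σ y + 1 / jb σ (ξ - y) := by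
    rcases min_choice (jb σ y) (jb σ (ξ - y)) with e | e <;> rw [e]
    · have : 0 ≤ 1 / jb σ (ξ - y) := by positivity
      linarith
    · have : 0 ≤ 1 / jb σ y := by positivity
      linarith
  set μ := min (jb σ y) (jb σ (ξ - y)) with hμ
  have hμ1 : 1 ≤ μ := le_min m1 m2
  have hω' : |ω| ≤ 2 * jb σ ξ * μ / σ := by
    rw [le_div_iff₀ hσ]
    rcases hω with rfl | rfl
    · have := abs_le_jb σ ω
      rw [abs_mul, abs_of_pos hσ] at this
      nlinarith
    · have := abs_le_jb σ ω
      rw [abs_mul, abs_of_pos hσ] at this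
      nlinarith
  have p1 := mm_pos (σ := σ) h ξ
  have p2 := mm_pos (σ := σ) h y
  have p3 := mm_pos (σ := σ) h (ξ - y)
  have hmx : mm σ W ξ ≤ 4 * A * (mm σ W y * mm σ W (ξ - y)) / μ ^ 2 := by
    rwa [le_div_iff₀ (by positivity)]
  calc mm σ W ξ / jb σ ξ * |ω| ≤ mm σ W ξ / jb σ ξ * (2 * jb σ ξ * μ / σ) := by gcongr
    _ = 2 * μ / σ * mm σ W ξ := by field_simp
    _ ≤ 2 * μ / σ * (4 * A * (mm σ W y * mm σ W (ξ - y)) / μ ^ 2) := by gcongr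
    _ = 8 * A / σ * (mm σ W y * mm σ W (ξ - y)) * (1 / μ) := by field_simp; ring
    _ ≤ _ := by gcongr

lemma bil_est (h : WOK A W) (hσ : 0 < σ) (h1 h2 : S2) (n : ℝ → ℂ) (ω : ℝ → ℝ → ℝ) (hω : ∀ ξ y, ω ξ y = ξ ∨ ω ξ y = y)
    (hn : ∀ ξ, ‖n ξ‖ₑ ≤ ∫⁻ y, ENNReal.ofReal |ω ξ y| * (‖h1 y‖ₑ * ‖h2 (ξ - y)‖ₑ)) :
    wn (fun ξ => mm σ W ξ / jb σ ξ) n ≤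
      ENNReal.ofReal (16 * A * Real.sqrt Real.pi / (σ * Real.sqrt σ)) * (wn (mm σ W) h1 * wn (mm σ W) h2) := by
  have hA := h.one_le_A
  have mM := mm_meas (σ := σ) h
  have mJ := jb_meas σ
  have q1 := h1.measurable
  have q2 := h2.measurable
  set F1 : ℝ → ℝ≥0∞ := fun ξ => ENNReal.ofReal (mm σ W ξ) * ‖h1 ξ‖ₑ with hF1
  set F2 : ℝ → ℝ≥0∞ := fun ξ => ENNReal.ofReal (mm σ W ξ) * ‖h2 ξ‖ₑ with hF2
  have mF1 : Measurable F1 := by fun_prop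
  have mF2 : Measurable F2 := by fun_prop
  set D : ℝ≥0∞ := ENNReal.ofReal (8 * A / σ) with hD
  have hpt : ∀ ξ, ENNReal.ofReal (mm σ W ξ / jb σ ξ) * ‖n ξ‖ₑ ≤
      D * ((∫⁻ y, (ENNReal.ofReal (1 / jb σ y) * F1 y) * F2 (ξ - y)) +
        ∫⁻ y, F1 y * (ENNReal.ofReal (1 / jb σ (ξ - y)) * F2 (ξ - y))) := by
    intro ξ
    rw [← lintegral_add_left (by fun_prop), ← lintegral_const_mul' _ _ ENNReal.ofReal_ne_top]
    calc _ ≤ ENNReal.ofReal (mm σ W ξ / jb σ ξ) * ∫⁻ y, ENNReal.ofReal |ω ξ y| * (‖h1 y‖ₑ * ‖h2 (ξ - y)‖ₑ) := by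
          gcongr; exact hn ξ
      _ ≤ _ := by
          rw [← lintegral_const_mul' _ _ ENNReal.ofReal_ne_top]
          apply lintegral_mono; intro y
          dsimp only
          have hb := bil_pt h hσ ξ y (ω ξ y) (hω ξ y)
          have p1 := mm_pos (σ := σ) h ξ
          have p2 := mm_pos (σ := σ) h y
          have p3 := mm_pos (σ := σ) h (ξ - y)
          have m1 := jb_pos σ y
          have m2 := jb_pos σ (ξ - y)
          have m3 := jb_pos σ ξ
          rw [← mul_assoc, ← ENNReal.ofReal_mul (by positivity)]
          refine (mul_le_mul_left (ENNReal.ofReal_le_ofReal hb) _).trans (le_of_eq ?_)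
          rw [ENNReal.ofReal_mul (by positivity), ENNReal.ofReal_mul (by positivity), ENNReal.ofReal_mul (by positivity),
            ENNReal.ofReal_add (by positivity) (by positivity), hF1, hF2]
          ring
  have hs : Real.sqrt (Real.pi / σ) = Real.sqrt Real.pi / Real.sqrt σ := Real.sqrt_div Real.pi_pos.le _
  calc wn (fun ξ => mm σ W ξ / jb σ ξ) n
      ≤ L2n volume (fun ξ => D * ((∫⁻ y, (ENNReal.ofReal (1 / jb σ y) * F1 y) * F2 (ξ - y)) +
        ∫⁻ y, F1 y * (ENNReal.ofReal (1 / jb σ (ξ - y)) * F2 (ξ - y)))) := L2n_mono _ hpt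
    _ ≤ D * (L2n volume (fun ξ => ∫⁻ y, (ENNReal.ofReal (1 / jb σ y) * F1 y) * F2 (ξ - y)) +
          L2n volume (fun ξ => ∫⁻ y, F1 y * (ENNReal.ofReal (1 / jb σ (ξ - y)) * F2 (ξ - y)))) := by
        rw [L2n_const_mul _ _ ENNReal.ofReal_ne_top]
        gcongr
        apply L2n_add
        · exact (Measurable.lintegral_prod_right' (f := fun p : ℝ × ℝ => (ENNReal.ofReal (1 / jb σ p.2) * F1 p.2) * F2 (p.1 - p.2)) (by fun_prop)).aemeasurable
        · exact (Measurable.lintegral_prod_right' (f := fun p : ℝ × ℝ => F1 p.2 * (ENNReal.ofReal (1 / jb σ (p.1 - p.2)) * F2 (p.1 - p.2))) (by fun_prop)).aemeasurable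
    _ ≤ D * ((ENNReal.ofReal (Real.sqrt (Real.pi / σ)) * wn (mm σ W) h1) * wn (mm σ W) h2 +
          (ENNReal.ofReal (Real.sqrt (Real.pi / σ)) * wn (mm σ W) h2) * wn (mm σ W) h1) := by
        gcongr
        · refine (young12' (fun y => ENNReal.ofReal (1 / jb σ y) * F1 y) F2 (by fun_prop) mF2).trans ?_
          exact mul_le_mul_left (lint_div_jb σ hσ F1 mF1) _
        · refine (young12 (fun y => ENNReal.ofReal (1 / jb σ y) * F2 y) F1 (by fun_prop) mF1).trans ?_
          exact mul_le_mul_left (lint_div_jb σ hσ F2 mF2) _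
    _ = (2 * (D * ENNReal.ofReal (Real.sqrt (Real.pi / σ)))) * (wn (mm σ W) h1 * wn (mm σ W) h2) := by ring
    _ = _ := by
        congr 1
        rw [hD, ← ENNReal.ofReal_mul (by positivity), show (2 : ℝ≥0∞) = ENNReal.ofReal 2 by simp, ← ENNReal.ofReal_mul (by norm_num), hs]
        congr 1
        field_simp; ring

/-- Frequencies for the cubic form. -/
def e3 : Fin 3 → ℝ × ℝ → ℝ := ![fun p => p.1, fun p => p.2, fun p => -p.1 - p.2]

lemma e3_meas (i : Fin 3) : Measurable (e3 i) := by
  fin_cases i <;> simp only [e3] <;> simp <;> fun_prop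

lemma cubic_bound (h : WOK A W) (hσ : 0 < σ) (hG : GOK σ W C G) (hC : 0 ≤ C) (hs : Fin 3 → S2) :
    ∫⁻ p, ‖((G p.1 p.2 : ℝ) : ℂ)‖ₑ * ∏ i, ‖hs i (e3 i p)‖ₑ ≤
      ENNReal.ofReal (C * σ ^ 2 * Real.sqrt (Real.pi / σ)) * ∏ i, wn (mm σ W) (hs i) := by
  have mM := mm_meas (σ := σ) h
  have mJ := jb_meas σ
  have mh : ∀ i, Measurable (fun ξ => ENNReal.ofReal (mm σ W ξ) * ‖hs i ξ‖ₑ) := by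
    intro i
    have h2 := (hs i).measurable
    fun_prop
  set F : Fin 3 → ℝ → ℝ≥0∞ := fun i ξ => ENNReal.ofReal (mm σ W ξ) * ‖hs i ξ‖ₑ with hF
  have hc := cubic3 (fun ξ => ENNReal.ofReal (1 / jb σ ξ) * F 0 ξ) (F 1) (F 2) (by have := mh 0; fun_prop) (mh 1) (mh 2)
  have hl := lint_div_jb σ hσ (F 0) (mh 0)
  have e : ENNReal.ofReal (C * σ ^ 2 * Real.sqrt (Real.pi / σ)) * ∏ i, wn (mm σ W) (hs i) =
      ENNReal.ofReal (C * σ ^ 2) * ((ENNReal.ofReal (Real.sqrt (Real.pi / σ)) * L2n volume (F 0)) * (L2n volume (F 1) * L2n volume (F 2))) := by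
    rw [ENNReal.ofReal_mul (by positivity), Fin.prod_univ_three]
    change _ * (L2n volume (F 0) * L2n volume (F 1) * L2n volume (F 2)) = _
    ring
  rw [e]
  refine le_trans ?_ (mul_le_mul_right (hc.trans (mul_le_mul_left hl _)) _)
  rw [← lintegral_const_mul' _ _ ENNReal.ofReal_ne_top]
  apply lintegral_mono
  rintro ⟨k, x⟩
  dsimp only
  rw [Fin.prod_univ_three]
  change _ * (‖hs 0 k‖ₑ * ‖hs 1 x‖ₑ * ‖hs 2 (-k - x)‖ₑ) ≤ _
  rw [enorm_real]
  have hg := hG k x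
  have m1 := jb_pos σ k
  have m2 := jb_pos σ x
  have m3 := jb_pos σ (-k - x)
  have p1 := mm_pos (σ := σ) h k
  have p2 := mm_pos (σ := σ) h x
  have p3 := mm_pos (σ := σ) h (-k - x)
  have hb : |G k x| ≤ C * σ ^ 2 * (1 / jb σ k * mm σ W k * mm σ W x * mm σ W (-k - x)) := by
    have : |G k x| * jb σ k ≤ C * σ ^ 2 * (mm σ W k * mm σ W x * mm σ W (-k - x)) := by
      refine le_trans ?_ hg
      gcongr; linarith
    rw [← le_div_iff₀ m1] at this
    refine this.trans (le_of_eq ?_)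
    field_simp
  refine (mul_le_mul_left (ENNReal.ofReal_le_ofReal hb) _).trans (le_of_eq ?_)
  rw [ENNReal.ofReal_mul (by positivity), ENNReal.ofReal_mul (by positivity), ENNReal.ofReal_mul (by positivity),
    ENNReal.ofReal_mul (by positivity), ENNReal.ofReal_mul (p := 1 / jb σ k) (by positivity), hF]
  ring

end
end HS

open MeasureTheory Set Filter
open scoped ENNReal

namespace HS

/-- bounded admissible profile, small scale -/
structure BW (A CW σ : ℝ) (W : ℝ → ℝ) : Prop where
  ok : WOK A W
  bd : ∀ s, 1 ≤ s → W s ≤ CW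
  σ_pos : 0 < σ
  σ_le : σ ≤ 1

noncomputable def xn (σ : ℝ) (W : ℝ → ℝ) (h : S2) : ℝ := (wn (mm σ W) h).toReal
noncomputable def yn (σ : ℝ) (W : ℝ → ℝ) (h : S2) : ℝ := (wn (fun ξ => mm σ W ξ / jb σ ξ) h).toReal

section
variable {A CW σ C : ℝ} {W : ℝ → ℝ}

lemma BW.CW_pos (b : BW A CW σ W) : 0 < CW := by
  have := b.bd 1 le_rfl
  have := b.ok.one_le 1 le_rfl
  linarith

lemma mm_le_w1 (b : BW A CW σ W) (ξ : ℝ) : mm σ W ξ ≤ CW * w1 ξ := by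
  unfold mm w1
  have h1 := b.bd (jb σ ξ) (one_le_jb _ _)
  have h2 := b.ok.one_le (jb σ ξ) (one_le_jb _ _)
  rw [jb_sq]
  have h3 : σ ^ 2 ≤ 1 := pow_le_one₀ b.σ_pos.le b.σ_le
  have h4 : 1 + (σ * ξ) ^ 2 ≤ 1 + ξ ^ 2 := by
    rw [mul_pow]; nlinarith [sq_nonneg ξ]
  calc (1 + (σ * ξ) ^ 2) * W (jb σ ξ) ≤ (1 + ξ ^ 2) * CW := by
        gcongr
    _ = _ := by ring

lemma wn_mono {w w' : ℝ → ℝ} (hw : ∀ ξ, w ξ ≤ w' ξ) (h : ℝ → ℂ) : wn w h ≤ wn w' h := by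
  apply L2n_mono
  intro ξ
  gcongr
  exact hw ξ

lemma wn_const_mul {w : ℝ → ℝ} (c : ℝ) (hc : 0 ≤ c) (h : ℝ → ℂ) :
    wn (fun ξ => c * w ξ) h = ENNReal.ofReal c * wn w h := by
  unfold wn
  rw [← L2n_const_mul _ _ ENNReal.ofReal_ne_top]
  congr 1; ext ξ
  rw [ENNReal.ofReal_mul hc, mul_assoc]

lemma wn_mm_le (b : BW A CW σ W) (h : S2) : wn (mm σ W) h ≤ ENNReal.ofReal CW * ENNReal.ofReal ‖h‖ := by
  rw [S2.norm_eq, ← wn_const_mul _ b.CW_pos.le]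
  exact wn_mono (mm_le_w1 b) _

lemma mmj_le (b : BW A CW σ W) (ξ : ℝ) : mm σ W ξ / jb σ ξ ≤ mm σ W ξ :=
  div_le_self (mm_pos b.ok ξ).le (one_le_jb _ _)

lemma ofReal_xn (b : BW A CW σ W) (h : S2) : ENNReal.ofReal (xn σ W h) = wn (mm σ W) h := by
  unfold xn
  rw [ENNReal.ofReal_toReal]
  exact ((wn_mm_le b h).trans_lt (ENNReal.mul_lt_top ENNReal.ofReal_lt_top ENNReal.ofReal_lt_top)).ne

lemma ofReal_yn (b : BW A CW σ W) (h : S2) :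
    ENNReal.ofReal (yn σ W h) = wn (fun ξ => mm σ W ξ / jb σ ξ) h := by
  unfold yn
  rw [ENNReal.ofReal_toReal]
  exact ((wn_mono (mmj_le b) h).trans_lt ((wn_mm_le b h).trans_lt (ENNReal.mul_lt_top ENNReal.ofReal_lt_top ENNReal.ofReal_lt_top))).ne

lemma xn_nonneg (h : S2) : 0 ≤ xn σ W h := ENNReal.toReal_nonneg
lemma yn_nonneg (h : S2) : 0 ≤ yn σ W h := ENNReal.toReal_nonneg

lemma prod_wn_le (b : BW A CW σ W) {n : ℕ} (hs : Fin n → S2) :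
    ∏ i, wn (mm σ W) (hs i) ≤ ENNReal.ofReal (CW ^ n) * ∏ i, ENNReal.ofReal ‖hs i‖ := by
  calc _ ≤ ∏ i, (ENNReal.ofReal CW * ENNReal.ofReal ‖hs i‖) := by
        gcongr with i; exact wn_mm_le b _
    _ = _ := by
        rw [Finset.prod_mul_distrib, Finset.prod_const, Finset.card_univ, Fintype.card_fin,
          ENNReal.ofReal_pow b.CW_pos.le]

lemma real_of_lint {α : Type*} [MeasurableSpace α] {ν : Measure α} {n : ℕ} {K : α → ℂ} {e : Fin n → α → ℝ}
    {h : Fin n → S2} {D E : ℝ} {P : ℝ≥0∞} (hD : 0 ≤ D) (hE : 0 ≤ E)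
    (hb : ∫⁻ p, ‖K p‖ₑ * ∏ i, ‖h i (e i p)‖ₑ ∂ν ≤ ENNReal.ofReal D * P) (hP : P ≤ ENNReal.ofReal E) :
    ‖Lam ν K e h‖ ≤ D * E := by
  have h1 := (norm_Lam_le_lint (ν := ν) (K := K) (e := e) h).trans (hb.trans (mul_le_mul_right hP _))
  rw [← ENNReal.ofReal_mul hD] at h1
  exact (ENNReal.ofReal_le_ofReal_iff (mul_nonneg hD hE)).1 h1

variable {K κ Φ : R3 → ℝ} {B : ℝ}

lemma LamOK_near (b : BW A CW σ W) (q : QOK σ W C K κ Φ) (hB : 0 < B) :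
    LamOK volume (Knear B K κ Φ) e4 ((C * σ) * (6 * Real.sqrt C * Real.sqrt B) * CW ^ 4) where
  measK := Knear_meas q
  mease := e4_meas
  C_nonneg := by have := q.C_pos; have := b.CW_pos; have := b.σ_pos; positivity
  bound hs := by
    have hC := q.C_pos
    have hσ := b.σ_pos
    rw [ENNReal.ofReal_mul (by positivity), ENNReal.ofReal_mul (by positivity), mul_assoc (_ * _)]
    exact (near_bound b.ok q b.σ_pos hB hs).trans (by gcongr; exact prod_wn_le b hs)

lemma LamOK_far (b : BW A CW σ W) (q : QOK σ W C K κ Φ) (hB : 0 < B) :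
    LamOK volume (Kfar B K κ Φ) e4 ((C * σ ^ 2) * (6 * Real.pi * Real.sqrt C / Real.sqrt B) * CW ^ 4) where
  measK := Kfar_meas q
  mease := e4_meas
  C_nonneg := by have := q.C_pos; have := b.CW_pos; have := b.σ_pos; positivity
  bound hs := by
    have hC := q.C_pos
    rw [ENNReal.ofReal_mul (by positivity), ENNReal.ofReal_mul (by positivity), mul_assoc (_ * _)]
    refine (far_bound b.ok q hB 0 hs).trans ?_
    gcongr
    refine le_trans ?_ (prod_wn_le b hs)
    gcongr with i
    apply wn_mono
    intro ξ
    split_ifs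
    · exact mmj_le b ξ
    · exact le_rfl

lemma prod_xn_le (b : BW A CW σ W) {n : ℕ} (hs : Fin n → S2) (X : ℝ) (hX : ∀ i, xn σ W (hs i) ≤ X) (h0 : 0 ≤ X) :
    ∏ i, wn (mm σ W) (hs i) ≤ ENNReal.ofReal (X ^ n) := by
  calc _ ≤ ∏ _i : Fin n, ENNReal.ofReal X := by
        gcongr with i
        rw [← ofReal_xn b]
        exact ENNReal.ofReal_le_ofReal (hX i)
    _ = _ := by
        rw [Finset.prod_const, Finset.card_univ, Fintype.card_fin, ENNReal.ofReal_pow h0]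

lemma near_norm (b : BW A CW σ W) (q : QOK σ W C K κ Φ) (hB : 0 < B) (hs : Fin 4 → S2) (X : ℝ)
    (h0 : 0 ≤ X) (hX : ∀ i, xn σ W (hs i) ≤ X) :
    ‖Lam volume (Knear B K κ Φ) e4 hs‖ ≤ (C * σ) * (6 * Real.sqrt C * Real.sqrt B) * X ^ 4 := by
  have hC := q.C_pos
  have hσ := b.σ_pos
  refine real_of_lint (by positivity) (by positivity) ?_ (prod_xn_le b hs X hX h0)
  rw [ENNReal.ofReal_mul (by positivity)]
  exact near_bound b.ok q b.σ_pos hB hs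

lemma far_norm (b : BW A CW σ W) (q : QOK σ W C K κ Φ) (hB : 0 < B) (hs : Fin 4 → S2) (X : ℝ)
    (h0 : 0 ≤ X) (hX : ∀ i, xn σ W (hs i) ≤ X) :
    ‖Lam volume (Kfar B K κ Φ) e4 hs‖ ≤ (C * σ ^ 2) * (6 * Real.pi * Real.sqrt C / Real.sqrt B) * X ^ 4 := by
  have hC := q.C_pos
  refine real_of_lint (by positivity) (by positivity) ?_ (prod_xn_le b hs X hX h0)
  rw [ENNReal.ofReal_mul (by positivity)]
  refine (far_bound b.ok q hB 0 hs).trans ?_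
  gcongr with i
  apply wn_mono
  intro ξ
  split_ifs
  · exact mmj_le b ξ
  · exact le_rfl

lemma far_norm_slot (b : BW A CW σ W) (q : QOK σ W C K κ Φ) (hB : 0 < B) (hs : Fin 4 → S2) (X Z : ℝ)
    (h0 : 0 ≤ X) (hX : ∀ i, xn σ W (hs i) ≤ X) (j : Fin 4) (N : S2) (hN : yn σ W N ≤ Z) :
    ‖Lam volume (Kfar B K κ Φ) e4 (Function.update hs j N)‖ ≤
      (C * σ ^ 2) * (6 * Real.pi * Real.sqrt C / Real.sqrt B) * (Z * X ^ 3) := by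
  have hC := q.C_pos
  have hZ : 0 ≤ Z := (yn_nonneg N).trans hN
  refine real_of_lint (P := ∏ i, wn (fun ξ => if i = j then mm σ W ξ / jb σ ξ else mm σ W ξ)
    (Function.update hs j N i)) (by positivity) (by positivity) ?_ ?_
  · rw [ENNReal.ofReal_mul (by positivity)]
    exact far_bound b.ok q hB j _
  · rw [← Finset.mul_prod_erase _ _ (Finset.mem_univ j), ENNReal.ofReal_mul hZ]
    gcongr
    · simp only [if_true, Function.update_self]
      rw [← ofReal_yn b]
      exact ENNReal.ofReal_le_ofReal hN
    · calc _ ≤ ∏ _i ∈ Finset.univ.erase j, ENNReal.ofReal X := by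
            apply Finset.prod_le_prod' 
            intro i hi
            have hij := Finset.ne_of_mem_erase hi
            simp only [hij, if_false, Function.update_of_ne hij]
            change wn (mm σ W) _ ≤ _
            rw [← ofReal_xn b]
            exact ENNReal.ofReal_le_ofReal (hX i)
        _ = _ := by
            rw [Finset.prod_const, Finset.card_erase_of_mem (Finset.mem_univ j), Finset.card_univ, Fintype.card_fin,
              ENNReal.ofReal_pow h0]

/-- The full quartic integral. -/
noncomputable def Qint (K : R3 → ℝ) (hs : Fin 4 → S2) : ℂ := ∫ p, (K p : ℂ) * ∏ i, hs i (e4 i p)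

lemma Q_integrable (b : BW A CW σ W) (q : QOK σ W C K κ Φ) (hs P : Fin 4 → S2) (φ : Fin 4 → ℝ → ℝ)
    (hP : ∀ i ξ, P i ξ = Complex.I * φ i ξ * hs i ξ) (hΦ : ∀ p, Φ p = ∑ i, φ i (e4 i p)) :
    Integrable (fun p => (K p : ℂ) * ∏ i, hs i (e4 i p)) := by
  have h1 := (LamOK_near b q one_pos).integrable hs
  have h2 := Lam_phase_integrable (LamOK_far b q one_pos) hs P φ Φ hP hΦ
  refine (h1.add h2).congr (Eventually.of_forall fun p => ?_)
  simp only [Pi.add_apply]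
  rw [K_split q one_pos p]; ring

lemma Q_split (b : BW A CW σ W) (q : QOK σ W C K κ Φ) (hB : 0 < B) (hs P : Fin 4 → S2) (φ : Fin 4 → ℝ → ℝ)
    (hP : ∀ i ξ, P i ξ = Complex.I * φ i ξ * hs i ξ) (hΦ : ∀ p, Φ p = ∑ i, φ i (e4 i p)) :
    Qint K hs = Lam volume (Knear B K κ Φ) e4 hs +
      Lam volume (fun p => Kfar B K κ Φ p * Φ p) e4 hs := by
  have h1 := (LamOK_near b q hB).integrable hs
  have h2 := Lam_phase_integrable (LamOK_far b q hB) hs P φ Φ hP hΦ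
  unfold Lam Qint
  rw [← integral_add h1 h2]
  congr 1; ext p
  rw [K_split q hB p]; ring

theorem quart_corr (b : BW A CW σ W) (q : QOK σ W C K κ Φ) (l : ℝ) (hl : 0 < l) (hσ : σ = l ^ 4)
    (hs : Fin 4 → ℝ → S2) (P N : Fin 4 → S2) (φ : Fin 4 → ℝ → ℝ) (s : Set ℝ) (t : ℝ)
    (hP : ∀ i ξ, P i ξ = Complex.I * φ i ξ * hs i t ξ) (hΦ : ∀ p, Φ p = ∑ i, φ i (e4 i p))
    (hd : ∀ i, HasDerivWithinAt (hs i) (P i + N i) s t) (X Z : ℝ) (h0 : 0 ≤ X)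
    (hX : ∀ i, xn σ W (hs i t) ≤ X) (hN : ∀ i, yn σ W (N i) ≤ Z) :
    ∃ R', HasDerivWithinAt (fun τ => Lam volume (Kfar (l ^ 2)⁻¹ K κ Φ) e4 (fun i => hs i τ)) R' s t ∧
      ‖Complex.I * Qint K (fun i => hs i t) - R'‖ ≤
        24 * Real.pi * C * Real.sqrt C * (l ^ 3 * X ^ 4 + l ^ 9 * (Z * X ^ 3)) := by
  have hB : 0 < (l ^ 2)⁻¹ := by positivity
  have hC := q.C_pos
  have hsB : Real.sqrt (l ^ 2)⁻¹ = l⁻¹ := by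
    rw [Real.sqrt_inv, Real.sqrt_sq hl.le]
  refine ⟨_, Lam_hasDeriv (LamOK_far b q hB) hs (fun i => P i + N i) P N φ Φ s t hd (fun i => rfl) hP hΦ, ?_⟩
  rw [Q_split b q hB _ P φ hP hΦ]
  have e : ∀ n F S : ℂ, Complex.I * (n + F) - (Complex.I * F + S) = Complex.I * n - S := by intros; ring
  rw [e]
  have hn := near_norm b q hB (fun i => hs i t) X h0 hX
  have hf := fun i => far_norm_slot b q hB (fun i => hs i t) X Z h0 hX i (N i) (hN i)
  rw [hsB] at hn hf
  have hZ : 0 ≤ Z := (yn_nonneg _).trans (hN 0)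
  refine (norm_sub_le _ _).trans ?_
  rw [norm_mul, Complex.norm_I, one_mul]
  have hsum : ‖∑ i, Lam volume (Kfar (l ^ 2)⁻¹ K κ Φ) e4 (Function.update (fun j => hs j t) i (N i))‖ ≤
      4 * ((C * σ ^ 2) * (6 * Real.pi * Real.sqrt C / l⁻¹) * (Z * X ^ 3)) := by
    refine (norm_sum_le _ _).trans ((Finset.sum_le_sum fun i _ => hf i).trans (le_of_eq ?_))
    simp
  have hpi : 1 ≤ Real.pi := by linarith [Real.pi_gt_three]
  have e1 : (C * σ) * (6 * Real.sqrt C * l⁻¹) * X ^ 4 ≤ 24 * Real.pi * C * Real.sqrt C * (l ^ 3 * X ^ 4) := by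
    rw [hσ]
    have : (C * l ^ 4) * (6 * Real.sqrt C * l⁻¹) * X ^ 4 = 6 * (C * Real.sqrt C * (l ^ 3 * X ^ 4)) := by
      field_simp
    rw [this]
    have : 0 ≤ C * Real.sqrt C * (l ^ 3 * X ^ 4) := by positivity
    nlinarith
  have e2 : 4 * ((C * σ ^ 2) * (6 * Real.pi * Real.sqrt C / l⁻¹) * (Z * X ^ 3)) =
      24 * Real.pi * C * Real.sqrt C * (l ^ 9 * (Z * X ^ 3)) := by
    rw [hσ]; field_simp; ring
  rw [e2] at hsum
  linarith

lemma quart_corr_size (b : BW A CW σ W) (q : QOK σ W C K κ Φ) (l : ℝ) (hl : 0 < l) (hσ : σ = l ^ 4)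
    (hs : Fin 4 → S2) (X : ℝ) (h0 : 0 ≤ X) (hX : ∀ i, xn σ W (hs i) ≤ X) :
    ‖Lam volume (Kfar (l ^ 2)⁻¹ K κ Φ) e4 hs‖ ≤ 24 * Real.pi * C * Real.sqrt C * (l ^ 9 * X ^ 4) := by
  have hB : 0 < (l ^ 2)⁻¹ := by positivity
  have hC := q.C_pos
  have hsB : Real.sqrt (l ^ 2)⁻¹ = l⁻¹ := by
    rw [Real.sqrt_inv, Real.sqrt_sq hl.le]
  refine (far_norm b q hB hs X h0 hX).trans ?_
  rw [hsB, hσ]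
  have : (C * (l ^ 4) ^ 2) * (6 * Real.pi * Real.sqrt C / l⁻¹) * X ^ 4 = 6 * (Real.pi * C * Real.sqrt C * (l ^ 9 * X ^ 4)) := by
    field_simp
  rw [this]
  have : 0 ≤ Real.pi * C * Real.sqrt C * (l ^ 9 * X ^ 4) := by positivity
  nlinarith

variable {G : ℝ → ℝ → ℝ}

lemma LamOK_cubic (b : BW A CW σ W) (hG : GOK σ W C G) (hC : 0 ≤ C) (mG : Measurable (fun p : ℝ × ℝ => G p.1 p.2)) :
    LamOK volume (fun p : ℝ × ℝ => ((G p.1 p.2 : ℝ) : ℂ)) e3 (C * σ ^ 2 * Real.sqrt (Real.pi / σ) * CW ^ 3) where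
  measK := Complex.measurable_ofReal.comp mG
  mease := e3_meas
  C_nonneg := by have := b.CW_pos; have := b.σ_pos; positivity
  bound hs := by
    rw [ENNReal.ofReal_mul (by positivity), mul_assoc (ENNReal.ofReal _)]
    refine (cubic_bound b.ok b.σ_pos hG hC hs).trans ?_
    gcongr
    exact prod_wn_le b hs

lemma cubic_norm (b : BW A CW σ W) (hG : GOK σ W C G) (hC : 0 ≤ C) (l : ℝ) (hl : 0 < l) (hσ : σ = l ^ 4)
    (hs : Fin 3 → S2) (X : ℝ) (h0 : 0 ≤ X) (hX : ∀ i, xn σ W (hs i) ≤ X) :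
    ‖Lam volume (fun p : ℝ × ℝ => ((G p.1 p.2 : ℝ) : ℂ)) e3 hs‖ ≤ 2 * C * (l ^ 6 * X ^ 3) := by
  have h1 := real_of_lint (by have := b.σ_pos; positivity) (by positivity) (cubic_bound b.ok b.σ_pos hG hC hs) (prod_xn_le b hs X hX h0)
  refine h1.trans ?_
  have hs : Real.sqrt (Real.pi / σ) ≤ 2 / l ^ 2 := by
    apply Real.sqrt_le_iff.2 ⟨by positivity, ?_⟩
    rw [div_pow, hσ]
    have := Real.pi_le_four
    rw [← pow_mul]
    gcongr
    linarith
  calc _ ≤ C * σ ^ 2 * (2 / l ^ 2) * X ^ 3 := by gcongr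
    _ = _ := by rw [hσ]; field_simp

end
end HS

open MeasureTheory Set Filter
open scoped ENNReal

namespace HS

/-- The Fourier side system. -/
structure Sys (a θ b1 b2 b3 : ℝ) where
  f : ℝ → S2
  g : ℝ → S2
  Pf : ℝ → S2
  Nf : ℝ → S2
  Pg : ℝ → S2
  Ng : ℝ → S2
  Pf_eq : ∀ t ξ, Pf t ξ = Complex.I * ((θ * a * ξ ^ 3 : ℝ) : ℂ) * f t ξ
  Pg_eq : ∀ t ξ, Pg t ξ = Complex.I * ((θ * 1 * ξ ^ 3 : ℝ) : ℂ) * g t ξ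
  Nf_eq : ∀ t ξ, Nf t ξ = Complex.I * ξ * (b1 * (∫ y, f t y * f t (ξ - y)) + b2 * ∫ y, g t y * g t (ξ - y))
  Ng_eq : ∀ t ξ, Ng t ξ = Complex.I * b3 * ∫ y : ℝ, ((y : ℝ) : ℂ) * g t y * f t (ξ - y)
  f_conj : ∀ t ξ, f t (-ξ) = starRingEnd ℂ (f t ξ)
  g_conj : ∀ t ξ, g t (-ξ) = starRingEnd ℂ (g t ξ)

/-- The reflected coordinates `(k,x) ↦ (k,-k-x)`. -/
def refl2 : (ℝ × ℝ) ≃ᵐ (ℝ × ℝ) where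
  toFun p := (p.1, -p.1 - p.2)
  invFun p := (p.1, -p.1 - p.2)
  left_inv p := by ext <;> simp
  right_inv p := by ext <;> simp
  measurable_toFun := by simp; fun_prop
  measurable_invFun := by simp; fun_prop

lemma refl2_mp : MeasurePreserving refl2 := by
  have h := MeasurePreserving.skew_product (μa := (volume : Measure ℝ)) (μb := (volume : Measure ℝ))
    (μc := (volume : Measure ℝ)) (μd := volume) (f := id) (g := fun k x => -k - x)
    (MeasurePreserving.id _) (by fun_prop)
    (Eventually.of_forall fun k => (Measure.measurePreserving_sub_left volume (-k)).map_eq)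
  exact h

lemma int_refl (F : ℝ × ℝ → ℂ) : ∫ p : ℝ × ℝ, F (p.1, -p.1 - p.2) = ∫ p, F p :=
  refl2_mp.integral_comp' F

lemma int_swap (F : ℝ × ℝ → ℂ) : ∫ p : ℝ × ℝ, F (p.2, p.1) = ∫ p, F p :=
  (Measure.measurePreserving_swap (μ := (volume : Measure ℝ)) (ν := (volume : Measure ℝ))).integral_comp'
    (f := MeasurableEquiv.prodComm) F

lemma w1_pow_temp (n : ℕ) : Function.HasTemperateGrowth (fun ξ => w1 ξ ^ n) := by
  unfold w1; fun_prop

lemma w1_pow_nonneg (n : ℕ) (ξ : ℝ) : 0 ≤ w1 ξ ^ n := pow_nonneg (w1_pos ξ).le _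

lemma S2.wn_lt (n : ℕ) (h : S2) : wn (fun ξ => w1 ξ ^ n) h < ⊤ :=
  wn_schwartz_lt (w1_pow_temp n) (w1_pow_nonneg n) h

lemma S2.l1_lt (n : ℕ) (h : S2) : ∫⁻ ξ, ENNReal.ofReal (w1 ξ ^ n) * ‖h ξ‖ₑ < ⊤ := by
  have := (SchwartzMap.integrable (μ := volume) (smS (fun ξ => w1 ξ ^ n) h)).2
  refine lt_of_eq_of_lt ?_ this
  congr 1; ext ξ
  have e := smS_apply (w1_pow_temp n) h ξ
  rw [e, enorm_mul, enorm_real, abs_of_nonneg (w1_pow_nonneg n ξ)]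
  rfl

lemma tri_integrable (K : ℝ × ℝ → ℂ) (mK : Measurable K) (C : ℝ) (n : ℕ)
    (hK : ∀ p, ‖K p‖ ≤ C * (w1 p.1 ^ n * w1 p.2 ^ n * w1 (-p.1 - p.2) ^ n)) (h1 h2 h3 : S2) :
    Integrable (fun p : ℝ × ℝ => K p * (h1 p.1 * h2 p.2 * h3 (-p.1 - p.2))) := by
  have m1 := h1.measurable
  have m2 := h2.measurable
  have m3 := h3.measurable
  have mw : Measurable (fun ξ => w1 ξ ^ n) := by unfold w1; fun_prop
  refine ⟨?_, ?_⟩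
  · have : Measurable (fun p : ℝ × ℝ => K p * (h1 p.1 * h2 p.2 * h3 (-p.1 - p.2))) := by fun_prop
    exact this.aestronglyMeasurable
  · have hc := cubic3 (fun ξ => ENNReal.ofReal (w1 ξ ^ n) * ‖h1 ξ‖ₑ) (fun ξ => ENNReal.ofReal (w1 ξ ^ n) * ‖h2 ξ‖ₑ)
      (fun ξ => ENNReal.ofReal (w1 ξ ^ n) * ‖h3 ξ‖ₑ) (by fun_prop) (by fun_prop) (by fun_prop)
    have hlt := lt_of_le_of_lt hc (ENNReal.mul_lt_top (h1.l1_lt n) (ENNReal.mul_lt_top (h2.wn_lt n) (h3.wn_lt n)))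
    unfold HasFiniteIntegral
    refine lt_of_le_of_lt ?_ (ENNReal.mul_lt_top (ENNReal.ofReal_lt_top (r := C)) hlt)
    rw [← lintegral_const_mul' _ _ ENNReal.ofReal_ne_top]
    apply lintegral_mono; intro p
    dsimp only
    have p1 := w1_pow_nonneg n p.1
    have p2 := w1_pow_nonneg n p.2
    have p3 := w1_pow_nonneg n (-p.1 - p.2)
    have hC : 0 ≤ C := by
      by_contra hneg
      push Not at hneg
      have q1 := pow_pos (w1_pos p.1) n
      have q2 := pow_pos (w1_pos p.2) n
      have q3 := pow_pos (w1_pos (-p.1 - p.2)) n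
      have := (norm_nonneg _).trans (hK p)
      have := mul_pos (mul_pos q1 q2) q3
      nlinarith
    have hKe : ‖K p‖ₑ ≤ ENNReal.ofReal C * (ENNReal.ofReal (w1 p.1 ^ n) * ENNReal.ofReal (w1 p.2 ^ n) * ENNReal.ofReal (w1 (-p.1 - p.2) ^ n)) := by
      rw [← ofReal_norm, ← ENNReal.ofReal_mul p1, ← ENNReal.ofReal_mul (mul_nonneg p1 p2), ← ENNReal.ofReal_mul hC]
      exact ENNReal.ofReal_le_ofReal (hK p)
    rw [enorm_mul, enorm_mul, enorm_mul]
    refine (mul_le_mul_left hKe _).trans (le_of_eq ?_)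
    ring

section
variable {A CW σ : ℝ} {W : ℝ → ℝ}

lemma mu_le (b : BW A CW σ W) (ξ : ℝ) : mm σ W ξ ^ 2 * |ξ| ≤ CW ^ 2 * w1 ξ ^ 3 := by
  have h1 := mm_le_w1 b ξ
  have h2 := mm_pos (σ := σ) b.ok ξ
  have h3 : |ξ| ≤ w1 ξ := by
    unfold w1; rw [← sq_abs]; nlinarith [sq_nonneg (|ξ| - 1)]
  calc mm σ W ξ ^ 2 * |ξ| ≤ (CW * w1 ξ) ^ 2 * w1 ξ := by
        have := w1_pos ξ
        have := b.CW_pos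
        gcongr
    _ = _ := by ring

lemma mu_le' (b : BW A CW σ W) (ξ η : ℝ) : mm σ W ξ ^ 2 * |η| ≤ CW ^ 2 * (w1 ξ ^ 3 * w1 η ^ 3) := by
  have h1 := mm_le_w1 b ξ
  have h2 := mm_pos (σ := σ) b.ok ξ
  have h3 : |η| ≤ w1 η := by
    unfold w1; rw [← sq_abs]; nlinarith [sq_nonneg (|η| - 1)]
  have k1 := one_le_w1 ξ
  have k2 := one_le_w1 η
  calc mm σ W ξ ^ 2 * |η| ≤ (CW * w1 ξ) ^ 2 * w1 η := by
        have := b.CW_pos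
        gcongr
    _ = CW ^ 2 * (w1 ξ ^ 2 * w1 η ^ 1) := by ring
    _ ≤ _ := by
        gcongr
        · norm_num
        · norm_num

variable {a θ b1 b2 b3 : ℝ} (S : Sys a θ b1 b2 b3)

/-- trilinear integrand -/
def tri (h1 h2 h3 : S2) (p : ℝ × ℝ) : ℂ := h1 p.1 * h2 p.2 * h3 (-p.1 - p.2)

lemma int_mu1 (b : BW A CW σ W) (h1 h2 h3 : S2) :
    Integrable (fun p : ℝ × ℝ => ((mm σ W p.1 ^ 2 * p.1 : ℝ) : ℂ) * tri h1 h2 h3 p) := by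
  have mM := mm_meas (σ := σ) b.ok
  refine tri_integrable _ (by fun_prop) (CW ^ 2) 3 (fun p => ?_) h1 h2 h3
  rw [Complex.norm_real, Real.norm_eq_abs, abs_mul, abs_of_nonneg (by positivity)]
  refine (mu_le b p.1).trans ?_
  have k1 := one_le_pow₀ (one_le_w1 p.1) (n := 3)
  have k2 := one_le_pow₀ (one_le_w1 p.2) (n := 3)
  have k3 := one_le_pow₀ (one_le_w1 (-p.1 - p.2)) (n := 3)
  have := b.CW_pos
  gcongr
  rw [mul_assoc]
  exact le_mul_of_one_le_right (by linarith) (one_le_mul_of_one_le_of_one_le k2 k3)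

lemma int_mu2 (b : BW A CW σ W) (h1 h2 h3 : S2) :
    Integrable (fun p : ℝ × ℝ => ((mm σ W p.1 ^ 2 * p.2 : ℝ) : ℂ) * tri h1 h2 h3 p) := by
  have mM := mm_meas (σ := σ) b.ok
  refine tri_integrable _ (by fun_prop) (CW ^ 2) 3 (fun p => ?_) h1 h2 h3
  rw [Complex.norm_real, Real.norm_eq_abs, abs_mul, abs_of_nonneg (by positivity)]
  refine (mu_le' b p.1 p.2).trans ?_
  have k1 := one_le_pow₀ (one_le_w1 p.1) (n := 3)
  have k2 := one_le_pow₀ (one_le_w1 p.2) (n := 3)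
  have k3 := one_le_pow₀ (one_le_w1 (-p.1 - p.2)) (n := 3)
  have := b.CW_pos
  refine mul_le_mul_of_nonneg_left ?_ (by positivity)
  exact le_mul_of_one_le_right (by nlinarith) k3

lemma int_mu3 (b : BW A CW σ W) (h1 h2 h3 : S2) :
    Integrable (fun p : ℝ × ℝ => ((mm σ W p.2 ^ 2 * (-p.1 - p.2) : ℝ) : ℂ) * tri h1 h2 h3 p) := by
  have mM := mm_meas (σ := σ) b.ok
  refine tri_integrable _ (by fun_prop) (CW ^ 2) 3 (fun p => ?_) h1 h2 h3
  rw [Complex.norm_real, Real.norm_eq_abs, abs_mul, abs_of_nonneg (by positivity)]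
  refine (mu_le' b p.2 (-p.1 - p.2)).trans ?_
  have k1 := one_le_pow₀ (one_le_w1 p.1) (n := 3)
  have k2 := one_le_pow₀ (one_le_w1 p.2) (n := 3)
  have k3 := one_le_pow₀ (one_le_w1 (-p.1 - p.2)) (n := 3)
  have := b.CW_pos
  refine mul_le_mul_of_nonneg_left ?_ (by positivity)
  rw [mul_assoc]
  exact le_mul_of_one_le_left (by nlinarith) k1

/-- integrability transported by reflections -/
lemma integrable_refl {F : ℝ × ℝ → ℂ} (hF : Integrable F) : Integrable (fun p : ℝ × ℝ => F (p.1, -p.1 - p.2)) :=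
  refl2_mp.integrable_comp_of_integrable hF

lemma integrable_swap {F : ℝ × ℝ → ℂ} (hF : Integrable F) : Integrable (fun p : ℝ × ℝ => F (p.2, p.1)) :=
  hF.swap

lemma tri_sum_u (b : BW A CW σ W) (f : S2) :
    ∫ p : ℝ × ℝ, ((Mu σ W p.1 p.2 : ℝ) : ℂ) * tri f f f p =
      3 * ∫ p : ℝ × ℝ, ((mm σ W p.1 ^ 2 * p.1 : ℝ) : ℂ) * tri f f f p := by
  set F : ℝ × ℝ → ℂ := fun p => ((mm σ W p.1 ^ 2 * p.1 : ℝ) : ℂ) * tri f f f p with hF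
  have hi : Integrable F := int_mu1 b f f f
  have i2 := integrable_swap hi
  have i3 : Integrable (fun p : ℝ × ℝ => F (-p.1 - p.2, p.1)) := integrable_refl i2
  have e2 : ∫ p : ℝ × ℝ, F (p.2, p.1) = ∫ p, F p := int_swap F
  have e3 : ∫ p : ℝ × ℝ, F (-p.1 - p.2, p.1) = ∫ p, F p := by
    rw [← e2, ← int_refl (fun p => F (p.2, p.1))]
  rw [show (3 : ℂ) * ∫ p, F p = (∫ p, F p) + (∫ p : ℝ × ℝ, F (p.2, p.1)) + ∫ p : ℝ × ℝ, F (-p.1 - p.2, p.1) by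
    rw [e2, e3]; ring]
  have i12 : Integrable (fun p : ℝ × ℝ => F p + F (p.2, p.1)) := hi.add i2
  rw [← integral_add hi i2, ← integral_add i12 i3]
  congr 1; ext p
  simp only [hF, tri, Mu]
  rw [show -p.2 - p.1 = -p.1 - p.2 by ring, show -(-p.1 - p.2) - p.1 = p.2 by ring]
  push_cast; ring

lemma tri_sum_v (b : BW A CW σ W) (f g : S2) :
    ∫ p : ℝ × ℝ, ((Mv σ W p.1 p.2 : ℝ) : ℂ) * tri f g g p =
      (∫ p : ℝ × ℝ, ((mm σ W p.1 ^ 2 * p.1 : ℝ) : ℂ) * tri f g g p) +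
      2 * ∫ p : ℝ × ℝ, ((mm σ W p.2 ^ 2 * (-p.1 - p.2) : ℝ) : ℂ) * tri f g g p := by
  set F : ℝ × ℝ → ℂ := fun p => ((mm σ W p.2 ^ 2 * (-p.1 - p.2) : ℝ) : ℂ) * tri f g g p with hF
  have hi : Integrable F := int_mu3 b f g g
  have i3 : Integrable (fun p : ℝ × ℝ => F (p.1, -p.1 - p.2)) := integrable_refl hi
  have e3 : ∫ p : ℝ × ℝ, F (p.1, -p.1 - p.2) = ∫ p, F p := int_refl F
  rw [show (2 : ℂ) * ∫ p, F p = (∫ p, F p) + ∫ p : ℝ × ℝ, F (p.1, -p.1 - p.2) by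
    rw [e3]; ring]
  have i12 : Integrable (fun p : ℝ × ℝ => F p + F (p.1, -p.1 - p.2)) := hi.add i3
  rw [← integral_add hi i3, ← integral_add (int_mu1 b f g g) i12]
  congr 1; ext p
  simp only [hF, tri, Mv]
  rw [show -p.1 - (-p.1 - p.2) = p.2 by ring]
  push_cast; ring

/-- the quadratic form -/
def e2 : Fin 2 → ℝ → ℝ := ![fun p => p, fun p => -p]

lemma LamOK_quad (b : BW A CW σ W) :
    LamOK volume (fun ξ => ((mm σ W ξ ^ 2 : ℝ) : ℂ)) e2 (CW ^ 2) where
  measK := by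
    have mM := mm_meas (σ := σ) b.ok
    fun_prop
  mease i := by fin_cases i <;> simp only [e2] <;> simp <;> fun_prop
  C_nonneg := by positivity
  bound hs := by
    have mM := mm_meas (σ := σ) b.ok
    have m0 := (hs 0).measurable
    have m1 := (hs 1).measurable
    refine le_trans ?_ (prod_wn_le b hs)
    rw [Fin.prod_univ_two]
    have e : wn (mm σ W) (hs 1) = L2n volume (fun ξ => ENNReal.ofReal (mm σ W ξ) * ‖hs 1 (-ξ)‖ₑ) := by
      have := L2n_comp_neg_sub (fun ξ => ENNReal.ofReal (mm σ W ξ) * ‖hs 1 ξ‖ₑ) 0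
      simp only [zero_sub, mm_neg] at this
      rw [this]; rfl
    rw [e]
    refine le_trans (le_of_eq ?_) (L2n_CS volume _ _ (by fun_prop) (by fun_prop))
    congr 1; ext ξ
    rw [Fin.prod_univ_two, enorm_real, abs_of_nonneg (by positivity), ENNReal.ofReal_pow (mm_pos b.ok ξ).le]
    change _ * (‖hs 0 ξ‖ₑ * ‖hs 1 (-ξ)‖ₑ) = _
    ring

noncomputable def L2f (σ : ℝ) (W : ℝ → ℝ) (h1 h2 : S2) : ℂ :=
  ∫ ξ, ((mm σ W ξ ^ 2 : ℝ) : ℂ) * (h1 ξ * h2 (-ξ))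

lemma L2f_eq (h : Fin 2 → S2) : Lam volume (fun ξ => ((mm σ W ξ ^ 2 : ℝ) : ℂ)) e2 h = L2f σ W (h 0) (h 1) := by
  unfold Lam L2f
  congr 1; ext ξ
  rw [Fin.prod_univ_two]; rfl

lemma L2f_symm (h1 h2 : S2) : L2f σ W h1 h2 = L2f σ W h2 h1 := by
  unfold L2f
  rw [← integral_neg_eq_self]
  congr 1; ext ξ
  rw [mm_neg, neg_neg]; ring

lemma L2f_real (b : BW A CW σ W) (h : S2) (hc : ∀ ξ, h (-ξ) = starRingEnd ℂ (h ξ)) :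
    L2f σ W h h = ((xn σ W h ^ 2 : ℝ) : ℂ) := by
  have e : ∀ ξ, ((mm σ W ξ ^ 2 : ℝ) : ℂ) * (h ξ * h (-ξ)) = ((mm σ W ξ ^ 2 * ‖h ξ‖ ^ 2 : ℝ) : ℂ) := by
    intro ξ
    rw [hc, Complex.mul_conj, Complex.normSq_eq_norm_sq]; push_cast; ring
  unfold L2f
  simp only [e]
  rw [integral_complex_ofReal]
  congr 1
  have mM := mm_meas (σ := σ) b.ok
  have m1 := h.measurable
  rw [integral_eq_lintegral_of_nonneg_ae (Eventually.of_forall fun ξ => by dsimp; positivity)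
    (by fun_prop)]
  unfold xn
  rw [← ENNReal.toReal_pow]
  congr 1
  have := L2n_sq volume (fun ξ => ENNReal.ofReal (mm σ W ξ) * ‖h ξ‖ₑ)
  rw [← ENNReal.rpow_natCast]
  refine Eq.trans ?_ this.symm
  congr 1; ext ξ
  rw [rpow_two_mul, ENNReal.ofReal_mul (by positivity), ENNReal.ofReal_pow (mm_pos b.ok ξ).le,
    ENNReal.ofReal_pow (norm_nonneg _), ofReal_norm]
  norm_cast

lemma quad_f (b : BW A CW σ W) (t : ℝ) :
    L2f σ W (S.f t) (S.Nf t) = -Complex.I * (b1 * (∫ p : ℝ × ℝ, ((mm σ W p.1 ^ 2 * p.1 : ℝ) : ℂ) * tri (S.f t) (S.f t) (S.f t) p)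
      + b2 * ∫ p : ℝ × ℝ, ((mm σ W p.1 ^ 2 * p.1 : ℝ) : ℂ) * tri (S.f t) (S.g t) (S.g t) p) := by
  have i1 := int_mu1 b (S.f t) (S.f t) (S.f t)
  have i2 := int_mu1 b (S.f t) (S.g t) (S.g t)
  have j1 := i1.integral_prod_left
  have j2 := i2.integral_prod_left
  rw [Measure.volume_eq_prod] at i1 i2 ⊢
  rw [integral_prod _ i1, integral_prod _ i2, ← integral_const_mul, ← integral_const_mul,
    ← integral_add (j1.const_mul _) (j2.const_mul _), ← integral_const_mul]
  unfold L2f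
  congr 1; ext k
  rw [S.Nf_eq]
  have c1 : ∀ h1 h2 h3 : S2, ∫ x, ((mm σ W k ^ 2 * k : ℝ) : ℂ) * tri h1 h2 h3 (k, x) =
      ((mm σ W k ^ 2 * k : ℝ) : ℂ) * h1 k * ∫ x, h2 x * h3 (-k - x) := by
    intro h1 h2 h3
    rw [← integral_const_mul]
    congr 1; ext x
    unfold tri; ring
  simp only [c1]
  push_cast
  ring

lemma quad_g (b : BW A CW σ W) (t : ℝ) :
    L2f σ W (S.g t) (S.Ng t) = Complex.I * b3 *
      ∫ p : ℝ × ℝ, ((mm σ W p.2 ^ 2 * (-p.1 - p.2) : ℝ) : ℂ) * tri (S.f t) (S.g t) (S.g t) p := by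
  have i1 := int_mu2 b (S.g t) (S.g t) (S.f t)
  have e : ∫ p : ℝ × ℝ, ((mm σ W p.2 ^ 2 * (-p.1 - p.2) : ℝ) : ℂ) * tri (S.f t) (S.g t) (S.g t) p =
      ∫ p : ℝ × ℝ, ((mm σ W p.1 ^ 2 * p.2 : ℝ) : ℂ) * tri (S.g t) (S.g t) (S.f t) p := by
    rw [← int_refl (fun p : ℝ × ℝ => ((mm σ W p.1 ^ 2 * p.2 : ℝ) : ℂ) * tri (S.g t) (S.g t) (S.f t) p),
      ← int_swap]
    congr 1; ext p
    unfold tri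
    dsimp only
    rw [show -p.1 - (-p.1 - p.2) = p.2 by ring, show -p.2 - p.1 = -p.1 - p.2 by ring]
    ring
  rw [e]
  rw [Measure.volume_eq_prod] at i1 ⊢
  rw [integral_prod _ i1, ← integral_const_mul]
  unfold L2f
  congr 1; ext k
  rw [S.Ng_eq]
  have c1 : ∫ x : ℝ, ((mm σ W k ^ 2 * x : ℝ) : ℂ) * tri (S.g t) (S.g t) (S.f t) (k, x) =
      ((mm σ W k ^ 2 : ℝ) : ℂ) * S.g t k * ∫ x : ℝ, ((x : ℝ) : ℂ) * S.g t x * S.f t (-k - x) := by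
    rw [← integral_const_mul]
    congr 1; ext x
    unfold tri; push_cast; ring
  simp only [c1]
  ring

end
end HS

open MeasureTheory Set Filter
open scoped ENNReal

namespace HS

/-- conservative bilinear form -/
noncomputable def bilF (h1 h2 : S2) (ξ : ℝ) : ℂ := Complex.I * ξ * ∫ y, h1 y * h2 (ξ - y)
/-- transport bilinear form -/
noncomputable def bilG (h1 h2 : S2) (ξ : ℝ) : ℂ := Complex.I * ∫ y : ℝ, ((y : ℝ) : ℂ) * h1 y * h2 (ξ - y)

lemma bilF_meas (h1 h2 : S2) : Measurable (bilF h1 h2) := by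
  have m1 := h1.measurable
  have m2 := h2.measurable
  have : Measurable (fun p : ℝ × ℝ => h1 p.2 * h2 (p.1 - p.2)) := by fun_prop
  have := (this.stronglyMeasurable.integral_prod_right' (ν := (volume : Measure ℝ))).measurable
  unfold bilF
  exact (by fun_prop : Measurable (fun ξ : ℝ => Complex.I * (ξ : ℂ))).mul this

lemma bilG_meas (h1 h2 : S2) : Measurable (bilG h1 h2) := by
  have m1 := h1.measurable
  have m2 := h2.measurable
  have : Measurable (fun p : ℝ × ℝ => ((p.2 : ℝ) : ℂ) * h1 p.2 * h2 (p.1 - p.2)) := by fun_prop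
  have := (this.stronglyMeasurable.integral_prod_right' (ν := (volume : Measure ℝ))).measurable
  unfold bilG
  exact this.const_mul _

lemma wn_lin {w : ℝ → ℝ} (mw : Measurable w) (c1 c2 : ℝ) {n1 n2 : ℝ → ℂ} (m1 : Measurable n1) (m2 : Measurable n2)
    (n : ℝ → ℂ) (hn : ∀ ξ, n ξ = (c1 : ℂ) * n1 ξ + (c2 : ℂ) * n2 ξ) :
    wn w n ≤ ENNReal.ofReal |c1| * wn w n1 + ENNReal.ofReal |c2| * wn w n2 := by
  unfold wn
  rw [← L2n_const_mul _ _ ENNReal.ofReal_ne_top, ← L2n_const_mul _ _ ENNReal.ofReal_ne_top]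
  refine le_trans (L2n_mono _ fun ξ => ?_) (L2n_add _ _ _ (by fun_prop) (by fun_prop))
  rw [hn]
  calc ENNReal.ofReal (w ξ) * ‖(c1 : ℂ) * n1 ξ + (c2 : ℂ) * n2 ξ‖ₑ
      ≤ ENNReal.ofReal (w ξ) * (‖(c1 : ℂ) * n1 ξ‖ₑ + ‖(c2 : ℂ) * n2 ξ‖ₑ) := by
        gcongr; exact enorm_add_le _ _
    _ = _ := by rw [enorm_mul, enorm_mul, enorm_real, enorm_real]; ring

section
variable {A CW σ C : ℝ} {W : ℝ → ℝ}

lemma enorm_I : ‖Complex.I‖ₑ = 1 := by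
  rw [← ofReal_norm, Complex.norm_I, ENNReal.ofReal_one]

lemma bilF_est (h : WOK A W) (hσ : 0 < σ) (h1 h2 : S2) :
    wn (fun ξ => mm σ W ξ / jb σ ξ) (bilF h1 h2) ≤
      ENNReal.ofReal (16 * A * Real.sqrt Real.pi / (σ * Real.sqrt σ)) * (wn (mm σ W) h1 * wn (mm σ W) h2) := by
  refine bil_est h hσ h1 h2 _ (fun ξ _ => ξ) (fun _ _ => Or.inl rfl) fun ξ => ?_
  unfold bilF
  rw [enorm_mul, enorm_mul, enorm_real, enorm_I, one_mul, lintegral_const_mul' _ _ ENNReal.ofReal_ne_top]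
  gcongr
  refine (enorm_integral_le_lintegral_enorm _).trans (le_of_eq ?_)
  simp only [enorm_mul]

lemma bilG_est (h : WOK A W) (hσ : 0 < σ) (h1 h2 : S2) :
    wn (fun ξ => mm σ W ξ / jb σ ξ) (bilG h1 h2) ≤
      ENNReal.ofReal (16 * A * Real.sqrt Real.pi / (σ * Real.sqrt σ)) * (wn (mm σ W) h1 * wn (mm σ W) h2) := by
  refine bil_est h hσ h1 h2 _ (fun _ y => y) (fun _ _ => Or.inr rfl) fun ξ => ?_
  unfold bilG
  rw [enorm_mul, enorm_I, one_mul]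
  refine (enorm_integral_le_lintegral_enorm _).trans (le_of_eq ?_)
  simp only [enorm_mul, enorm_real, mul_assoc]

lemma mmj_meas (h : WOK A W) : Measurable (fun ξ => mm σ W ξ / jb σ ξ) :=
  (mm_meas h).div (jb_meas σ)

variable {a θ b1 b2 b3 : ℝ} (S : Sys a θ b1 b2 b3)

lemma Sys.Nf_eq' (t ξ : ℝ) : S.Nf t ξ = (b1 : ℂ) * bilF (S.f t) (S.f t) ξ + (b2 : ℂ) * bilF (S.g t) (S.g t) ξ := by
  rw [S.Nf_eq]; unfold bilF; ring

lemma Sys.Ng_eq' (t ξ : ℝ) : S.Ng t ξ = (b3 : ℂ) * bilG (S.g t) (S.f t) ξ := by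
  rw [S.Ng_eq]; unfold bilG; ring

lemma l6 {l : ℝ} (hl : 0 < l) : l ^ 4 * Real.sqrt (l ^ 4) = l ^ 6 := by
  rw [show l ^ 4 = (l ^ 2) ^ 2 by ring, Real.sqrt_sq (by positivity)]; ring

/-- constant for the size of nonlinearities -/
noncomputable def cZ (A b1 b2 b3 : ℝ) : ℝ := (|b1| + |b2| + |b3|) * (16 * A * Real.sqrt Real.pi)

lemma yn_of_wn {h : S2} {Z : ℝ} (hZ : 0 ≤ Z)
    (hw : wn (fun ξ => mm σ W ξ / jb σ ξ) h ≤ ENNReal.ofReal Z) : yn σ W h ≤ Z := by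
  unfold yn
  rw [← ENNReal.toReal_ofReal hZ]
  exact ENNReal.toReal_mono ENNReal.ofReal_ne_top hw

lemma Nf_yn (b : BW A CW σ W) {l : ℝ} (hl : 0 < l) (hσ : σ = l ^ 4) (t X : ℝ) (h0 : 0 ≤ X)
    (hf : xn σ W (S.f t) ≤ X) (hg : xn σ W (S.g t) ≤ X) : yn σ W (S.Nf t) ≤ cZ A b1 b2 b3 / l ^ 6 * X ^ 2 := by
  have hA := b.ok.one_le_A
  have e1 := bilF_est b.ok b.σ_pos (S.f t) (S.f t)
  have e2 := bilF_est b.ok b.σ_pos (S.g t) (S.g t)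
  have k1 : wn (mm σ W) (S.f t) ≤ ENNReal.ofReal X := by rw [← ofReal_xn b]; exact ENNReal.ofReal_le_ofReal hf
  have k2 : wn (mm σ W) (S.g t) ≤ ENNReal.ofReal X := by rw [← ofReal_xn b]; exact ENNReal.ofReal_le_ofReal hg
  have e := wn_lin (mmj_meas (σ := σ) b.ok) b1 b2 (bilF_meas (S.f t) (S.f t)) (bilF_meas (S.g t) (S.g t)) _ (S.Nf_eq' t)
  apply yn_of_wn (by unfold cZ; positivity)
  refine e.trans ?_
  calc _ ≤ ENNReal.ofReal |b1| * (ENNReal.ofReal (16 * A * Real.sqrt Real.pi / (σ * Real.sqrt σ)) * (ENNReal.ofReal X * ENNReal.ofReal X))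
      + ENNReal.ofReal |b2| * (ENNReal.ofReal (16 * A * Real.sqrt Real.pi / (σ * Real.sqrt σ)) * (ENNReal.ofReal X * ENNReal.ofReal X)) := by
        gcongr
        · exact e1.trans (by gcongr)
        · exact e2.trans (by gcongr)
    _ = ENNReal.ofReal ((|b1| + |b2|) * (16 * A * Real.sqrt Real.pi / (σ * Real.sqrt σ) * (X * X))) := by
        have := b.σ_pos
        rw [ENNReal.ofReal_mul (by positivity), ENNReal.ofReal_add (by positivity) (by positivity),
          ENNReal.ofReal_mul (by positivity), ENNReal.ofReal_mul h0]
        ring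
    _ ≤ _ := by
        apply ENNReal.ofReal_le_ofReal
        rw [hσ, l6 hl]
        unfold cZ
        calc _ = (|b1| + |b2| + 0) * (16 * A * Real.sqrt Real.pi) / l ^ 6 * X ^ 2 := by ring
          _ ≤ _ := by gcongr; positivity

lemma Ng_yn (b : BW A CW σ W) {l : ℝ} (hl : 0 < l) (hσ : σ = l ^ 4) (t X : ℝ) (h0 : 0 ≤ X)
    (hf : xn σ W (S.f t) ≤ X) (hg : xn σ W (S.g t) ≤ X) : yn σ W (S.Ng t) ≤ cZ A b1 b2 b3 / l ^ 6 * X ^ 2 := by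
  have hA := b.ok.one_le_A
  have e1 := bilG_est b.ok b.σ_pos (S.g t) (S.f t)
  have k1 : wn (mm σ W) (S.f t) ≤ ENNReal.ofReal X := by rw [← ofReal_xn b]; exact ENNReal.ofReal_le_ofReal hf
  have k2 : wn (mm σ W) (S.g t) ≤ ENNReal.ofReal X := by rw [← ofReal_xn b]; exact ENNReal.ofReal_le_ofReal hg
  have e := wn_lin (mmj_meas (σ := σ) b.ok) b3 0 (bilG_meas (S.g t) (S.f t)) (bilG_meas (S.g t) (S.f t)) (S.Ng t)
    (fun ξ => by rw [S.Ng_eq']; simp)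
  apply yn_of_wn (by unfold cZ; positivity)
  refine e.trans ?_
  calc _ ≤ ENNReal.ofReal |b3| * (ENNReal.ofReal (16 * A * Real.sqrt Real.pi / (σ * Real.sqrt σ)) * (ENNReal.ofReal X * ENNReal.ofReal X)) := by
        simp only [abs_zero, ENNReal.ofReal_zero, zero_mul, add_zero]
        gcongr
        exact e1.trans (by gcongr)
    _ = ENNReal.ofReal (|b3| * (16 * A * Real.sqrt Real.pi / (σ * Real.sqrt σ) * (X * X))) := by
        have := b.σ_pos
        rw [ENNReal.ofReal_mul (by positivity),
          ENNReal.ofReal_mul (by positivity), ENNReal.ofReal_mul h0]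
    _ ≤ _ := by
        apply ENNReal.ofReal_le_ofReal
        rw [hσ, l6 hl]
        unfold cZ
        calc _ = (0 + |b3|) * (16 * A * Real.sqrt Real.pi) / l ^ 6 * X ^ 2 := by ring
          _ ≤ _ := by gcongr; positivity

/-- cubic form -/
noncomputable def T3 (G : ℝ → ℝ → ℝ) (h0 h1 h2 : S2) : ℂ := ∫ p : ℝ × ℝ, ((G p.1 p.2 : ℝ) : ℂ) * tri h0 h1 h2 p

lemma Lam3_eq (G : ℝ → ℝ → ℝ) (hs : Fin 3 → S2) :
    Lam volume (fun p : ℝ × ℝ => ((G p.1 p.2 : ℝ) : ℂ)) e3 hs = T3 G (hs 0) (hs 1) (hs 2) := by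
  unfold Lam T3
  congr 1; ext p
  rw [Fin.prod_univ_three]; rfl

lemma T3_refl (G : ℝ → ℝ → ℝ) (hG : ∀ k x, G k (-k - x) = G k x) (h0 h1 h2 : S2) : T3 G h0 h1 h2 = T3 G h0 h2 h1 := by
  unfold T3
  rw [← int_refl (fun p : ℝ × ℝ => ((G p.1 p.2 : ℝ) : ℂ) * tri h0 h1 h2 p)]
  congr 1; ext p
  unfold tri
  dsimp only
  rw [hG, show -p.1 - (-p.1 - p.2) = p.2 by ring]; ring

lemma T3_swap (G : ℝ → ℝ → ℝ) (h0 h1 h2 : S2) : T3 G h0 h1 h2 = T3 (fun k x => G x k) h1 h0 h2 := by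
  unfold T3
  rw [← int_swap]
  congr 1; ext p
  unfold tri
  dsimp only
  rw [show -p.2 - p.1 = -p.1 - p.2 by ring]; ring

lemma T3_deriv (b : BW A CW σ W) {G : ℝ → ℝ → ℝ} (hG : GOK σ W C G) (hC : 0 ≤ C)
    (mG : Measurable (fun p : ℝ × ℝ => G p.1 p.2)) (c d : ℝ) (M : ℝ → ℝ → ℝ) (hM : ∀ k x, G k x * al θ c d k x = M k x)
    (h k : ℝ → S2) (Ph Nh Pk Nk : S2) (s : Set ℝ) (t : ℝ)
    (hh : HasDerivWithinAt h (Ph + Nh) s t) (hk : HasDerivWithinAt k (Pk + Nk) s t)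
    (hPh : ∀ ξ, Ph ξ = Complex.I * ((θ * c * ξ ^ 3 : ℝ) : ℂ) * h t ξ)
    (hPk : ∀ ξ, Pk ξ = Complex.I * ((θ * d * ξ ^ 3 : ℝ) : ℂ) * k t ξ) :
    HasDerivWithinAt (fun τ => T3 G (h τ) (k τ) (k τ))
      (Complex.I * T3 M (h t) (k t) (k t) + (T3 G Nh (k t) (k t) + T3 G (h t) Nk (k t) + T3 G (h t) (k t) Nk)) s t := by
  have key := Lam_hasDeriv (LamOK_cubic b hG hC mG) ![h, k, k] ![Ph + Nh, Pk + Nk, Pk + Nk] ![Ph, Pk, Pk] ![Nh, Nk, Nk]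
    ![fun ξ => θ * c * ξ ^ 3, fun ξ => θ * d * ξ ^ 3, fun ξ => θ * d * ξ ^ 3] (fun p => al θ c d p.1 p.2) s t
    (by intro i; fin_cases i <;> simpa) (by intro i; fin_cases i <;> simp)
    (by
      intro i ξ
      fin_cases i
      · simpa using hPh ξ
      · simpa using hPk ξ
      · simpa using hPk ξ)
    (by
      intro p
      rw [Fin.sum_univ_three]
      simp [al, e3]; ring)
  have e1 : (fun τ => Lam volume (fun p : ℝ × ℝ => ((G p.1 p.2 : ℝ) : ℂ)) e3 (fun i => (![h, k, k] : Fin 3 → ℝ → S2) i τ))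
      = fun τ => T3 G (h τ) (k τ) (k τ) := by
    ext τ; rw [Lam3_eq]; rfl
  rw [e1] at key
  convert key using 1
  congr 1
  · congr 1
    have : (fun p : ℝ × ℝ => ((G p.1 p.2 : ℝ) : ℂ) * ((al θ c d p.1 p.2 : ℝ) : ℂ)) = fun p : ℝ × ℝ => ((M p.1 p.2 : ℝ) : ℂ) := by
      ext p; rw [← hM]; push_cast; ring
    rw [this, Lam3_eq M]; rfl
  · rw [Fin.sum_univ_three, Lam3_eq, Lam3_eq, Lam3_eq]
    simp

lemma L2f_deriv (b : BW A CW σ W) (c : ℝ) (h : ℝ → S2) (Ph Nh : S2) (s : Set ℝ) (t : ℝ)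
    (hh : HasDerivWithinAt h (Ph + Nh) s t)
    (hPh : ∀ ξ, Ph ξ = Complex.I * ((θ * c * ξ ^ 3 : ℝ) : ℂ) * h t ξ) :
    HasDerivWithinAt (fun τ => L2f σ W (h τ) (h τ)) (2 * L2f σ W (h t) Nh) s t := by
  have key := Lam_hasDeriv (LamOK_quad b) (fun _ => h) (fun _ => Ph + Nh) (fun _ => Ph) (fun _ => Nh)
    (fun _ ξ => θ * c * ξ ^ 3) (fun _ => 0) s t (fun _ => hh) (fun _ => rfl) (fun _ => hPh)
    (by intro p; rw [Fin.sum_univ_two]; simp [e2]; ring)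
  simp only [L2f_eq] at key
  convert key using 1
  rw [Fin.sum_univ_two]
  simp only [Lam, Complex.ofReal_zero, mul_zero, zero_mul, integral_zero]
  simp
  rw [L2f_symm Nh]; ring

end
end HS

open MeasureTheory Set Filter
open scoped ENNReal

namespace HS
section
variable {A CW σ C : ℝ} {W : ℝ → ℝ}
variable {a θ b1 b2 b3 : ℝ} (S : Sys a θ b1 b2 b3)

/-- component selector -/
def Sys.h (c : Bool) (t : ℝ) : S2 := if c then S.f t else S.g t
def Sys.P (c : Bool) (t : ℝ) : S2 := if c then S.Pf t else S.Pg t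
def Sys.N (c : Bool) (t : ℝ) : S2 := if c then S.Nf t else S.Ng t
/-- dispersion coefficient selector -/
def co (a : ℝ) (c : Bool) : ℝ := if c then a else 1

lemma Sys.P_eq (c : Bool) (t ξ : ℝ) : S.P c t ξ = Complex.I * ((θ * co a c * ξ ^ 3 : ℝ) : ℂ) * S.h c t ξ := by
  cases c
  · exact S.Pg_eq t ξ
  · exact S.Pf_eq t ξ

/-- regularity at a time -/
def Sys.Reg (s : Set ℝ) (t : ℝ) : Prop :=
  HasDerivWithinAt S.f (S.Pf t + S.Nf t) s t ∧ HasDerivWithinAt S.g (S.Pg t + S.Ng t) s t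

lemma Sys.Reg.h {S : Sys a θ b1 b2 b3} {s : Set ℝ} {t : ℝ} (r : S.Reg s t) (c : Bool) :
    HasDerivWithinAt (S.h c) (S.P c t + S.N c t) s t := by
  cases c
  · exact r.2
  · exact r.1

variable {K κ Φ : R3 → ℝ}

noncomputable def RR (l : ℝ) (K κ Φ : R3 → ℝ) (bt : Fin 4 → Bool) (τ : ℝ) : ℂ :=
  Lam volume (Kfar (l ^ 2)⁻¹ K κ Φ) e4 (fun i => S.h (bt i) τ)

noncomputable def cR (A C b1 b2 b3 : ℝ) : ℝ := 24 * Real.pi * C * Real.sqrt C * (1 + cZ A b1 b2 b3)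

lemma cZ_nonneg (hA : 1 ≤ A) : 0 ≤ cZ A b1 b2 b3 := by unfold cZ; positivity

lemma quart_sys (b : BW A CW σ W) (q : QOK σ W C K κ Φ) (l : ℝ) (hl : 0 < l) (hσ : σ = l ^ 4)
    (bt : Fin 4 → Bool) (hΦ : ∀ p, Φ p = ∑ i, θ * co a (bt i) * (e4 i p) ^ 3) (s : Set ℝ) (t X : ℝ) (h0 : 0 ≤ X)
    (hf : xn σ W (S.f t) ≤ X) (hg : xn σ W (S.g t) ≤ X) (r : S.Reg s t) :
    ∃ R', HasDerivWithinAt (RR S l K κ Φ bt) R' s t ∧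
      ‖Complex.I * Qint K (fun i => S.h (bt i) t) - R'‖ ≤ cR A C b1 b2 b3 * (l ^ 3 * (X ^ 4 + X ^ 5)) := by
  have hx : ∀ c, xn σ W (S.h c t) ≤ X := by
    intro c; cases c
    · exact hg
    · exact hf
  have hn : ∀ c, yn σ W (S.N c t) ≤ cZ A b1 b2 b3 / l ^ 6 * X ^ 2 := by
    intro c; cases c
    · exact Ng_yn S b hl hσ t X h0 hf hg
    · exact Nf_yn S b hl hσ t X h0 hf hg
  obtain ⟨R', h1, h2⟩ := quart_corr b q l hl hσ (fun i => S.h (bt i)) (fun i => S.P (bt i) t) (fun i => S.N (bt i) t)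
    (fun i ξ => θ * co a (bt i) * ξ ^ 3) s t (fun i ξ => S.P_eq _ _ _) hΦ (fun i => r.h _) X _ h0 (fun i => hx _)
    (fun i => hn _)
  refine ⟨R', h1, h2.trans ?_⟩
  have hC := q.C_pos
  have hz := cZ_nonneg (b1 := b1) (b2 := b2) (b3 := b3) b.ok.one_le_A
  unfold cR
  have e : l ^ 9 * (cZ A b1 b2 b3 / l ^ 6 * X ^ 2 * X ^ 3) = cZ A b1 b2 b3 * (l ^ 3 * X ^ 5) := by
    field_simp
  rw [e, mul_assoc (24 * Real.pi * C * Real.sqrt C)]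
  have hx4 : 0 ≤ l ^ 3 * X ^ 4 := by positivity
  have hx5 : 0 ≤ l ^ 3 * X ^ 5 := by positivity
  gcongr
  nlinarith [mul_nonneg hz hx4]

lemma quart_sys_size (b : BW A CW σ W) (q : QOK σ W C K κ Φ) (l : ℝ) (hl : 0 < l) (hσ : σ = l ^ 4)
    (bt : Fin 4 → Bool) (t X : ℝ) (h0 : 0 ≤ X)
    (hf : xn σ W (S.f t) ≤ X) (hg : xn σ W (S.g t) ≤ X) :
    ‖RR S l K κ Φ bt t‖ ≤ cR A C b1 b2 b3 * (l ^ 9 * X ^ 4) := by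
  have hx : ∀ c, xn σ W (S.h c t) ≤ X := by
    intro c; cases c
    · exact hg
    · exact hf
  refine (quart_corr_size b q l hl hσ _ X h0 (fun i => hx _)).trans ?_
  have hC := q.C_pos
  have hz := cZ_nonneg (b1 := b1) (b2 := b2) (b3 := b3) b.ok.one_le_A
  unfold cR
  have : 0 ≤ 24 * Real.pi * C * Real.sqrt C * (l ^ 9 * X ^ 4) := by positivity
  nlinarith

lemma quart_sys_int (b : BW A CW σ W) (q : QOK σ W C K κ Φ)
    (bt : Fin 4 → Bool) (hΦ : ∀ p, Φ p = ∑ i, θ * co a (bt i) * (e4 i p) ^ 3) (t : ℝ) :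
    Integrable (fun p => (K p : ℂ) * ∏ i, S.h (bt i) t (e4 i p)) :=
  Q_integrable b q (fun i => S.h (bt i) t) (fun i => S.P (bt i) t) (fun i ξ => θ * co a (bt i) * ξ ^ 3)
    (fun i ξ => S.P_eq _ _ _) hΦ

lemma Qint_iter (hs : Fin 4 → S2) (hi : Integrable (fun p => (K p : ℂ) * ∏ i, hs i (e4 i p))) :
    Qint K hs = ∫ p : ℝ × ℝ, ∫ y, (K (p, y) : ℂ) * (hs 0 p.2 * hs 1 (-p.1 - p.2) * hs 2 y * hs 3 (p.1 - y)) := by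
  unfold Qint
  have hi' := hi
  rw [Measure.volume_eq_prod] at hi' ⊢
  rw [integral_prod _ hi']
  congr 1; ext p; congr 1; ext y
  rw [Fin.prod_univ_four]; rfl

lemma Qint_iter_int (hs : Fin 4 → S2) (hi : Integrable (fun p => (K p : ℂ) * ∏ i, hs i (e4 i p))) :
    Integrable (fun p : ℝ × ℝ => ∫ y, (K (p, y) : ℂ) * (hs 0 p.2 * hs 1 (-p.1 - p.2) * hs 2 y * hs 3 (p.1 - y))) := by
  have hi' := hi
  rw [Measure.volume_eq_prod] at hi'
  refine hi'.integral_prod_left.congr (Eventually.of_forall fun p => ?_)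
  dsimp only
  congr 1; ext y
  rw [Fin.prod_univ_four]; rfl

lemma T3_N_A (G : ℝ → ℝ → ℝ) (k k' N : S2) (hs1 hs2 : Fin 4 → S2) (h10 : hs1 0 = k) (h11 : hs1 1 = k')
    (h20 : hs2 0 = k) (h21 : hs2 1 = k')
    (hN : ∀ ξ, N ξ = (b1 : ℂ) * bilF (hs1 2) (hs1 3) ξ + (b2 : ℂ) * bilF (hs2 2) (hs2 3) ξ)
    (hi1 : Integrable (fun p => (KA G p : ℂ) * ∏ i, hs1 i (e4 i p)))
    (hi2 : Integrable (fun p => (KA G p : ℂ) * ∏ i, hs2 i (e4 i p))) :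
    T3 G N k k' = Complex.I * (b1 * Qint (KA G) hs1 + b2 * Qint (KA G) hs2) := by
  rw [Qint_iter hs1 hi1, Qint_iter hs2 hi2, ← integral_const_mul, ← integral_const_mul,
    ← integral_add ((Qint_iter_int hs1 hi1).const_mul _) ((Qint_iter_int hs2 hi2).const_mul _), ← integral_const_mul]
  unfold T3
  congr 1; ext p
  have c1 : ∀ h0 h1 h2 h3 : S2, ∫ y, (KA G (p, y) : ℂ) * (h0 p.2 * h1 (-p.1 - p.2) * h2 y * h3 (p.1 - y)) =
      ((p.1 * G p.1 p.2 : ℝ) : ℂ) * (h0 p.2 * h1 (-p.1 - p.2)) * ∫ y, h2 y * h3 (p.1 - y) := by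
    intro h0 h1 h2 h3
    rw [← integral_const_mul]
    congr 1; ext y
    unfold KA; ring
  rw [c1, c1, h10, h11, h20, h21]
  unfold tri
  rw [hN]
  unfold bilF
  push_cast
  ring

lemma T3_N_B (G : ℝ → ℝ → ℝ) (N : S2) (hs : Fin 4 → S2)
    (hN : ∀ ξ, N ξ = (b3 : ℂ) * bilG (hs 2) (hs 3) ξ)
    (hi : Integrable (fun p => (KB G p : ℂ) * ∏ i, hs i (e4 i p))) :
    T3 G N (hs 0) (hs 1) = Complex.I * (b3 * Qint (KB G) hs) := by
  rw [Qint_iter hs hi, ← integral_const_mul, ← integral_const_mul]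
  unfold T3
  congr 1; ext p
  have c1 : ∀ h0 h1 h2 h3 : S2, ∫ y, (KB G (p, y) : ℂ) * (h0 p.2 * h1 (-p.1 - p.2) * h2 y * h3 (p.1 - y)) =
      ((G p.1 p.2 : ℝ) : ℂ) * (h0 p.2 * h1 (-p.1 - p.2)) * ∫ y : ℝ, ((y : ℝ) : ℂ) * h2 y * h3 (p.1 - y) := by
    intro h0 h1 h2 h3
    rw [← integral_const_mul]
    congr 1; ext y
    unfold KB; push_cast; ring
  rw [c1]
  unfold tri
  rw [hN]
  unfold bilG
  ring

lemma GOK_swap {G : ℝ → ℝ → ℝ} (hG : GOK σ W C G) : GOK σ W C (fun k x => G x k) := by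
  intro k x
  have := hG x k
  rw [show -x - k = -k - x by ring] at this
  calc _ = |G x k| * (jb σ x + jb σ k + jb σ (-k - x)) := by ring
    _ ≤ _ := this
    _ = _ := by ring

/-- the quadratic energy -/
noncomputable def En (γ : ℝ) (σ : ℝ) (W : ℝ → ℝ) (t : ℝ) : ℂ :=
  L2f σ W (S.f t) (S.f t) + γ * L2f σ W (S.g t) (S.g t)

/-- the energy corrected by the cubic terms -/
noncomputable def En2 (γ : ℝ) (σ : ℝ) (W : ℝ → ℝ) (t : ℝ) : ℂ :=
  L2f σ W (S.f t) (S.f t) + γ * L2f σ W (S.g t) (S.g t) +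
    ((2 * b1 / 3 : ℝ) : ℂ) * T3 (Gu a θ σ W) (S.f t) (S.f t) (S.f t) +
    ((2 * b2 : ℝ) : ℂ) * T3 (Gv a θ σ W) (S.f t) (S.g t) (S.g t)

lemma En2_deriv (b : BW A CW σ W) (ha : a ≠ 0) (ha' : a < 1 / 4) (hθ : 0 < θ) (γ : ℝ) (hγ : γ * b3 = -2 * b2)
    (s : Set ℝ) (t : ℝ) (r : S.Reg s t) :
    HasDerivWithinAt (En2 S γ σ W) (((2 * b1 : ℝ) : ℂ) * T3 (Gu a θ σ W) (S.Nf t) (S.f t) (S.f t) +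
      ((2 * b2 : ℝ) : ℂ) * T3 (Gv a θ σ W) (S.Nf t) (S.g t) (S.g t) +
      ((4 * b2 : ℝ) : ℂ) * T3 (fun k x => Gv a θ σ W x k) (S.Ng t) (S.f t) (S.g t)) s t := by
  have hmin : 0 < min 1 (1 - 4 * a) := lt_min one_pos (by linarith)
  have hA := b.ok.one_le_A
  have hGu := GOK_Gu (σ := σ) b.ok ha hθ
  have hGv := GOK_Gv (σ := σ) b.ok ha' hθ
  have d1 := L2f_deriv (θ := θ) b a S.f (S.Pf t) (S.Nf t) s t r.1 (S.Pf_eq t)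
  have d2 := L2f_deriv (θ := θ) b 1 S.g (S.Pg t) (S.Ng t) s t r.2 (S.Pg_eq t)
  have d3 := T3_deriv (θ := θ) b hGu (by positivity) (Gu_meas b.ok) a a (Mu σ W) (Mu_eq b.ok ha hθ)
    S.f S.f (S.Pf t) (S.Nf t) (S.Pf t) (S.Nf t) s t r.1 r.1 (S.Pf_eq t) (S.Pf_eq t)
  have d4 := T3_deriv (θ := θ) b hGv (by positivity) (Gv_meas b.ok) a 1 (Mv σ W) (Mv_eq b.ok ha' hθ)
    S.f S.g (S.Pf t) (S.Nf t) (S.Pg t) (S.Ng t) s t r.1 r.2 (S.Pf_eq t) (S.Pg_eq t)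
  have D := ((d1.add (d2.const_mul (γ : ℂ))).add (d3.const_mul ((2 * b1 / 3 : ℝ) : ℂ))).add (d4.const_mul ((2 * b2 : ℝ) : ℂ))
  have eD : En2 S γ σ W = (fun τ => L2f σ W (S.f τ) (S.f τ)) + (fun τ => (γ : ℂ) * L2f σ W (S.g τ) (S.g τ)) +
      (fun τ => ((2 * b1 / 3 : ℝ) : ℂ) * T3 (Gu a θ σ W) (S.f τ) (S.f τ) (S.f τ)) +
      (fun τ => ((2 * b2 : ℝ) : ℂ) * T3 (Gv a θ σ W) (S.f τ) (S.g τ) (S.g τ)) := by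
    ext τ; simp [En2]
  rw [eD]
  refine HasDerivWithinAt.congr_deriv D ?_
  have s1 : T3 (Gu a θ σ W) (S.f t) (S.Nf t) (S.f t) = T3 (Gu a θ σ W) (S.Nf t) (S.f t) (S.f t) := by
    rw [T3_swap]
    congr 1; ext k x; exact Gu_swap x k
  have s2 : T3 (Gu a θ σ W) (S.f t) (S.f t) (S.Nf t) = T3 (Gu a θ σ W) (S.Nf t) (S.f t) (S.f t) := by
    rw [T3_refl _ Gu_refl, s1]
  have s3 : T3 (Gv a θ σ W) (S.f t) (S.g t) (S.Ng t) = T3 (fun k x => Gv a θ σ W x k) (S.Ng t) (S.f t) (S.g t) := by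
    rw [T3_refl _ Gv_refl, T3_swap]
  have s4 : T3 (Gv a θ σ W) (S.f t) (S.Ng t) (S.g t) = T3 (fun k x => Gv a θ σ W x k) (S.Ng t) (S.f t) (S.g t) := by
    rw [T3_swap]
  have u1 : T3 (Mu σ W) (S.f t) (S.f t) (S.f t) = _ := tri_sum_u b (S.f t)
  have u2 : T3 (Mv σ W) (S.f t) (S.g t) (S.g t) = _ := tri_sum_v b (S.f t) (S.g t)
  rw [s1, s2, s3, s4, quad_f S b t, quad_g S b t, u1, u2]
  have hγ' : (γ : ℂ) * b3 = -2 * b2 := by exact_mod_cast hγ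
  generalize (∫ p : ℝ × ℝ, ((mm σ W p.2 ^ 2 * (-p.1 - p.2) : ℝ) : ℂ) * tri (S.f t) (S.g t) (S.g t) p) = U
  push_cast
  linear_combination (2 * Complex.I * U) * hγ'

end
end HS

open MeasureTheory Set Filter
open scoped ENNReal

namespace HS

def bt1 : Fin 4 → Bool := ![true, true, true, true]
def bt2 : Fin 4 → Bool := ![true, true, false, false]
def bt3 : Fin 4 → Bool := ![false, false, true, true]
def bt4 : Fin 4 → Bool := ![false, false, false, false]
def bt5 : Fin 4 → Bool := ![true, false, false, true]

lemma bt1_Φ (θ a : ℝ) (p : R3) : ΦA θ a a p = ∑ i, θ * co a (bt1 i) * (e4 i p) ^ 3 := by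
  rw [Fin.sum_univ_four]; simp [ΦA, e4, co, bt1]
lemma bt2_Φ (θ a : ℝ) (p : R3) : ΦA θ a 1 p = ∑ i, θ * co a (bt2 i) * (e4 i p) ^ 3 := by
  rw [Fin.sum_univ_four]; simp [ΦA, e4, co, bt2]
lemma bt3_Φ (θ a : ℝ) (p : R3) : ΦA θ 1 a p = ∑ i, θ * co a (bt3 i) * (e4 i p) ^ 3 := by
  rw [Fin.sum_univ_four]; simp [ΦA, e4, co, bt3]
lemma bt4_Φ (θ a : ℝ) (p : R3) : ΦA θ 1 1 p = ∑ i, θ * co a (bt4 i) * (e4 i p) ^ 3 := by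
  rw [Fin.sum_univ_four]; simp [ΦA, e4, co, bt4]
lemma bt5_Φ (θ a : ℝ) (p : R3) : ΦB θ a p = ∑ i, θ * co a (bt5 i) * (e4 i p) ^ 3 := by
  rw [Fin.sum_univ_four]; simp [ΦB, e4, co, bt5]

/-- sum of absolute values of the quartic coefficients -/
noncomputable def cS (b1 b2 b3 : ℝ) : ℝ := |2 * b1 * b1| + |2 * b1 * b2| + |2 * b2 * b1| + |2 * b2 * b2| + |4 * b2 * b3|

lemma five_norm (c1 c2 c3 c4 c5 : ℝ) (z1 z2 z3 z4 z5 : ℂ) (B : ℝ) (h1 : ‖z1‖ ≤ B) (h2 : ‖z2‖ ≤ B) (h3 : ‖z3‖ ≤ B)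
    (h4 : ‖z4‖ ≤ B) (h5 : ‖z5‖ ≤ B) :
    ‖(c1 : ℂ) * z1 + (c2 : ℂ) * z2 + (c3 : ℂ) * z3 + (c4 : ℂ) * z4 + (c5 : ℂ) * z5‖ ≤
      (|c1| + |c2| + |c3| + |c4| + |c5|) * B := by
  have k : ∀ (c : ℝ) (z : ℂ), ‖z‖ ≤ B → ‖(c : ℂ) * z‖ ≤ |c| * B := by
    intro c z hz
    rw [norm_mul, Complex.norm_real, Real.norm_eq_abs]; gcongr
  have t1 := norm_add_le ((c1 : ℂ) * z1 + (c2 : ℂ) * z2 + (c3 : ℂ) * z3 + (c4 : ℂ) * z4) ((c5 : ℂ) * z5)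
  have t2 := norm_add_le ((c1 : ℂ) * z1 + (c2 : ℂ) * z2 + (c3 : ℂ) * z3) ((c4 : ℂ) * z4)
  have t3 := norm_add_le ((c1 : ℂ) * z1 + (c2 : ℂ) * z2) ((c3 : ℂ) * z3)
  have t4 := norm_add_le ((c1 : ℂ) * z1) ((c2 : ℂ) * z2)
  have := k c1 z1 h1
  have := k c2 z2 h2
  have := k c3 z3 h3
  have := k c4 z4 h4
  have := k c5 z5 h5
  linarith

lemma swap_meas (G : ℝ → ℝ → ℝ) (mG : Measurable (fun p : ℝ × ℝ => G p.1 p.2)) :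
    Measurable (fun p : ℝ × ℝ => G p.2 p.1) :=
  mG.comp (measurable_snd.prodMk measurable_fst)

set_option maxHeartbeats 1000000 in
theorem energy3 (A a θ b1 b2 b3 : ℝ) (ha : a ≠ 0) (ha' : a < 1 / 4) (hθ : 0 < θ) (hA : 1 ≤ A) :
    ∃ C0 : ℝ, 0 < C0 ∧ ∀ (CW σ : ℝ) (W : ℝ → ℝ) (_ : BW A CW σ W) (S : Sys a θ b1 b2 b3) (γ : ℝ) (_ : γ * b3 = -2 * b2)
      (l : ℝ) (_ : 0 < l) (_ : σ = l ^ 4), ∃ E : ℝ → ℂ,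
      (∀ t X, 0 ≤ X → xn σ W (S.f t) ≤ X → xn σ W (S.g t) ≤ X →
        ‖E t - En S γ σ W t‖ ≤ C0 * (l ^ 6 * X ^ 3 + l ^ 9 * X ^ 4)) ∧
      (∀ s t X, 0 ≤ X → xn σ W (S.f t) ≤ X → xn σ W (S.g t) ≤ X → S.Reg s t →
        ∃ E', HasDerivWithinAt E E' s t ∧ ‖E'‖ ≤ C0 * (l ^ 3 * (X ^ 4 + X ^ 5))) := by
  obtain ⟨D, hD, hres⟩ := res_mixed a ha ha'
  have hmin : 0 < min 1 (1 - 4 * a) := lt_min one_pos (by linarith)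
  have haa : 0 < |a| := abs_pos.2 ha
  set C1 := 800 * A ^ 2 / (3 * θ * |a|) with hC1
  set C2 := 160 * A ^ 2 / (θ * min 1 (1 - 4 * a) / 6) with hC2
  have C1p : 0 < C1 := by positivity
  have C2p : 0 < C2 := by positivity
  set E0 := 8 * A * C1 + 8 * A * C2 + 1 / |3 * θ * a| + 1 / |3 * θ * 1| + D / θ with hE0
  have q1 : 0 < 8 * A * C1 := by positivity
  have q2 : 0 < 8 * A * C2 := by positivity
  have q3 : 0 < 1 / |3 * θ * a| := by positivity
  have q4 : 0 < 1 / |3 * θ * 1| := by positivity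
  have q5 : 0 < D / θ := by positivity
  have E0p : 0 < E0 := by positivity
  have hz := cZ_nonneg (b1 := b1) (b2 := b2) (b3 := b3) hA
  have hcR : 0 < cR A E0 b1 b2 b3 := by unfold cR; positivity
  have hcS : 0 ≤ cS b1 b2 b3 := by unfold cS; positivity
  refine ⟨cS b1 b2 b3 * cR A E0 b1 b2 b3 + |2 * b1 / 3| * (2 * C1) + |2 * b2| * (2 * C2) + 1, by positivity, ?_⟩
  intro CW σ W b S γ hγ l hl hσ
  have hGu : GOK σ W C1 (Gu a θ σ W) := GOK_Gu (σ := σ) b.ok ha hθ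
  have hGv : GOK σ W C2 (Gv a θ σ W) := GOK_Gv (σ := σ) b.ok ha' hθ
  have mu := Gu_meas (a := a) (θ := θ) (σ := σ) b.ok
  have mv := Gv_meas (a := a) (θ := θ) (σ := σ) b.ok
  have mv' : Measurable (fun p : ℝ × ℝ => Gv a θ σ W p.2 p.1) := swap_meas _ mv
  have Q1 := QOK_A b.ok b.σ_pos hGu C1p.le mu hθ a a ha ha E0 (by linarith) (by linarith) (by linarith)
  have Q2 := QOK_A b.ok b.σ_pos hGu C1p.le mu hθ a 1 ha one_ne_zero E0 (by linarith) (by linarith) (by linarith)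
  have Q3 := QOK_A b.ok b.σ_pos hGv C2p.le mv hθ 1 a one_ne_zero ha E0 (by linarith) (by linarith) (by linarith)
  have Q4 := QOK_A b.ok b.σ_pos hGv C2p.le mv hθ 1 1 one_ne_zero one_ne_zero E0 (by linarith) (by linarith) (by linarith)
  have Q5 := QOK_B b.ok b.σ_pos (GOK_swap hGv) C2p.le mv' hθ D E0 hD hres (by linarith) (by linarith)
  set R1 := RR S l (KA (Gu a θ σ W)) (fun p => |p.1.1|) (ΦA θ a a) bt1 with hR1
  set R2 := RR S l (KA (Gu a θ σ W)) (fun p => |p.1.1|) (ΦA θ a 1) bt2 with hR2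
  set R3' := RR S l (KA (Gv a θ σ W)) (fun p => |p.1.1|) (ΦA θ 1 a) bt3 with hR3
  set R4 := RR S l (KA (Gv a θ σ W)) (fun p => |p.1.1|) (ΦA θ 1 1) bt4 with hR4
  set R5 := RR S l (KB (fun k x => Gv a θ σ W x k)) (fun p => |p.1.2| + |p.2 - p.1.1| + |p.1.1|) (ΦB θ a) bt5 with hR5
  refine ⟨En2 S γ σ W - ((fun τ => ((2 * b1 * b1 : ℝ) : ℂ) * R1 τ) + (fun τ => ((2 * b1 * b2 : ℝ) : ℂ) * R2 τ) +
    (fun τ => ((2 * b2 * b1 : ℝ) : ℂ) * R3' τ) + (fun τ => ((2 * b2 * b2 : ℝ) : ℂ) * R4 τ) +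
    (fun τ => ((4 * b2 * b3 : ℝ) : ℂ) * R5 τ)), ?_, ?_⟩
  · intro t X h0 hf hg
    have z1 := quart_sys_size S b Q1 l hl hσ bt1 t X h0 hf hg
    have z2 := quart_sys_size S b Q2 l hl hσ bt2 t X h0 hf hg
    have z3 := quart_sys_size S b Q3 l hl hσ bt3 t X h0 hf hg
    have z4 := quart_sys_size S b Q4 l hl hσ bt4 t X h0 hf hg
    have z5 := quart_sys_size S b Q5 l hl hσ bt5 t X h0 hf hg
    have zz := five_norm (2 * b1 * b1) (2 * b1 * b2) (2 * b2 * b1) (2 * b2 * b2) (4 * b2 * b3) _ _ _ _ _ _ z1 z2 z3 z4 z5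
    have c1 := cubic_norm b hGu C1p.le l hl hσ ![S.f t, S.f t, S.f t] X h0 (by
      intro i; fin_cases i <;> simpa)
    have c2 := cubic_norm b hGv C2p.le l hl hσ ![S.f t, S.g t, S.g t] X h0 (by
      intro i; fin_cases i <;> simpa)
    rw [Lam3_eq] at c1 c2
    replace c1 : ‖T3 (Gu a θ σ W) (S.f t) (S.f t) (S.f t)‖ ≤ 2 * C1 * (l ^ 6 * X ^ 3) := c1
    replace c2 : ‖T3 (Gv a θ σ W) (S.f t) (S.g t) (S.g t)‖ ≤ 2 * C2 * (l ^ 6 * X ^ 3) := c2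
    have e : (En2 S γ σ W - ((fun τ => ((2 * b1 * b1 : ℝ) : ℂ) * R1 τ) + (fun τ => ((2 * b1 * b2 : ℝ) : ℂ) * R2 τ) +
      (fun τ => ((2 * b2 * b1 : ℝ) : ℂ) * R3' τ) + (fun τ => ((2 * b2 * b2 : ℝ) : ℂ) * R4 τ) +
      (fun τ => ((4 * b2 * b3 : ℝ) : ℂ) * R5 τ))) t - En S γ σ W t =
      (((2 * b1 / 3 : ℝ) : ℂ) * T3 (Gu a θ σ W) (S.f t) (S.f t) (S.f t) +
      ((2 * b2 : ℝ) : ℂ) * T3 (Gv a θ σ W) (S.f t) (S.g t) (S.g t)) -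
      (((2 * b1 * b1 : ℝ) : ℂ) * R1 t + ((2 * b1 * b2 : ℝ) : ℂ) * R2 t +
        ((2 * b2 * b1 : ℝ) : ℂ) * R3' t + ((2 * b2 * b2 : ℝ) : ℂ) * R4 t + ((4 * b2 * b3 : ℝ) : ℂ) * R5 t) := by
      simp only [Pi.sub_apply, Pi.add_apply, En2, En]; ring
    rw [e]
    refine (norm_sub_le _ _).trans ?_
    have k1 : ‖((2 * b1 / 3 : ℝ) : ℂ) * T3 (Gu a θ σ W) (S.f t) (S.f t) (S.f t)‖ ≤ |2 * b1 / 3| * (2 * C1 * (l ^ 6 * X ^ 3)) := by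
      rw [norm_mul, Complex.norm_real, Real.norm_eq_abs]; gcongr
    have k2 : ‖((2 * b2 : ℝ) : ℂ) * T3 (Gv a θ σ W) (S.f t) (S.g t) (S.g t)‖ ≤ |2 * b2| * (2 * C2 * (l ^ 6 * X ^ 3)) := by
      rw [norm_mul, Complex.norm_real, Real.norm_eq_abs]; gcongr
    have k3 := norm_add_le (((2 * b1 / 3 : ℝ) : ℂ) * T3 (Gu a θ σ W) (S.f t) (S.f t) (S.f t))
      (((2 * b2 : ℝ) : ℂ) * T3 (Gv a θ σ W) (S.f t) (S.g t) (S.g t))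
    change _ ≤ cS b1 b2 b3 * _ at zz
    have x6 : 0 ≤ l ^ 6 * X ^ 3 := by positivity
    have x9 : 0 ≤ l ^ 9 * X ^ 4 := by positivity
    refine (add_le_add (k3.trans (add_le_add k1 k2)) zz).trans ?_
    have y1 : 0 ≤ |2 * b1 / 3| * (2 * C1) := by positivity
    have y2 : 0 ≤ |2 * b2| * (2 * C2) := by positivity
    have y3 : 0 ≤ cS b1 b2 b3 * cR A E0 b1 b2 b3 := by positivity
    nlinarith [mul_nonneg y1 x9, mul_nonneg y2 x9, mul_nonneg y3 x6]
  · intro s t X h0 hf hg r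
    obtain ⟨r1, d1, z1⟩ := quart_sys S b Q1 l hl hσ bt1 (bt1_Φ θ a) s t X h0 hf hg r
    obtain ⟨r2, d2, z2⟩ := quart_sys S b Q2 l hl hσ bt2 (bt2_Φ θ a) s t X h0 hf hg r
    obtain ⟨r3, d3, z3⟩ := quart_sys S b Q3 l hl hσ bt3 (bt3_Φ θ a) s t X h0 hf hg r
    obtain ⟨r4, d4, z4⟩ := quart_sys S b Q4 l hl hσ bt4 (bt4_Φ θ a) s t X h0 hf hg r
    obtain ⟨r5, d5, z5⟩ := quart_sys S b Q5 l hl hσ bt5 (bt5_Φ θ a) s t X h0 hf hg r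
    have i1 := quart_sys_int S b Q1 bt1 (bt1_Φ θ a) t
    have i2 := quart_sys_int S b Q2 bt2 (bt2_Φ θ a) t
    have i3 := quart_sys_int S b Q3 bt3 (bt3_Φ θ a) t
    have i4 := quart_sys_int S b Q4 bt4 (bt4_Φ θ a) t
    have i5 := quart_sys_int S b Q5 bt5 (bt5_Φ θ a) t
    have dE := En2_deriv S b ha ha' hθ γ hγ s t r
    have t1 := T3_N_A (b1 := b1) (b2 := b2) (Gu a θ σ W) (S.f t) (S.f t) (S.Nf t) (fun i => S.h (bt1 i) t) (fun i => S.h (bt2 i) t)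
      rfl rfl rfl rfl (S.Nf_eq' t) i1 i2
    have t2 := T3_N_A (b1 := b1) (b2 := b2) (Gv a θ σ W) (S.g t) (S.g t) (S.Nf t) (fun i => S.h (bt3 i) t) (fun i => S.h (bt4 i) t)
      rfl rfl rfl rfl (S.Nf_eq' t) i3 i4
    have t3 : T3 (fun k x => Gv a θ σ W x k) (S.Ng t) (S.f t) (S.g t) = _ :=
      T3_N_B (b3 := b3) (fun k x => Gv a θ σ W x k) (S.Ng t) (fun i => S.h (bt5 i) t) (S.Ng_eq' t) i5
    have dd := dE.sub (((((d1.const_mul ((2 * b1 * b1 : ℝ) : ℂ)).add (d2.const_mul ((2 * b1 * b2 : ℝ) : ℂ))).add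
      (d3.const_mul ((2 * b2 * b1 : ℝ) : ℂ))).add (d4.const_mul ((2 * b2 * b2 : ℝ) : ℂ))).add (d5.const_mul ((4 * b2 * b3 : ℝ) : ℂ)))
    refine ⟨_, dd, ?_⟩
    have zz := five_norm (2 * b1 * b1) (2 * b1 * b2) (2 * b2 * b1) (2 * b2 * b2) (4 * b2 * b3) _ _ _ _ _ _ z1 z2 z3 z4 z5
    rw [t1, t2, t3]
    change _ ≤ cS b1 b2 b3 * _ at zz
    refine le_trans (le_of_eq ?_) (zz.trans ?_)
    · congr 1; push_cast; ring
    · have x6 : 0 ≤ l ^ 3 * (X ^ 4 + X ^ 5) := by positivity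
      have y1 : 0 ≤ |2 * b1 / 3| * (2 * C1) := by positivity
      have y2 : 0 ≤ |2 * b2| * (2 * C2) := by positivity
      nlinarith [mul_nonneg y1 x6, mul_nonneg y2 x6]

end HS

open MeasureTheory Set Filter
open scoped ENNReal

namespace HS

/-- scalar continuity argument along a segment -/
lemma cont_arg (Y : ℝ → ℝ) (s t B m : ℝ) (hY : ContinuousOn Y (uIcc s t)) (hm : Y s ≤ m) (hmB : m < B)
    (step : ∀ τ ∈ uIcc s t, (∀ r ∈ uIcc s τ, Y r ≤ B) → Y τ < B) : ∀ τ ∈ uIcc s t, Y τ ≤ B := by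
  have hφ : ∀ r ∈ Icc (0:ℝ) 1, s + r * (t - s) ∈ uIcc s t := by
    intro r hr
    rw [mem_uIcc]
    rcases le_total s t with h | h
    · left; constructor <;> nlinarith [hr.1, hr.2]
    · right; constructor <;> nlinarith [hr.1, hr.2]
  have hc : ContinuousOn (fun r : ℝ => Y (s + r * (t - s))) (Icc 0 1) :=
    hY.comp (by fun_prop) hφ
  have key : ∀ r ∈ Icc (0:ℝ) 1, Y (s + r * (t - s)) ≤ B := by
    by_contra hcon
    push Not at hcon
    obtain ⟨r, hr, hrB⟩ := hcon
    set K := {q ∈ Icc (0:ℝ) 1 | B ≤ Y (s + q * (t - s))} with hK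
    have hKc : IsClosed K := by
      have := hc.preimage_isClosed_of_isClosed isClosed_Icc (isClosed_Ici (a := B))
      exact this
    have hKne : K.Nonempty := ⟨r, hr, hrB.le⟩
    have hbd : BddBelow K := ⟨0, fun q hq => hq.1.1⟩
    have hin : sInf K ∈ K := hKc.csInf_mem hKne hbd
    set q := sInf K with hq
    have hlt : ∀ p ∈ Icc (0:ℝ) 1, p < q → Y (s + p * (t - s)) < B := by
      intro p hp hpq
      by_contra h
      exact absurd (csInf_le hbd (show p ∈ K from ⟨hp, not_lt.1 h⟩)) (not_le.2 hpq)
    have hqle : Y (s + q * (t - s)) ≤ B := by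
      have iv := intermediate_value_Icc hin.1.1 (hc.mono (Icc_subset_Icc_right hin.1.2))
      have : B ∈ (fun r : ℝ => Y (s + r * (t - s))) '' Icc 0 q := iv ⟨by simp; linarith, hin.2⟩
      obtain ⟨p, hp, hpe⟩ := this
      rcases lt_or_eq_of_le hp.2 with h | h
      · have := hlt p ⟨hp.1, hp.2.trans hin.1.2⟩ h
        simp only at hpe; linarith
      · rw [h] at hpe; exact hpe.le
    have := step _ (hφ q hin.1) (by
      intro x hx
      have : ∃ p ∈ Icc (0:ℝ) q, x = s + p * (t - s) := by
        have e : uIcc s (s + q * (t - s)) = (fun p => s + p * (t - s)) '' Icc 0 q := by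
          rcases eq_or_lt_of_le hin.1.1 with h | h
          · rw [← h]; simp
          · rw [← segment_eq_uIcc, segment_eq_image]
            ext z; simp only [mem_image]
            constructor
            · rintro ⟨w, hw, rfl⟩
              exact ⟨w * q, ⟨by nlinarith [hw.1], by nlinarith [hw.2]⟩, by simp [smul_eq_mul]; ring⟩
            · rintro ⟨p, hp, rfl⟩
              refine ⟨p / q, ⟨div_nonneg hp.1 h.le, (div_le_one h).2 hp.2⟩, ?_⟩
              simp only [smul_eq_mul]; field_simp; ring
        rw [e] at hx
        obtain ⟨p, hp, rfl⟩ := hx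
        exact ⟨p, hp, rfl⟩
      obtain ⟨p, hp, rfl⟩ := this
      rcases lt_or_eq_of_le hp.2 with h | h
      · exact (hlt p ⟨hp.1, hp.2.trans hin.1.2⟩ h).le
      · rw [h]; exact hqle)
    linarith [hin.2]
  intro τ hτ
  rcases eq_or_ne s t with h | h
  · subst h; simp at hτ; rw [hτ]; linarith
  · have hts : t - s ≠ 0 := sub_ne_zero.2 h.symm
    have := key ((τ - s) / (t - s)) (by
      rw [mem_uIcc] at hτ
      rcases hτ with hτ | hτ
      · have : 0 < t - s := lt_of_le_of_ne (by linarith [hτ.1, hτ.2]) hts.symm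
        exact ⟨div_nonneg (by linarith [hτ.1]) this.le, (div_le_one this).2 (by linarith [hτ.2])⟩
      · have : t - s < 0 := lt_of_le_of_ne (by linarith [hτ.1, hτ.2]) hts
        exact ⟨div_nonneg_of_nonpos (by linarith [hτ.2]) this.le, (div_le_one_of_neg this).2 (by linarith [hτ.1])⟩)
    rwa [div_mul_cancel₀ _ hts, add_sub_cancel] at this

lemma le_of_sq_le' {x y : ℝ} (hy : 0 ≤ y) (h : x ^ 2 ≤ y ^ 2) : x ≤ y := by
  nlinarith [abs_le_of_sq_le_sq h hy, le_abs_self x]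

set_option maxHeartbeats 1000000 in
/-- the bootstrap lemma -/
theorem bootstrap (A a θ b1 b2 b3 γ : ℝ) (ha : a ≠ 0) (ha' : a < 1 / 4) (hθ : 0 < θ) (hA : 1 ≤ A)
    (hγ0 : 0 < γ) (hγ : γ * b3 = -2 * b2) :
    ∃ C1 : ℝ, 1 ≤ C1 ∧ ∀ (CW σ : ℝ) (W : ℝ → ℝ) (_ : BW A CW σ W) (S : Sys a θ b1 b2 b3)
      (l : ℝ) (_ : 0 < l) (_ : l ≤ 1) (_ : σ = l ^ 4) (t1 t2 s M : ℝ) (_ : 1 ≤ M) (_ : s ∈ Icc t1 t2)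
      (_ : ∀ t ∈ Icc t1 t2, S.Reg (Icc t1 t2) t) (_ : xn σ W (S.f s) ≤ M) (_ : xn σ W (S.g s) ≤ M)
      (_ : C1 * (l ^ 3 * M ^ 2 + l ^ 3 * (t2 - t1) * M ^ 3) ≤ 1),
      ∀ t ∈ Icc t1 t2, xn σ W (S.f t) ≤ C1 * M ∧ xn σ W (S.g t) ≤ C1 * M := by
  obtain ⟨C0, hC0, H⟩ := energy3 A a θ b1 b2 b3 ha ha' hθ hA
  set D := 1 + 2 * (1 + γ) * (1 + 1 / γ) with hD
  have hg1 : 0 < 1 / γ := by positivity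
  have hD1 : 1 ≤ D := by rw [hD]; nlinarith [mul_pos (show 0 < 1 + γ by linarith) (show 0 < 1 + 1/γ by linarith)]
  have hD2 : 2 * (1 + γ) ≤ D ^ 2 := by
    have : 2 * (1 + γ) ≤ D := by rw [hD]; nlinarith
    nlinarith
  have hD3 : 2 * (1 + γ) ≤ γ * D ^ 2 := by
    have h1 : 2 * (1 + γ) ≤ γ * D := by
      have : γ * D = γ + 2 * (1 + γ) * (γ + 1) := by rw [hD]; field_simp
      nlinarith
    have : γ * D ≤ γ * D ^ 2 := by
      apply mul_le_mul_of_nonneg_left _ hγ0.le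
      nlinarith
    linarith
  refine ⟨8 * C0 * D ^ 5 + D, ?_, ?_⟩
  · have : 0 < 8 * C0 * D ^ 5 := by positivity
    linarith
  intro CW σ W b S l hl hl1 hσ t1 t2 s M hM hs reg hf hg small t ht
  obtain ⟨E, hE, hE'⟩ := H CW σ W b S γ hγ l hl hσ
  set Y : ℝ → ℝ := fun τ => xn σ W (S.f τ) ^ 2 + γ * xn σ W (S.g τ) ^ 2 with hYdef
  have hEn : ∀ τ, En S γ σ W τ = ((Y τ : ℝ) : ℂ) := by
    intro τ
    rw [En, L2f_real b _ (S.f_conj τ), L2f_real b _ (S.g_conj τ), hYdef]; push_cast; ring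
  have hYc : ContinuousOn Y (Icc t1 t2) := by
    intro τ hτ
    have d1 := L2f_deriv (θ := θ) b a S.f (S.Pf τ) (S.Nf τ) _ τ (reg τ hτ).1 (S.Pf_eq τ)
    have d2 := L2f_deriv (θ := θ) b 1 S.g (S.Pg τ) (S.Ng τ) _ τ (reg τ hτ).2 (S.Pg_eq τ)
    have d : HasDerivWithinAt (En S γ σ W) _ _ τ := d1.add (d2.const_mul (γ : ℂ))
    have c := d.continuousWithinAt
    have : Y = fun τ => Complex.re (En S γ σ W τ) := by
      funext τ; rw [hEn]; simp
    rw [this]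
    exact Complex.continuous_re.continuousAt.comp_continuousWithinAt c
  have hsub : ∀ {p q}, p ∈ Icc t1 t2 → q ∈ Icc t1 t2 → uIcc p q ⊆ Icc t1 t2 := by
    intro p q hp hq
    exact ordConnected_Icc.uIcc_subset hp hq
  set B := 2 * (1 + γ) * M ^ 2 with hB
  have hX : ∀ τ, Y τ ≤ B → xn σ W (S.f τ) ≤ D * M ∧ xn σ W (S.g τ) ≤ D * M := by
    intro τ hτ
    have n1 := xn_nonneg (σ := σ) (W := W) (S.f τ)
    have n2 := xn_nonneg (σ := σ) (W := W) (S.g τ)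
    have hτ' : xn σ W (S.f τ) ^ 2 + γ * xn σ W (S.g τ) ^ 2 ≤ 2 * (1 + γ) * M ^ 2 := hτ
    constructor
    · apply le_of_sq_le' (by positivity)
      have := mul_nonneg hγ0.le (sq_nonneg (xn σ W (S.g τ)))
      have := mul_le_mul_of_nonneg_right hD2 (sq_nonneg M)
      rw [mul_pow]; linarith
    · apply le_of_sq_le' (by positivity)
      have : γ * xn σ W (S.g τ) ^ 2 ≤ γ * (D * M) ^ 2 := by
        have := sq_nonneg (xn σ W (S.f τ))
        have := mul_le_mul_of_nonneg_right hD3 (sq_nonneg M)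
        rw [mul_pow]; linarith
      exact le_of_mul_le_mul_left this hγ0
  set X := D * M with hXd
  have hX0 : 0 ≤ X := by positivity
  have hYs : Y s ≤ (1 + γ) * M ^ 2 := by
    have n1 := xn_nonneg (σ := σ) (W := W) (S.f s)
    have n2 := xn_nonneg (σ := σ) (W := W) (S.g s)
    have q1 : xn σ W (S.f s) ^ 2 ≤ M ^ 2 := by gcongr
    have q2 : γ * xn σ W (S.g s) ^ 2 ≤ γ * M ^ 2 := by gcongr
    simp only [hYdef]; linarith
  have hM2 : 0 < (1 + γ) * M ^ 2 := by positivity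
  set T := t2 - t1 with hT
  have hT0 : 0 ≤ T := by rw [hT]; linarith [hs.1, hs.2]
  have hsB : Y s ≤ B := by rw [hB]; linarith
  -- smallness
  have hsmall : 2 * (C0 * (l ^ 6 * X ^ 3 + l ^ 9 * X ^ 4)) + C0 * (l ^ 3 * (X ^ 4 + X ^ 5)) * T < (1 + γ) * M ^ 2 := by
    have l6 : l ^ 6 ≤ l ^ 3 := pow_le_pow_of_le_one hl.le hl1 (by norm_num)
    have l9 : l ^ 9 ≤ l ^ 3 := pow_le_pow_of_le_one hl.le hl1 (by norm_num)
    have x3 : X ^ 3 ≤ D ^ 5 * M ^ 4 := by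
      rw [hXd, mul_pow]
      exact mul_le_mul (pow_le_pow_right₀ hD1 (by norm_num)) (pow_le_pow_right₀ hM (by norm_num)) (by positivity) (by positivity)
    have x4 : X ^ 4 ≤ D ^ 5 * M ^ 4 := by
      rw [hXd, mul_pow]
      exact mul_le_mul (pow_le_pow_right₀ hD1 (by norm_num)) le_rfl (by positivity) (by positivity)
    have x4' : X ^ 4 ≤ D ^ 5 * M ^ 5 := by
      rw [hXd, mul_pow]
      exact mul_le_mul (pow_le_pow_right₀ hD1 (by norm_num)) (pow_le_pow_right₀ hM (by norm_num)) (by positivity) (by positivity)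
    have x5 : X ^ 5 = D ^ 5 * M ^ 5 := by rw [hXd, mul_pow]
    have e1 : l ^ 6 * X ^ 3 ≤ l ^ 3 * (D ^ 5 * M ^ 4) := by gcongr
    have e2 : l ^ 9 * X ^ 4 ≤ l ^ 3 * (D ^ 5 * M ^ 4) := by gcongr
    have e3 : l ^ 3 * (X ^ 4 + X ^ 5) ≤ l ^ 3 * (2 * (D ^ 5 * M ^ 5)) := by
      rw [x5]; gcongr; linarith
    calc 2 * (C0 * (l ^ 6 * X ^ 3 + l ^ 9 * X ^ 4)) + C0 * (l ^ 3 * (X ^ 4 + X ^ 5)) * T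
        ≤ 2 * (C0 * (l ^ 3 * (D ^ 5 * M ^ 4) + l ^ 3 * (D ^ 5 * M ^ 4))) + C0 * (l ^ 3 * (2 * (D ^ 5 * M ^ 5))) * T := by gcongr
      _ ≤ (8 * C0 * D ^ 5) * (l ^ 3 * M ^ 2 + l ^ 3 * T * M ^ 3) * M ^ 2 := by
          have : 0 ≤ C0 * D ^ 5 * (l ^ 3 * M ^ 4) := by positivity
          have : 0 ≤ C0 * D ^ 5 * (l ^ 3 * T * M ^ 5) := by positivity
          nlinarith
      _ ≤ (8 * C0 * D ^ 5 + D) * (l ^ 3 * M ^ 2 + l ^ 3 * T * M ^ 3) * M ^ 2 := by gcongr; linarith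
      _ ≤ 1 * M ^ 2 := by gcongr
      _ < (1 + γ) * M ^ 2 := by
          have : 0 < γ * M ^ 2 := by positivity
          linarith
  have main := cont_arg Y s t B ((1 + γ) * M ^ 2) (hYc.mono (hsub hs ht)) hYs (by rw [hB]; linarith) (by
    intro τ hτ hr
    have hτI := hsub hs ht hτ
    have dd : ∀ r ∈ uIcc s τ, ∃ E', HasDerivWithinAt E E' (uIcc s τ) r ∧ ‖E'‖ ≤ C0 * (l ^ 3 * (X ^ 4 + X ^ 5)) := by
      intro r hrr
      obtain ⟨E', h1, h2⟩ := hE' (Icc t1 t2) r X hX0 (hX r (hr r hrr)).1 (hX r (hr r hrr)).2 (reg r (hsub hs hτI hrr))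
      exact ⟨E', h1.mono (hsub hs hτI), h2⟩
    choose! F hF1 hF2 using dd
    have mv := (convex_uIcc s τ).norm_image_sub_le_of_norm_hasDerivWithin_le hF1 hF2 left_mem_uIcc right_mem_uIcc
    have k1 := hE τ X hX0 (hX τ (hr τ right_mem_uIcc)).1 (hX τ (hr τ right_mem_uIcc)).2
    have k2 := hE s X hX0 (hX s hsB).1 (hX s hsB).2
    rw [hEn] at k1 k2
    have k3 : ‖((Y τ : ℝ) : ℂ) - ((Y s : ℝ) : ℂ)‖ ≤ 2 * (C0 * (l ^ 6 * X ^ 3 + l ^ 9 * X ^ 4)) + C0 * (l ^ 3 * (X ^ 4 + X ^ 5)) * T := by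
      have e : ((Y τ : ℝ) : ℂ) - ((Y s : ℝ) : ℂ) = -(E τ - Y τ) + (E s - Y s) + (E τ - E s) := by ring
      rw [e]
      have t1' : ‖τ - s‖ ≤ T := by
        rw [Real.norm_eq_abs, abs_le, hT]; constructor <;> linarith [hs.1, hs.2, hτI.1, hτI.2]
      have t2' : C0 * (l ^ 3 * (X ^ 4 + X ^ 5)) * ‖τ - s‖ ≤ C0 * (l ^ 3 * (X ^ 4 + X ^ 5)) * T := by gcongr
      have := norm_add₃_le (a := -(E τ - Y τ)) (b := (E s - Y s)) (c := (E τ - E s))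
      rw [norm_neg] at this
      linarith
    rw [← Complex.ofReal_sub, Complex.norm_real, Real.norm_eq_abs] at k3
    have := (abs_le.1 k3).2
    rw [hB]; linarith)
  have := hX t (main t right_mem_uIcc)
  have hle : X ≤ (8 * C0 * D ^ 5 + D) * M := by
    have : 0 ≤ 8 * C0 * D ^ 5 * M := by positivity
    rw [hXd]; linarith
  exact ⟨this.1.trans hle, this.2.trans hle⟩

end HS

open MeasureTheory Set Filter
open scoped ENNReal

namespace HS

open scoped FourierTransform in
/-- the Fourier transform, valued in `S2` -/
noncomputable def ft (U : SchwartzMap ℝ ℂ) : S2 := (𝓕 U : SchwartzMap ℝ ℂ)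

/-- the weighted norms -/
noncomputable def nw (j : ℕ) (h : S2) : ℝ := (wn (fun ξ => w1 ξ ^ j) h).toReal

lemma nw_nonneg (j : ℕ) (h : S2) : 0 ≤ nw j h := ENNReal.toReal_nonneg

lemma ofReal_nw (j : ℕ) (h : S2) : ENNReal.ofReal (nw j h) = wn (fun ξ => w1 ξ ^ j) h :=
  ENNReal.ofReal_toReal (S2.wn_lt j h).ne

lemma nw_one (h : S2) : nw 1 h = ‖h‖ := by
  unfold nw
  have := S2.norm_eq h
  simp only [pow_one]
  change (wn w1 h).toReal = _
  rw [← this, ENNReal.toReal_ofReal (norm_nonneg _)]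

lemma nw_mono {i j : ℕ} (hij : i ≤ j) (h : S2) : nw i h ≤ nw j h := by
  unfold nw
  apply ENNReal.toReal_mono (S2.wn_lt j h).ne
  exact wn_mono (fun ξ => pow_le_pow_right₀ (one_le_w1 ξ) hij) _

/-- the test function `w1^{2j} conj h` -/
noncomputable def tst (j : ℕ) (h : S2) : SchwartzMap ℝ ℂ :=
  smS (fun ξ => w1 ξ ^ (2 * j)) (SchwartzMap.postcompCLM (𝕜 := ℝ) (Complex.conjCLE : ℂ →L[ℝ] ℂ) (h : SchwartzMap ℝ ℂ))

lemma tst_apply (j : ℕ) (h : S2) (ξ : ℝ) : tst j h ξ = ((w1 ξ ^ (2 * j) : ℝ) : ℂ) * starRingEnd ℂ (h ξ) := by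
  unfold tst
  rw [smS_apply (w1_pow_temp _)]
  rfl

lemma w1_meas : Measurable w1 := by unfold w1; fun_prop

lemma tst_self (j : ℕ) (h : S2) : ∫ ξ, h ξ * tst j h ξ = ((nw j h ^ 2 : ℝ) : ℂ) := by
  have e : ∀ ξ, h ξ * tst j h ξ = ((w1 ξ ^ (2 * j) * ‖h ξ‖ ^ 2 : ℝ) : ℂ) := by
    intro ξ
    rw [tst_apply, mul_left_comm, Complex.mul_conj, Complex.normSq_eq_norm_sq]; push_cast; ring
  simp only [e]
  rw [integral_complex_ofReal]
  congr 1
  have m1 := h.measurable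
  have m2 := w1_meas
  rw [integral_eq_lintegral_of_nonneg_ae (Eventually.of_forall fun ξ => by
    have := w1_pos ξ
    dsimp; positivity) (by fun_prop)]
  unfold nw
  rw [← ENNReal.toReal_pow]
  congr 1
  have := L2n_sq volume (fun ξ => ENNReal.ofReal (w1 ξ ^ j) * ‖h ξ‖ₑ)
  rw [← ENNReal.rpow_natCast]
  refine Eq.trans ?_ this.symm
  congr 1; ext ξ
  have p := w1_pos ξ
  rw [rpow_two_mul, ENNReal.ofReal_mul (by positivity), mul_comm 2 j, pow_mul, ENNReal.ofReal_pow (by positivity),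
    ENNReal.ofReal_pow (norm_nonneg _), ofReal_norm]
  norm_cast

lemma tst_le (j : ℕ) (k h : S2) : ‖∫ ξ, k ξ * tst j h ξ‖ ≤ nw j k * nw j h := by
  have m1 := h.measurable
  have m3 := k.measurable
  have m2 := w1_meas
  have : ‖∫ ξ, k ξ * tst j h ξ‖ₑ ≤ ENNReal.ofReal (nw j k * nw j h) := by
    rw [ENNReal.ofReal_mul (nw_nonneg _ _), ofReal_nw, ofReal_nw]
    refine (enorm_integral_le_lintegral_enorm _).trans ?_
    refine le_trans (le_of_eq ?_) (L2n_CS volume _ _ (by fun_prop) (by fun_prop))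
    congr 1; ext ξ
    rw [tst_apply, enorm_mul, enorm_mul, enorm_real, RCLike.enorm_conj, abs_of_nonneg (w1_pow_nonneg _ _),
      mul_comm 2 j, pow_mul, ENNReal.ofReal_pow (w1_pow_nonneg _ _)]
    ring
  rw [← ofReal_norm] at this
  exact (ENNReal.ofReal_le_ofReal_iff (mul_nonneg (nw_nonneg _ _) (nw_nonneg _ _))).1 this

lemma pair_int (h : S2) (φ : SchwartzMap ℝ ℂ) : Integrable (fun ξ => h ξ * φ ξ) := by
  have := (SchwartzMap.pairing (𝕜 := ℂ) (ContinuousLinearMap.mul ℂ ℂ) (h : SchwartzMap ℝ ℂ) φ).integrable (μ := (volume : Measure ℝ))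
  exact this

open scoped FourierTransform in
lemma pair_ft (U φ : SchwartzMap ℝ ℂ) : ∫ ξ, ft U ξ * φ ξ = ∫ x, U x * (𝓕 φ : SchwartzMap ℝ ℂ) x :=
  SchwartzMap.integral_fourier_mul_eq U φ

/-- sup norm bound -/
lemma sup_le : ∃ C : ℝ, 0 < C ∧ ∀ (U : SchwartzMap ℝ ℂ) (x : ℝ), ‖U x‖ ≤ C * ‖ft U‖ := by
  have m2 := w1_meas
  have hfin : L2n volume (fun ξ => ENNReal.ofReal (w1 ξ)⁻¹) < ⊤ := by
    unfold L2n
    apply ENNReal.rpow_lt_top_of_nonneg (by norm_num)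
    apply ne_of_lt
    refine lt_of_le_of_lt (lintegral_mono (g := fun ξ => ENNReal.ofReal (w1 ξ)⁻¹) fun ξ => ?_) ?_
    · have h1 : ENNReal.ofReal (w1 ξ)⁻¹ ≤ 1 := by
        rw [ENNReal.ofReal_le_one]; exact inv_le_one_of_one_le₀ (one_le_w1 ξ)
      calc ENNReal.ofReal (w1 ξ)⁻¹ ^ (2:ℝ) = ENNReal.ofReal (w1 ξ)⁻¹ * ENNReal.ofReal (w1 ξ)⁻¹ := by
            rw [ENNReal.rpow_two, sq]
        _ ≤ ENNReal.ofReal (w1 ξ)⁻¹ * 1 := by gcongr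
        _ = _ := mul_one _
    · exact (integrable_inv_one_add_sq).lintegral_lt_top
  refine ⟨(L2n volume (fun ξ => ENNReal.ofReal (w1 ξ)⁻¹)).toReal + 1, by positivity, fun U x => ?_⟩
  have e : U x = ∫ ξ, Real.fourierChar (ξ * x) • ft U ξ := by
    have h1 : (FourierTransformInv.fourierInv (FourierTransform.fourier U : SchwartzMap ℝ ℂ) : SchwartzMap ℝ ℂ) = U := by
      simp
    conv_lhs => rw [← h1]
    change _ = ∫ ξ, Real.fourierChar (ξ * x) • (FourierTransform.fourier U : SchwartzMap ℝ ℂ) ξ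
    rw [SchwartzMap.fourierInv_coe, Real.fourierInv_eq']
    congr 1; ext ξ
    rw [Circle.smul_def, Real.fourierChar_apply]
    congr 2
    simp; ring
  have key : ‖U x‖ₑ ≤ L2n volume (fun ξ => ENNReal.ofReal (w1 ξ)⁻¹) * ENNReal.ofReal ‖ft U‖ := by
    rw [S2.norm_eq, e]
    have m1 := (ft U).measurable
    refine (enorm_integral_le_lintegral_enorm _).trans ?_
    refine le_trans (le_of_eq ?_) (L2n_CS volume _ _ (by fun_prop) (by fun_prop))
    congr 1; ext ξ
    rw [← mul_assoc, ← ENNReal.ofReal_mul (by have := w1_pos ξ; positivity), inv_mul_cancel₀ (w1_pos ξ).ne']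
    rw [← ofReal_norm, ← ofReal_norm, Circle.norm_smul]; simp
  rw [← ENNReal.ofReal_toReal hfin.ne, ← ENNReal.ofReal_mul ENNReal.toReal_nonneg, ← ofReal_norm,
    ENNReal.ofReal_le_ofReal_iff (by positivity)] at key
  nlinarith [norm_nonneg (ft U)]

end HS

open MeasureTheory Set Filter
open scoped ENNReal

namespace HS

lemma nw_zero (j : ℕ) : nw j 0 = 0 := by
  unfold nw wn L2n
  have : ∀ ξ, (0 : S2) ξ = 0 := fun ξ => rfl
  simp [this]

lemma nw_neg (j : ℕ) (h : S2) : nw j (-h) = nw j h := by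
  unfold nw wn L2n
  have : ∀ ξ, (-h : S2) ξ = -(h ξ) := fun ξ => rfl
  simp [this]

lemma pair_cont {T : Type*} {F : Filter T} [F.IsCountablyGenerated] (U : T → SchwartzMap ℝ ℂ) (U0 φ : SchwartzMap ℝ ℂ) (B : ℝ)
    (hB : ∀ᶠ τ in F, ‖ft (U τ)‖ ≤ B) (hU : ∀ x, Tendsto (fun τ => U τ x) F (nhds (U0 x))) :
    Tendsto (fun τ => ∫ ξ, ft (U τ) ξ * φ ξ) F (nhds (∫ ξ, ft U0 ξ * φ ξ)) := by
  obtain ⟨C, hC, H⟩ := sup_le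
  simp only [pair_ft]
  set ψ : SchwartzMap ℝ ℂ := FourierTransform.fourier φ
  refine tendsto_integral_filter_of_dominated_convergence (fun x => C * B * ‖ψ x‖) ?_ ?_ ?_ ?_
  · filter_upwards with τ
    exact (((U τ).continuous).mul ψ.continuous).aestronglyMeasurable
  · filter_upwards [hB] with τ hτ
    filter_upwards with x
    rw [norm_mul]
    gcongr
    exact (H _ _).trans (by gcongr)
  · exact (ψ.integrable (μ := volume)).norm.const_mul _
  · filter_upwards with x
    exact (hU x).mul_const _

lemma pair_deriv (U Q : ℝ → SchwartzMap ℝ ℂ) (hd : ∀ t x, HasDerivAt (fun τ => U τ x) (Q t x) t) (t1 t2 B : ℝ)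
    (hQ : ∀ τ ∈ Icc t1 t2, ‖ft (Q τ)‖ ≤ B) (φ : SchwartzMap ℝ ℂ) (t : ℝ) (ht : t ∈ Ioo t1 t2) :
    HasDerivAt (fun τ => ∫ ξ, ft (U τ) ξ * φ ξ) (∫ ξ, ft (Q t) ξ * φ ξ) t := by
  obtain ⟨C, hC, H⟩ := sup_le
  simp only [pair_ft]
  set ψ : SchwartzMap ℝ ℂ := FourierTransform.fourier φ
  refine (hasDerivAt_integral_of_dominated_loc_of_deriv_le (F := fun τ x => U τ x * ψ x) (F' := fun τ x => Q τ x * ψ x)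
    (bound := fun x => C * B * ‖ψ x‖) (s := Ioo t1 t2) (Ioo_mem_nhds ht.1 ht.2) ?_ ?_ ?_ ?_ ?_ ?_).2
  · filter_upwards with τ
    exact (((U τ).continuous).mul ψ.continuous).aestronglyMeasurable
  · exact pair_int (U t : S2) ψ
  · exact (((Q t).continuous).mul ψ.continuous).aestronglyMeasurable
  · filter_upwards with x τ hτ
    rw [norm_mul]
    have := hQ τ (Ioo_subset_Icc_self hτ)
    gcongr
    exact (H _ _).trans (by gcongr)
  · exact (ψ.integrable (μ := volume)).norm.const_mul _
  · filter_upwards with x τ hτ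
    exact (hd τ x).mul_const _

theorem nw_mvt (U Q : ℝ → SchwartzMap ℝ ℂ) (hd : ∀ t x, HasDerivAt (fun τ => U τ x) (Q t x) t) (t1 t2 B : ℝ) (h12 : t1 ≤ t2)
    (hU : ∀ τ ∈ Icc t1 t2, ‖ft (U τ)‖ ≤ B) (hQ : ∀ τ ∈ Icc t1 t2, ‖ft (Q τ)‖ ≤ B) (P : S2) (j : ℕ) (K : ℝ)
    (hK : ∀ c ∈ Icc t1 t2, nw j (ft (Q c) - P) ≤ K) :
    nw j (ft (U t2) - ft (U t1) - (t2 - t1) • P) ≤ (t2 - t1) * K := by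
  rcases eq_or_lt_of_le h12 with h | h
  · subst h; simp [nw_zero]
  set ρ := ft (U t2) - ft (U t1) - (t2 - t1) • P with hρ
  set φ := tst j ρ with hφ
  set Ψ : ℝ → ℂ := fun τ => ∫ ξ, ft (U τ) ξ * φ ξ with hΨ
  set p : ℂ := ∫ ξ, P ξ * φ ξ with hp
  have hlin : ∀ τ, ∫ ξ, (ft (Q τ) - P) ξ * φ ξ = (∫ ξ, ft (Q τ) ξ * φ ξ) - p := by
    intro τ
    rw [hp, ← integral_sub (pair_int _ _) (pair_int _ _)]
    congr 1; ext ξ; rw [S2.sub_apply]; ring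
  have hlin2 : ∫ ξ, ρ ξ * φ ξ = Ψ t2 - Ψ t1 - (t2 - t1) * p := by
    rw [hp, hΨ]
    simp only
    rw [← integral_const_mul, ← integral_sub (pair_int _ _) (pair_int _ _)]
    have i1 : Integrable (fun ξ => ft (U t2) ξ * φ ξ - ft (U t1) ξ * φ ξ) := (pair_int _ _).sub (pair_int _ _)
    rw [← integral_sub i1 ((pair_int _ _).const_mul _)]
    congr 1; ext ξ; rw [hρ, S2.sub_apply, S2.sub_apply, S2.smul_apply]; push_cast; ring
  set ψ : ℝ → ℝ := fun τ => (Ψ τ - τ * p).re with hψ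
  have hc : ContinuousOn ψ (Icc t1 t2) := by
    intro τ hτ
    have c1 : ContinuousWithinAt Ψ (Icc t1 t2) τ :=
      pair_cont U (U τ) φ B (by filter_upwards [self_mem_nhdsWithin] with r hr using hU r hr)
        (fun x => ((hd τ x).continuousAt.mono_left nhdsWithin_le_nhds))
    have c2 : ContinuousWithinAt (fun τ : ℝ => (τ : ℂ) * p) (Icc t1 t2) τ := by fun_prop
    exact Complex.continuous_re.continuousAt.comp_continuousWithinAt (c1.sub c2)
  have hder : ∀ τ ∈ Ioo t1 t2, HasDerivAt ψ ((∫ ξ, (ft (Q τ) - P) ξ * φ ξ).re) τ := by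
    intro τ hτ
    rw [hlin]
    have d1 := pair_deriv U Q hd t1 t2 B hQ φ τ hτ
    have d2 : HasDerivAt (fun τ : ℝ => (τ : ℂ) * p) (1 * p) τ := (Complex.ofRealCLM.hasDerivAt (x := τ)).mul_const p
    have d3 := d1.sub d2
    rw [one_mul] at d3
    exact (Complex.reCLM.hasFDerivAt.comp_hasDerivAt τ d3)
  obtain ⟨c, hc1, hc2⟩ := exists_hasDerivAt_eq_slope ψ _ h hc hder
  have e1 : ψ t2 - ψ t1 = nw j ρ ^ 2 := by
    have : ((nw j ρ ^ 2 : ℝ) : ℂ) = Ψ t2 - Ψ t1 - (t2 - t1) * p := by rw [← hlin2, hφ, tst_self]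
    have := congrArg Complex.re this
    rw [Complex.ofReal_re] at this
    rw [this, hψ]
    simp only [← Complex.sub_re]
    congr 1; ring
  have hpos : 0 < t2 - t1 := by linarith
  rw [e1, eq_div_iff hpos.ne'] at hc2
  have e2 : (∫ ξ, (ft (Q c) - P) ξ * φ ξ).re ≤ K * nw j ρ :=
    (Complex.re_le_norm _).trans ((tst_le j _ ρ).trans (by
      have := nw_nonneg j ρ
      have := hK c (Ioo_subset_Icc_self hc1)
      gcongr))
  rcases eq_or_lt_of_le (nw_nonneg j ρ) with h0 | h0
  · rw [← h0]
    exact mul_nonneg hpos.le ((nw_nonneg _ _).trans (hK t1 ⟨le_rfl, h12⟩))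
  · have : nw j ρ * nw j ρ ≤ ((t2 - t1) * K) * nw j ρ := by nlinarith
    exact le_of_mul_le_mul_right this h0

/-- weak lower semicontinuity -/
lemma nw_lsc (U : ℝ → SchwartzMap ℝ ℂ) (hc : ∀ x, Continuous (fun τ => U τ x)) (j : ℕ) (hj : 1 ≤ j) (B : ℝ) :
    IsClosed {t | nw j (ft (U t)) ≤ B} := by
  rw [← isSeqClosed_iff_isClosed]
  intro τ t hτ hlim
  simp only [mem_ofPred_eq] at hτ ⊢
  have H := pair_cont (F := atTop) (fun n => U (τ n)) (U t) (tst j (ft (U t))) B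
    (Eventually.of_forall fun n => by
      rw [← nw_one]; exact (nw_mono hj _).trans (hτ n))
    (fun x => ((hc x).tendsto t).comp hlim)
  rw [tst_self] at H
  have H2 := H.norm
  have := le_of_tendsto H2 (Eventually.of_forall fun n => (tst_le j _ _).trans
    (mul_le_mul_of_nonneg_right (hτ n) (nw_nonneg j _)))
  rw [Complex.norm_real, Real.norm_eq_abs, abs_of_nonneg (sq_nonneg _)] at this
  rcases eq_or_lt_of_le (nw_nonneg j (ft (U t))) with h0 | h0
  · rw [← h0]; exact (nw_nonneg _ _).trans (hτ 0)
  · rw [sq] at this; exact le_of_mul_le_mul_right this h0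

end HS

open MeasureTheory Set Filter
open scoped ENNReal

namespace HS

lemma jb_one_sq (ξ : ℝ) : jb 1 ξ ^ 2 = w1 ξ := by rw [jb_sq]; unfold w1; ring

lemma mmj_one (j : ℕ) (ξ : ℝ) : mm 1 (fun s => s ^ (2 * j + 1)) ξ / jb 1 ξ = w1 ξ ^ (j + 1) := by
  have := jb_pos 1 ξ
  unfold mm
  rw [← jb_one_sq, ← pow_mul]
  field_simp
  ring

lemma mm_one_le (j : ℕ) (ξ : ℝ) : mm 1 (fun s => s ^ (2 * j + 1)) ξ ≤ w1 ξ ^ (j + 2) := by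
  have := one_le_jb 1 ξ
  unfold mm
  rw [← jb_one_sq, ← pow_mul, ← pow_add]
  exact pow_le_pow_right₀ this (by omega)

lemma bil_nw (j : ℕ) : ∃ C : ℝ, 0 ≤ C ∧ ∀ h1 h2 : S2,
    wn (fun ξ => w1 ξ ^ (j + 1)) (bilF h1 h2) ≤ ENNReal.ofReal (C * (nw (j + 2) h1 * nw (j + 2) h2)) ∧
    wn (fun ξ => w1 ξ ^ (j + 1)) (bilG h1 h2) ≤ ENNReal.ofReal (C * (nw (j + 2) h1 * nw (j + 2) h2)) := by
  have ok := WOK_pow (2 * j + 1)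
  have hA := ok.one_le_A
  set A : ℝ := _
  refine ⟨16 * A * Real.sqrt Real.pi / (1 * Real.sqrt 1), by positivity, fun h1 h2 => ?_⟩
  have e1 := bilF_est ok one_pos h1 h2
  have e2 := bilG_est ok one_pos h1 h2
  simp only [mmj_one] at e1 e2
  have hp : ENNReal.ofReal (16 * A * Real.sqrt Real.pi / (1 * Real.sqrt 1)) *
      (wn (mm 1 fun s => s ^ (2 * j + 1)) h1 * wn (mm 1 fun s => s ^ (2 * j + 1)) h2) ≤
      ENNReal.ofReal (16 * A * Real.sqrt Real.pi / (1 * Real.sqrt 1) * (nw (j + 2) h1 * nw (j + 2) h2)) := by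
    rw [ENNReal.ofReal_mul (by positivity), ENNReal.ofReal_mul (nw_nonneg _ _), ofReal_nw, ofReal_nw]
    gcongr
    · exact wn_mono (mm_one_le j) _
    · exact wn_mono (mm_one_le j) _
  exact ⟨e1.trans hp, e2.trans hp⟩

lemma conv_int (h1 h2 : S2) (ξ : ℝ) : Integrable (fun y => h1 y * h2 (ξ - y)) := by
  have i1 : Integrable (fun y => h1 y) := SchwartzMap.integrable (h1 : SchwartzMap ℝ ℂ)
  obtain ⟨C, hC⟩ := (SchwartzMap.decay (h2 : SchwartzMap ℝ ℂ) 0 0)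
  refine i1.mul_bdd (c := C) ?_ ?_
  · exact (h2.continuous.comp (by fun_prop : Continuous fun y : ℝ => ξ - y)).aestronglyMeasurable
  · filter_upwards with y
    have := hC.2 (ξ - y)
    simp only [pow_zero, one_mul, norm_iteratedFDeriv_zero] at this
    exact this

lemma mulId (h : S2) : ∃ k : S2, ∀ y : ℝ, k y = (y : ℂ) * h y :=
  ⟨smS (fun y => y) (h : SchwartzMap ℝ ℂ), fun y => smS_apply (by fun_prop) _ _⟩

lemma bilF_diff (k k' f f' : S2) (ξ : ℝ) :
    bilF k f ξ - bilF k' f' ξ = bilF (k - k') f ξ + bilF k' (f - f') ξ := by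
  unfold bilF
  have e1 : ∫ y, (k - k') y * f (ξ - y) = (∫ y, k y * f (ξ - y)) - ∫ y, k' y * f (ξ - y) := by
    rw [← integral_sub (conv_int _ _ _) (conv_int _ _ _)]
    congr 1; ext y; rw [S2.sub_apply]; ring
  have e2 : ∫ y, k' y * (f - f') (ξ - y) = (∫ y, k' y * f (ξ - y)) - ∫ y, k' y * f' (ξ - y) := by
    rw [← integral_sub (conv_int _ _ _) (conv_int _ _ _)]
    congr 1; ext y; rw [S2.sub_apply]; ring
  rw [e1, e2]; ring

lemma bilG_diff (k k' f f' : S2) (ξ : ℝ) :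
    bilG k f ξ - bilG k' f' ξ = bilG (k - k') f ξ + bilG k' (f - f') ξ := by
  unfold bilG
  obtain ⟨m, hm⟩ := mulId k
  obtain ⟨m', hm'⟩ := mulId k'
  simp only [S2.sub_apply, mul_sub, ← hm, ← hm']
  have e1 : ∫ y, (m y - m' y) * f (ξ - y) = (∫ y, m y * f (ξ - y)) - ∫ y, m' y * f (ξ - y) := by
    rw [← integral_sub (conv_int _ _ _) (conv_int _ _ _)]
    congr 1; ext y; ring
  have e2 : ∫ y, (m' y * f (ξ - y) - m' y * f' (ξ - y)) = (∫ y, m' y * f (ξ - y)) - ∫ y, m' y * f' (ξ - y) := by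
    rw [← integral_sub (conv_int _ _ _) (conv_int _ _ _)]
  rw [e1, e2]; ring

lemma nw_le_of (j : ℕ) (h : S2) (C : ℝ) (hC : 0 ≤ C) (H : wn (fun ξ => w1 ξ ^ j) h ≤ ENNReal.ofReal C) : nw j h ≤ C := by
  rw [← ofReal_nw] at H
  exact (ENNReal.ofReal_le_ofReal_iff hC).1 H

lemma w1j_meas (j : ℕ) : Measurable (fun ξ => w1 ξ ^ j) := w1_meas.pow_const j

lemma nw_add (j : ℕ) (h k : S2) : nw j (h + k) ≤ nw j h + nw j k := by
  apply nw_le_of _ _ _ (add_nonneg (nw_nonneg _ _) (nw_nonneg _ _))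
  refine (wn_lin (w1j_meas j) 1 1 h.measurable k.measurable _ (fun ξ => by simp [S2.add_apply])).trans ?_
  rw [ENNReal.ofReal_add (nw_nonneg _ _) (nw_nonneg _ _), ofReal_nw, ofReal_nw]
  simp

/-- linear combination of two functions with given bounds -/
lemma wn_lin' (j : ℕ) (c1 c2 : ℝ) {n1 n2 : ℝ → ℂ} (m1 : Measurable n1) (m2 : Measurable n2)
    (n : ℝ → ℂ) (hn : ∀ ξ, n ξ = (c1 : ℂ) * n1 ξ + (c2 : ℂ) * n2 ξ) (B1 B2 : ℝ) (h1 : 0 ≤ B1) (h2 : 0 ≤ B2)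
    (H1 : wn (fun ξ => w1 ξ ^ j) n1 ≤ ENNReal.ofReal B1) (H2 : wn (fun ξ => w1 ξ ^ j) n2 ≤ ENNReal.ofReal B2) :
    wn (fun ξ => w1 ξ ^ j) n ≤ ENNReal.ofReal (|c1| * B1 + |c2| * B2) := by
  refine (wn_lin (w1j_meas j) c1 c2 m1 m2 n hn).trans ?_
  rw [ENNReal.ofReal_add (by positivity) (by positivity), ENNReal.ofReal_mul (abs_nonneg _), ENNReal.ofReal_mul (abs_nonneg _)]
  gcongr

lemma nw_P (j : ℕ) (c : ℝ) (h k : S2) (H : ∀ ξ, h ξ = Complex.I * ((c * ξ ^ 3 : ℝ) : ℂ) * k ξ) :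
    nw j h ≤ |c| * nw (j + 2) k := by
  apply nw_le_of _ _ _ (mul_nonneg (abs_nonneg _) (nw_nonneg _ _))
  rw [ENNReal.ofReal_mul (abs_nonneg _), ofReal_nw, ← wn_const_mul _ (abs_nonneg _)]
  apply L2n_mono
  intro ξ
  rw [H, enorm_mul, enorm_mul, enorm_real, enorm_I, one_mul, ← mul_assoc, ← ENNReal.ofReal_mul (w1_pow_nonneg _ _)]
  gcongr
  change _ ≤ |c| * w1 ξ ^ (j + 2)
  rw [abs_mul, pow_add]
  have : |ξ ^ 3| ≤ w1 ξ ^ 2 := by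
    rw [abs_pow]
    unfold w1
    have h0 := abs_nonneg ξ
    have h1 := sq_abs ξ
    rw [← h1]
    nlinarith [sq_nonneg (|ξ| - 1), sq_nonneg (|ξ|^2), mul_nonneg h0 h0, sq_nonneg (|ξ|^2 - |ξ|)]
  have p := w1_pow_nonneg j ξ
  have := mul_le_mul_of_nonneg_left this (mul_nonneg p (abs_nonneg c))
  nlinarith

/-- A solution seen from both sides. -/
structure Sol (a θ b1 b2 b3 : ℝ) extends Sys a θ b1 b2 b3 where
  U : ℝ → SchwartzMap ℝ ℂ
  V : ℝ → SchwartzMap ℝ ℂ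
  QU : ℝ → SchwartzMap ℝ ℂ
  QV : ℝ → SchwartzMap ℝ ℂ
  f_ft : ∀ t, f t = ft (U t)
  g_ft : ∀ t, g t = ft (V t)
  QU_ft : ∀ t, Pf t + Nf t = ft (QU t)
  QV_ft : ∀ t, Pg t + Ng t = ft (QV t)
  dU : ∀ t x, HasDerivAt (fun τ => U τ x) (QU t x) t
  dV : ∀ t x, HasDerivAt (fun τ => V τ x) (QV t x) t

variable {a θ b1 b2 b3 : ℝ}

lemma Sol.F_bd (S : Sol a θ b1 b2 b3) (n : ℝ) (hn : 0 ≤ n) : ∃ K : ℝ, 0 ≤ K ∧ ∀ t, nw 5 (S.f t) ≤ n → nw 5 (S.g t) ≤ n →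
    nw 3 (S.Pf t + S.Nf t) ≤ K ∧ nw 3 (S.Pg t + S.Ng t) ≤ K := by
  obtain ⟨C, hC, H⟩ := bil_nw 2
  refine ⟨(|θ * a| + |θ * 1|) * n + (|b1| + |b2| + |b3|) * (C * (n * n)), by positivity, fun t hf hg => ?_⟩
  have f4 := (nw_mono (show 2 + 2 ≤ 5 by norm_num) (S.f t)).trans hf
  have g4 := (nw_mono (show 2 + 2 ≤ 5 by norm_num) (S.g t)).trans hg
  have bd : ∀ x y : S2, nw (2 + 2) x ≤ n → nw (2 + 2) y ≤ n →
      ENNReal.ofReal (C * (nw (2 + 2) x * nw (2 + 2) y)) ≤ ENNReal.ofReal (C * (n * n)) := by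
    intro x y hx hy
    have := nw_nonneg (2 + 2) x
    have := nw_nonneg (2 + 2) y
    gcongr
  have z : 0 ≤ C * (n * n) := by positivity
  have a1 := nw_P 3 (θ * a) _ _ (S.Pf_eq t)
  have a2 := nw_P 3 (θ * 1) _ _ (S.Pg_eq t)
  have c1 : nw 3 (S.Nf t) ≤ |b1| * (C * (n * n)) + |b2| * (C * (n * n)) :=
    nw_le_of _ _ _ (by positivity) (wn_lin' 3 b1 b2 (bilF_meas _ _) (bilF_meas _ _) _ (S.Nf_eq' t) _ _ z z
      ((H _ _).1.trans (bd _ _ f4 f4)) ((H _ _).1.trans (bd _ _ g4 g4)))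
  have c2 : nw 3 (S.Ng t) ≤ |b3| * (C * (n * n)) + |0| * (C * (n * n)) :=
    nw_le_of _ _ _ (by positivity) (wn_lin' 3 b3 0 (bilG_meas _ _) (bilG_meas _ _) _
      (fun ξ => by rw [S.Ng_eq' t]; push_cast; rw [zero_mul, add_zero]) _ _ z z
      ((H _ _).2.trans (bd _ _ g4 f4)) ((H _ _).2.trans (bd _ _ g4 f4)))
  rw [abs_zero, zero_mul, add_zero] at c2
  have d1 := nw_add 3 (S.Pf t) (S.Nf t)
  have d2 := nw_add 3 (S.Pg t) (S.Ng t)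
  have p1 : |θ * a| * nw (3 + 2) (S.f t) ≤ |θ * a| * n := by gcongr
  have p2 : |θ * 1| * nw (3 + 2) (S.g t) ≤ |θ * 1| * n := by gcongr
  have q1 : 0 ≤ |θ * a| * n := by positivity
  have q2 : 0 ≤ |θ * 1| * n := by positivity
  have r1 : 0 ≤ |b1| * (C * (n * n)) := by positivity
  have r2 : 0 ≤ |b2| * (C * (n * n)) := by positivity
  have r3 : 0 ≤ |b3| * (C * (n * n)) := by positivity
  constructor <;> linarith

lemma Sol.F_lip (S : Sol a θ b1 b2 b3) (n : ℝ) (hn : 0 ≤ n) : ∃ K : ℝ, 0 ≤ K ∧ ∀ c s d, 0 ≤ d → nw 5 (S.f c) ≤ n → nw 5 (S.g c) ≤ n →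
    nw 5 (S.f s) ≤ n → nw 5 (S.g s) ≤ n → nw 3 (S.f c - S.f s) ≤ d → nw 3 (S.g c - S.g s) ≤ d →
    nw 1 ((S.Pf c + S.Nf c) - (S.Pf s + S.Nf s)) ≤ K * d ∧ nw 1 ((S.Pg c + S.Ng c) - (S.Pg s + S.Ng s)) ≤ K * d := by
  obtain ⟨C, hC, H⟩ := bil_nw 0
  simp only [zero_add] at H
  refine ⟨(|θ * a| + |θ * 1|) + (|b1| + |b2| + |b3|) * (2 * (C * n)), by positivity, fun c s d hd hfc hgc hfs hgs hf hg => ?_⟩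
  have m25 : ∀ x : S2, nw 5 x ≤ n → nw 2 x ≤ n := fun x hx => (nw_mono (by norm_num) x).trans hx
  have m23 : ∀ x : S2, nw 3 x ≤ d → nw 2 x ≤ d := fun x hx => (nw_mono (by norm_num) x).trans hx
  have bd : ∀ x y : S2, nw 2 x ≤ d → nw 2 y ≤ n →
      ENNReal.ofReal (C * (nw 2 x * nw 2 y)) ≤ ENNReal.ofReal (C * n * d) := by
    intro x y hx hy
    have := nw_nonneg 2 x
    have := nw_nonneg 2 y
    apply ENNReal.ofReal_le_ofReal
    calc C * (nw 2 x * nw 2 y) ≤ C * (d * n) := by gcongr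
      _ = _ := by ring
  have bd' : ∀ x y : S2, nw 2 x ≤ n → nw 2 y ≤ d →
      ENNReal.ofReal (C * (nw 2 x * nw 2 y)) ≤ ENNReal.ofReal (C * n * d) := by
    intro x y hx hy
    rw [mul_comm (nw 2 x)]; exact bd y x hy hx
  have z : 0 ≤ C * n * d := by positivity
  have zz : 0 ≤ 2 * (C * n * d) := by positivity
  have T1 : ∀ x x' y y' : S2, nw 3 (x - x') ≤ d → nw 3 (y - y') ≤ d → nw 5 x' ≤ n → nw 5 y ≤ n →
      wn (fun ξ => w1 ξ ^ 1) (fun ξ => bilF x y ξ - bilF x' y' ξ) ≤ ENNReal.ofReal (2 * (C * n * d)) := by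
    intro x x' y y' h1 h2 h3 h4
    refine (wn_lin' 1 1 1 (bilF_meas (x - x') y) (bilF_meas x' (y - y')) _ (fun ξ => by rw [bilF_diff]; simp) _ _ z z
      ((H _ _).1.trans (bd _ _ (m23 _ h1) (m25 _ h4))) ((H _ _).1.trans (bd' _ _ (m25 _ h3) (m23 _ h2)))).trans (le_of_eq ?_)
    congr 1; rw [abs_one]; ring
  have T2 : ∀ x x' y y' : S2, nw 3 (x - x') ≤ d → nw 3 (y - y') ≤ d → nw 5 x' ≤ n → nw 5 y ≤ n →
      wn (fun ξ => w1 ξ ^ 1) (fun ξ => bilG x y ξ - bilG x' y' ξ) ≤ ENNReal.ofReal (2 * (C * n * d)) := by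
    intro x x' y y' h1 h2 h3 h4
    refine (wn_lin' 1 1 1 (bilG_meas (x - x') y) (bilG_meas x' (y - y')) _ (fun ξ => by rw [bilG_diff]; simp) _ _ z z
      ((H _ _).2.trans (bd _ _ (m23 _ h1) (m25 _ h4))) ((H _ _).2.trans (bd' _ _ (m25 _ h3) (m23 _ h2)))).trans (le_of_eq ?_)
    congr 1; rw [abs_one]; ring
  have a1 := nw_P 1 (θ * a) (S.Pf c - S.Pf s) (S.f c - S.f s) (fun ξ => by
    rw [S2.sub_apply, S2.sub_apply, S.Pf_eq, S.Pf_eq]; ring)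
  have a2 := nw_P 1 (θ * 1) (S.Pg c - S.Pg s) (S.g c - S.g s) (fun ξ => by
    rw [S2.sub_apply, S2.sub_apply, S.Pg_eq, S.Pg_eq]; ring)
  have c1 : nw 1 (S.Nf c - S.Nf s) ≤ |b1| * (2 * (C * n * d)) + |b2| * (2 * (C * n * d)) :=
    nw_le_of _ _ _ (by positivity) (wn_lin' 1 b1 b2
      ((bilF_meas (S.f c) (S.f c)).sub (bilF_meas (S.f s) (S.f s))) ((bilF_meas (S.g c) (S.g c)).sub (bilF_meas (S.g s) (S.g s))) _
      (fun ξ => by rw [S2.sub_apply, S.Nf_eq', S.Nf_eq']; simp only [Pi.sub_apply]; ring) _ _ zz zz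
      (T1 _ _ _ _ hf hf hfs hfc) (T1 _ _ _ _ hg hg hgs hgc))
  have c2 : nw 1 (S.Ng c - S.Ng s) ≤ |b3| * (2 * (C * n * d)) + |0| * (2 * (C * n * d)) :=
    nw_le_of _ _ _ (by positivity) (wn_lin' 1 b3 0
      ((bilG_meas (S.g c) (S.f c)).sub (bilG_meas (S.g s) (S.f s))) ((bilG_meas (S.g c) (S.f c)).sub (bilG_meas (S.g s) (S.f s))) _
      (fun ξ => by rw [S2.sub_apply, S.Ng_eq', S.Ng_eq']; simp only [Pi.sub_apply]; push_cast; ring) _ _ zz zz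
      (T2 _ _ _ _ hg hf hgs hfc) (T2 _ _ _ _ hg hf hgs hfc))
  rw [abs_zero, zero_mul, add_zero] at c2
  have d1 := nw_add 1 (S.Pf c - S.Pf s) (S.Nf c - S.Nf s)
  have d2 := nw_add 1 (S.Pg c - S.Pg s) (S.Ng c - S.Ng s)
  rw [show S.Pf c - S.Pf s + (S.Nf c - S.Nf s) = (S.Pf c + S.Nf c) - (S.Pf s + S.Nf s) by abel] at d1
  rw [show S.Pg c - S.Pg s + (S.Ng c - S.Ng s) = (S.Pg c + S.Ng c) - (S.Pg s + S.Ng s) by abel] at d2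
  have p1 : |θ * a| * nw (1 + 2) (S.f c - S.f s) ≤ |θ * a| * d := by gcongr
  have p2 : |θ * 1| * nw (1 + 2) (S.g c - S.g s) ≤ |θ * 1| * d := by gcongr
  have q1 : 0 ≤ |θ * a| * d := by positivity
  have q2 : 0 ≤ |θ * 1| * d := by positivity
  have r1 : 0 ≤ |b1| * (2 * (C * n * d)) := by positivity
  have r2 : 0 ≤ |b2| * (2 * (C * n * d)) := by positivity
  have r3 : 0 ≤ |b3| * (2 * (C * n * d)) := by positivity
  have e : ((|θ * a| + |θ * 1|) + (|b1| + |b2| + |b3|) * (2 * (C * n))) * d = |θ * a| * d + |θ * 1| * d +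
    |b1| * (2 * (C * n * d)) + |b2| * (2 * (C * n * d)) + |b3| * (2 * (C * n * d)) := by ring
  rw [e]
  constructor <;> linarith

end HS

open MeasureTheory Set Filter
open scoped ENNReal

namespace HS

lemma hasDerivWithinAt_of_quad {E : Type*} [NormedAddCommGroup E] [NormedSpace ℝ E] (f : ℝ → E) (F : E) (I : Set ℝ) (s C : ℝ)
    (H : ∀ t ∈ I, ‖f t - f s - (t - s) • F‖ ≤ C * (t - s) ^ 2) : HasDerivWithinAt f F I s := by
  rw [hasDerivWithinAt_iff_isLittleO]
  have h1 : (fun t => f t - f s - (t - s) • F) =O[nhdsWithin s I] fun t => (t - s) ^ 2 := by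
    apply Asymptotics.IsBigO.of_bound C
    filter_upwards [self_mem_nhdsWithin] with t ht
    rw [Real.norm_of_nonneg (sq_nonneg _)]
    exact H t ht
  refine h1.trans_isLittleO ?_
  rw [Asymptotics.isLittleO_iff]
  intro c hc
  have : ∀ᶠ t in nhds s, |t - s| < c := by
    have := Metric.ball_mem_nhds s hc
    filter_upwards [this] with t ht
    rwa [Metric.mem_ball, Real.dist_eq] at ht
  filter_upwards [mem_nhdsWithin_of_mem_nhds this] with t ht
  rw [norm_pow, sq]
  exact mul_le_mul_of_nonneg_right (le_of_lt ht) (norm_nonneg _)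

variable {a θ b1 b2 b3 : ℝ}

/-- Quadratic remainder estimate, abstract one-function version. -/
lemma quad_of (U Q : ℝ → SchwartzMap ℝ ℂ) (hd : ∀ t x, HasDerivAt (fun τ => U τ x) (Q t x) t) (t1 t2 B L : ℝ)
    (hU : ∀ τ ∈ Icc t1 t2, ‖ft (U τ)‖ ≤ B) (hQ : ∀ τ ∈ Icc t1 t2, ‖ft (Q τ)‖ ≤ B)
    (hL : ∀ c ∈ Icc t1 t2, ∀ s ∈ Icc t1 t2, nw 1 (ft (Q c) - ft (Q s)) ≤ L * |c - s|) (hL0 : 0 ≤ L) :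
    ∀ s ∈ Icc t1 t2, ∀ t ∈ Icc t1 t2, ‖ft (U t) - ft (U s) - (t - s) • ft (Q s)‖ ≤ L * (t - s) ^ 2 := by
  intro s hs t ht
  rcases le_total s t with h | h
  · have hsub : Icc s t ⊆ Icc t1 t2 := Icc_subset_Icc hs.1 ht.2
    have := nw_mvt U Q hd s t B h (fun τ hτ => hU τ (hsub hτ)) (fun τ hτ => hQ τ (hsub hτ)) (ft (Q s)) 1 (L * (t - s))
      (fun c hc => (hL c (hsub hc) s hs).trans (by
        gcongr
        rw [abs_of_nonneg (by linarith [hc.1])]; linarith [hc.2]))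
    rw [nw_one] at this
    exact this.trans (le_of_eq (by ring))
  · have hsub : Icc t s ⊆ Icc t1 t2 := Icc_subset_Icc ht.1 hs.2
    have := nw_mvt U Q hd t s B h (fun τ hτ => hU τ (hsub hτ)) (fun τ hτ => hQ τ (hsub hτ)) (ft (Q s)) 1 (L * (s - t))
      (fun c hc => (hL c (hsub hc) s hs).trans (by
        gcongr
        rw [abs_of_nonpos (by linarith [hc.2])]; linarith [hc.1]))
    rw [nw_one] at this
    have e : ft (U t) - ft (U s) - (t - s) • ft (Q s) = -(ft (U s) - ft (U t) - (s - t) • ft (Q s)) := by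
      rw [show t - s = -(s - t) by ring, neg_smul]; abel
    rw [e, norm_neg]
    exact this.trans (le_of_eq (by ring))

lemma lip_of (U Q : ℝ → SchwartzMap ℝ ℂ) (hd : ∀ t x, HasDerivAt (fun τ => U τ x) (Q t x) t) (t1 t2 B L : ℝ)
    (hU : ∀ τ ∈ Icc t1 t2, ‖ft (U τ)‖ ≤ B) (hQ : ∀ τ ∈ Icc t1 t2, ‖ft (Q τ)‖ ≤ B)
    (hL : ∀ c ∈ Icc t1 t2, nw 3 (ft (Q c)) ≤ L) :
    ∀ s ∈ Icc t1 t2, ∀ t ∈ Icc t1 t2, nw 3 (ft (U t) - ft (U s)) ≤ L * |t - s| := by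
  have key : ∀ s ∈ Icc t1 t2, ∀ t ∈ Icc t1 t2, s ≤ t → nw 3 (ft (U t) - ft (U s)) ≤ L * |t - s| := by
    intro s hs t ht h
    have hsub : Icc s t ⊆ Icc t1 t2 := Icc_subset_Icc hs.1 ht.2
    have := nw_mvt U Q hd s t B h (fun τ hτ => hU τ (hsub hτ)) (fun τ hτ => hQ τ (hsub hτ)) 0 3 L
      (fun c hc => by rw [sub_zero]; exact hL c (hsub hc))
    rw [smul_zero, sub_zero] at this
    rw [abs_of_nonneg (by linarith)]
    exact this.trans (le_of_eq (by ring))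
  intro s hs t ht
  rcases le_total s t with h | h
  · exact key s hs t ht h
  · have := key t ht s hs h
    rw [← nw_neg, neg_sub, abs_sub_comm]; exact this

theorem Sol.reg (S : Sol a θ b1 b2 b3) (n t1 t2 : ℝ) (hf : ∀ t ∈ Icc t1 t2, nw 5 (S.f t) ≤ n) (hg : ∀ t ∈ Icc t1 t2, nw 5 (S.g t) ≤ n) :
    ∀ t ∈ Icc t1 t2, S.Reg (Icc t1 t2) t := by
  intro t ht
  have hn : 0 ≤ n := (nw_nonneg _ _).trans (hf t ht)
  obtain ⟨K, hK, HK⟩ := S.F_bd n hn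
  obtain ⟨L, hL, HL⟩ := S.F_lip n hn
  have nf : ∀ x : S2, ∀ j, 1 ≤ j → ‖x‖ ≤ nw j x := fun x j hj => by rw [← nw_one]; exact nw_mono hj x
  have uB : ∀ τ ∈ Icc t1 t2, ‖ft (S.U τ)‖ ≤ n + K := fun τ hτ => by
    rw [← S.f_ft]; exact ((nf _ 5 (by norm_num)).trans (hf τ hτ)).trans (by linarith)
  have vB : ∀ τ ∈ Icc t1 t2, ‖ft (S.V τ)‖ ≤ n + K := fun τ hτ => by
    rw [← S.g_ft]; exact ((nf _ 5 (by norm_num)).trans (hg τ hτ)).trans (by linarith)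
  have qu3 : ∀ τ ∈ Icc t1 t2, nw 3 (ft (S.QU τ)) ≤ K := fun τ hτ => by
    rw [← S.QU_ft]; exact (HK τ (hf τ hτ) (hg τ hτ)).1
  have qv3 : ∀ τ ∈ Icc t1 t2, nw 3 (ft (S.QV τ)) ≤ K := fun τ hτ => by
    rw [← S.QV_ft]; exact (HK τ (hf τ hτ) (hg τ hτ)).2
  have quB : ∀ τ ∈ Icc t1 t2, ‖ft (S.QU τ)‖ ≤ n + K := fun τ hτ =>
    ((nf _ 3 (by norm_num)).trans (qu3 τ hτ)).trans (by linarith)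
  have qvB : ∀ τ ∈ Icc t1 t2, ‖ft (S.QV τ)‖ ≤ n + K := fun τ hτ =>
    ((nf _ 3 (by norm_num)).trans (qv3 τ hτ)).trans (by linarith)
  have lu := lip_of S.U S.QU S.dU t1 t2 _ K uB quB qu3
  have lv := lip_of S.V S.QV S.dV t1 t2 _ K vB qvB qv3
  have F : ∀ c ∈ Icc t1 t2, ∀ s ∈ Icc t1 t2, nw 1 (ft (S.QU c) - ft (S.QU s)) ≤ L * K * |c - s| ∧
      nw 1 (ft (S.QV c) - ft (S.QV s)) ≤ L * K * |c - s| := by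
    intro c hc s hs
    have := HL c s (K * |c - s|) (by positivity) (hf c hc) (hg c hc) (hf s hs) (hg s hs)
      (by rw [S.f_ft, S.f_ft]; exact lu s hs c hc) (by rw [S.g_ft, S.g_ft]; exact lv s hs c hc)
    rw [← S.QU_ft, ← S.QU_ft, ← S.QV_ft, ← S.QV_ft, mul_assoc]
    exact this
  have qu := quad_of S.U S.QU S.dU t1 t2 _ (L * K) uB quB (fun c hc s hs => (F c hc s hs).1) (by positivity)
  have qv := quad_of S.V S.QV S.dV t1 t2 _ (L * K) vB qvB (fun c hc s hs => (F c hc s hs).2) (by positivity)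
  constructor
  · apply hasDerivWithinAt_of_quad _ _ _ _ (L * K)
    intro τ hτ
    rw [S.QU_ft, S.f_ft, S.f_ft]
    exact qu t ht τ hτ
  · apply hasDerivWithinAt_of_quad _ _ _ _ (L * K)
    intro τ hτ
    rw [S.QV_ft, S.g_ft, S.g_ft]
    exact qv t ht τ hτ

end HS

open MeasureTheory Set Filter
open scoped ENNReal

namespace HS

/-- The a priori bound property: bounds on an interval follow from a bound at one point. -/
def APB (N : ℝ → ℝ) : Prop := ∀ M : ℝ, ∃ Φ : ℝ, ∀ t1 t2 s : ℝ, t2 - t1 ≤ 1 → s ∈ Icc t1 t2 →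
  (∃ n : ℝ, ∀ t ∈ Icc t1 t2, N t ≤ n) → N s ≤ M → ∀ t ∈ Icc t1 t2, N t ≤ Φ

lemma APB.neg {N : ℝ → ℝ} (h : APB N) : APB (fun t => N (-t)) := by
  intro M
  obtain ⟨Φ, H⟩ := h M
  refine ⟨Φ, fun t1 t2 s h12 hs ⟨n, hn⟩ hM t ht => ?_⟩
  refine H (-t2) (-t1) (-s) (by linarith) ⟨by linarith [hs.2], by linarith [hs.1]⟩ ⟨n, fun τ hτ => ?_⟩ hM (-t)
    ⟨by linarith [ht.2], by linarith [ht.1]⟩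
  have := hn (-τ) ⟨by linarith [hτ.2], by linarith [hτ.1]⟩
  simpa using this

lemma baire_side (N : ℝ → ℝ) (P : Set ℝ) (hP : IsClosed P)
    (hb : ∀ t1 t2, Disjoint (Icc t1 t2) P → ∃ n : ℝ, ∀ t ∈ Icc t1 t2, N t ≤ n)
    (n Φ : ℝ) (hA : APB N) (hΦ : ∀ t1 t2 s : ℝ, t2 - t1 ≤ 1 → s ∈ Icc t1 t2 →
      (∃ n : ℝ, ∀ t ∈ Icc t1 t2, N t ≤ n) → N s ≤ n → ∀ t ∈ Icc t1 t2, N t ≤ Φ)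
    (p t : ℝ) (hp : p ∈ P) (hpt : p ≤ t) (ht1 : t - p ≤ 1) (hn : ∀ τ ∈ P, τ ∈ Icc p t → N τ ≤ n) : N t ≤ Φ := by
  have hK : IsCompact (P ∩ Icc p t) := isCompact_Icc.inter_left hP
  obtain ⟨α, hα, hmax⟩ := hK.exists_isGreatest ⟨p, hp, ⟨le_rfl, hpt⟩⟩
  obtain ⟨Φ1, H1⟩ := hA (N t)
  have hαn := hn α hα.1 hα.2
  refine hΦ α t α (by linarith [hα.2.1]) ⟨le_rfl, hα.2.2⟩ ⟨max n Φ1, fun τ hτ => ?_⟩ hαn t ⟨hα.2.2, le_rfl⟩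
  rcases eq_or_lt_of_le hτ.1 with h | h
  · rw [← h]; exact hαn.trans (le_max_left _ _)
  · refine (H1 τ t t (by linarith [hα.2.1]) ⟨hτ.2, le_rfl⟩ (hb τ t ?_) le_rfl τ ⟨le_rfl, hτ.2⟩).trans (le_max_right _ _)
    rw [Set.disjoint_left]
    intro x hx hxP
    have := hmax ⟨hxP, ⟨by linarith [hα.2.1, hx.1], hx.2⟩⟩
    linarith [hx.1]

theorem baire_bdd (N : ℝ → ℝ) (hcl : ∀ B, IsClosed {t | N t ≤ B}) (hA : APB N) (t1 t2 : ℝ) :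
    ∃ n : ℝ, ∀ t ∈ Icc t1 t2, N t ≤ n := by
  set G : Set ℝ := {t | ∃ n : ℝ, ∀ᶠ τ in nhds t, N τ ≤ n} with hG
  have hGo : IsOpen G := by
    rw [isOpen_iff_mem_nhds]
    rintro t ⟨n, hn⟩
    filter_upwards [hn.eventually_nhds] with τ hτ
    exact ⟨n, hτ⟩
  have hb : ∀ t1 t2, Disjoint (Icc t1 t2) Gᶜ → ∃ n : ℝ, ∀ t ∈ Icc t1 t2, N t ≤ n := by
    intro t1 t2 hd
    refine isCompact_Icc.induction_on (p := fun s => ∃ n : ℝ, ∀ t ∈ s, N t ≤ n) ⟨0, by simp⟩ ?_ ?_ ?_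
    · rintro s t hst ⟨n, hn⟩; exact ⟨n, fun x hx => hn x (hst hx)⟩
    · rintro s t ⟨n, hn⟩ ⟨m, hm⟩
      refine ⟨max n m, fun x hx => ?_⟩
      rcases hx with hx | hx
      · exact (hn x hx).trans (le_max_left _ _)
      · exact (hm x hx).trans (le_max_right _ _)
    · intro x hx
      have hxG : x ∈ G := by
        by_contra h
        exact Set.disjoint_left.1 hd hx h
      obtain ⟨n, hn⟩ := hxG
      exact ⟨_, mem_nhdsWithin_of_mem_nhds hn, n, fun t ht => ht⟩
  suffices hall : Gᶜ = ∅ by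
    apply hb; rw [hall]; exact Set.disjoint_empty _
  by_contra hne
  have hne' : (Gᶜ).Nonempty := Set.nonempty_iff_ne_empty.2 hne
  set P := Gᶜ with hPdef
  have hP : IsClosed P := hGo.isClosed_compl
  have : Nonempty P := hne'.to_subtype
  have : CompleteSpace P := hP.completeSpace_coe
  obtain ⟨n, hn⟩ := nonempty_interior_of_iUnion_of_closed (X := P) (f := fun n : ℕ => {t : P | N t ≤ n})
    (fun n => (hcl n).preimage continuous_subtype_val) (by
      rw [Set.eq_univ_iff_forall]
      intro x
      obtain ⟨m, hm⟩ := exists_nat_ge (N x)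
      exact Set.mem_iUnion.2 ⟨m, hm⟩)
  obtain ⟨⟨p, hp⟩, hpi⟩ := hn
  rw [mem_interior_iff_mem_nhds, Metric.mem_nhds_iff] at hpi
  obtain ⟨δ, hδ, hball⟩ := hpi
  have hPn : ∀ τ ∈ P, |τ - p| < δ → N τ ≤ n := by
    intro τ hτ h
    exact hball (show (⟨τ, hτ⟩ : P) ∈ Metric.ball _ _ by
      rw [Metric.mem_ball, Subtype.dist_eq, Real.dist_eq]; exact h)
  obtain ⟨Φ, hΦ⟩ := hA n
  obtain ⟨Φ', hΦ'⟩ := hA.neg n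
  apply hp
  refine ⟨max Φ Φ', ?_⟩
  filter_upwards [Metric.ball_mem_nhds p (lt_min hδ one_pos)] with t ht
  rw [Metric.mem_ball, Real.dist_eq, lt_min_iff] at ht
  rcases le_total p t with h | h
  · rw [abs_of_nonneg (by linarith)] at ht
    refine (baire_side N P hP hb n Φ hA hΦ p t hp h (by linarith) (fun τ hτ hτ' => hPn τ hτ ?_)).trans (le_max_left _ _)
    rw [abs_of_nonneg (by linarith [hτ'.1])]; linarith [hτ'.2]
  · rw [abs_of_nonpos (by linarith)] at ht
    have := baire_side (fun t => N (-t)) {x | -x ∈ P} (hP.preimage continuous_neg) ?_ n Φ' hA.neg hΦ' (-p) (-t)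
      (by simpa using hp) (by linarith) (by linarith) (fun τ hτ hτ' => hPn (-τ) hτ ?_)
    · simp only [neg_neg] at this
      exact this.trans (le_max_right _ _)
    · intro s1 s2 hd
      obtain ⟨m, hm⟩ := hb (-s2) (-s1) (by
        rw [Set.disjoint_left] at hd ⊢
        intro x hx hxP
        exact hd (a := -x) ⟨by linarith [hx.2], by linarith [hx.1]⟩ (by simpa using hxP))
      exact ⟨m, fun τ hτ => hm (-τ) ⟨by linarith [hτ.2], by linarith [hτ.1]⟩⟩
    · rw [abs_of_nonpos (by linarith [hτ'.1])]; linarith [hτ'.2]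

/-- Fatou for weighted norms. -/
lemma wn_fatou (w : ℝ → ℝ) (wk : ℕ → ℝ → ℝ) (hm : ∀ k, Measurable (wk k)) (he : ∀ ξ, ∀ᶠ k in atTop, wk k ξ = w ξ)
    (h : ℝ → ℂ) (hh : Measurable h) (B : ℝ≥0∞) (hB : ∀ k, wn (wk k) h ≤ B) : wn w h ≤ B := by
  unfold wn at hB ⊢
  apply L2n_le_of_sq
  have e : ∀ ξ, (ENNReal.ofReal (w ξ) * ‖h ξ‖ₑ) ^ (2:ℝ) = liminf (fun k => (ENNReal.ofReal (wk k ξ) * ‖h ξ‖ₑ) ^ (2:ℝ)) atTop := by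
    intro ξ
    symm
    apply Tendsto.liminf_eq
    apply tendsto_const_nhds.congr'
    filter_upwards [he ξ] with k hk
    rw [hk]
  simp_rw [e]
  refine (lintegral_liminf_le (fun k => ?_)).trans ?_
  · exact (((hm k).ennreal_ofReal).mul hh.enorm).pow_const 2
  · apply liminf_le_of_le
    · isBoundedDefault
    · intro b hb
      obtain ⟨k, hk⟩ := hb.exists
      refine hk.trans ?_
      have := hB k
      rw [← L2n_sq]
      gcongr

end HS

open MeasureTheory Set Filter
open scoped ENNReal

namespace HS

lemma jb_sq_le_w1 {σ : ℝ} (h0 : 0 < σ) (h1 : σ ≤ 1) (ξ : ℝ) : jb σ ξ ^ 2 ≤ w1 ξ := by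
  rw [jb_sq]; unfold w1
  have : σ ^ 2 ≤ 1 := by nlinarith
  have := mul_le_mul_of_nonneg_right this (sq_nonneg ξ)
  rw [mul_pow]; linarith

lemma w1_le_jb_sq {σ : ℝ} (h0 : 0 < σ) (h1 : σ ≤ 1) (ξ : ℝ) : w1 ξ ≤ σ⁻¹ ^ 2 * jb σ ξ ^ 2 := by
  rw [jb_sq, mul_pow]; unfold w1
  have h2 : 1 ≤ σ⁻¹ ^ 2 := one_le_pow₀ ((one_le_inv₀ h0).2 h1)
  have e : σ⁻¹ ^ 2 * (1 + σ ^ 2 * ξ ^ 2) = σ⁻¹ ^ 2 + ξ ^ 2 := by field_simp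
  rw [e]; linarith

lemma BW_pow8 {σ : ℝ} (h0 : 0 < σ) (h1 : σ ≤ 1) (K : ℝ) (hK : 1 ≤ K) : BW 256 (K ^ 8) σ (fun s => (min s K) ^ 8) where
  ok := WOK_pow8 K hK
  bd s hs := by
    have : 0 ≤ min s K := le_min (by linarith) (by linarith)
    have : min s K ≤ K := min_le_right _ _
    gcongr
  σ_pos := h0
  σ_le := h1

lemma mm_pow8_le {σ : ℝ} (h0 : 0 < σ) (h1 : σ ≤ 1) (K : ℝ) (hK : 1 ≤ K) (ξ : ℝ) :
    mm σ (fun s => (min s K) ^ 8) ξ ≤ w1 ξ ^ 5 := by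
  unfold mm
  have hj := one_le_jb σ ξ
  have : 0 ≤ min (jb σ ξ) K := le_min (by linarith) (by linarith)
  calc jb σ ξ ^ 2 * (min (jb σ ξ) K) ^ 8 ≤ jb σ ξ ^ 2 * (jb σ ξ) ^ 8 := by gcongr; exact min_le_left _ _
    _ = (jb σ ξ ^ 2) ^ 5 := by ring
    _ ≤ _ := by gcongr; exact jb_sq_le_w1 h0 h1 ξ

lemma xn_pow8_le {σ : ℝ} (h0 : 0 < σ) (h1 : σ ≤ 1) (K : ℝ) (hK : 1 ≤ K) (h : S2) :
    xn σ (fun s => (min s K) ^ 8) h ≤ nw 5 h := by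
  apply (ENNReal.ofReal_le_ofReal_iff (nw_nonneg _ _)).1
  rw [ofReal_xn (BW_pow8 h0 h1 K hK), ofReal_nw]
  exact wn_mono (mm_pow8_le h0 h1 K hK) _

lemma nw5_le_of_xn {σ : ℝ} (h0 : 0 < σ) (h1 : σ ≤ 1) (h : S2) (B : ℝ) (hB : 0 ≤ B)
    (H : ∀ K : ℝ, 1 ≤ K → xn σ (fun s => (min s K) ^ 8) h ≤ B) : nw 5 h ≤ σ⁻¹ ^ 10 * B := by
  apply nw_le_of _ _ _ (by positivity)
  have F : wn (fun ξ => jb σ ξ ^ 10) h ≤ ENNReal.ofReal B := by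
    refine wn_fatou _ (fun k : ℕ => mm σ (fun s => (min s ((k : ℝ) + 1)) ^ 8)) (fun k => ?_) (fun ξ => ?_) h h.measurable _ (fun k => ?_)
    · exact mm_meas (WOK_pow8 _ (by linarith [k.cast_nonneg (α := ℝ)]))
    · obtain ⟨m, hm⟩ := exists_nat_ge (jb σ ξ)
      filter_upwards [eventually_ge_atTop m] with k hk
      have : (m : ℝ) ≤ k := by exact_mod_cast hk
      unfold mm
      beta_reduce
      rw [min_eq_left (by linarith)]; ring
    · have hk : (1 : ℝ) ≤ k + 1 := by linarith [k.cast_nonneg (α := ℝ)]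
      rw [← ofReal_xn (BW_pow8 h0 h1 _ hk)]
      exact ENNReal.ofReal_le_ofReal (H _ hk)
  rw [ENNReal.ofReal_mul (by positivity)]
  refine le_trans ?_ (mul_le_mul_right F _)
  rw [← wn_const_mul _ (by positivity)]
  apply wn_mono
  intro ξ
  have := w1_pos ξ
  calc w1 ξ ^ 5 ≤ (σ⁻¹ ^ 2 * jb σ ξ ^ 2) ^ 5 := by gcongr; exact w1_le_jb_sq h0 h1 ξ
    _ = _ := by ring

variable {a θ b1 b2 b3 : ℝ}

/-- Given `C`, `M` and `T` there is an admissible scale. -/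
lemma exists_l (C X : ℝ) (hC : 0 < C) (hX : 0 ≤ X) : ∃ l : ℝ, 0 < l ∧ l ≤ 1 ∧ C * (l ^ 3 * X) ≤ 1 := by
  refine ⟨1 / (1 + C * X), by positivity, ?_, ?_⟩
  · rw [div_le_one (by positivity)]; nlinarith [mul_nonneg hC.le hX]
  · have h0 : 0 ≤ C * X := by positivity
    have h1 : 1 / (1 + C * X) ≤ 1 := by rw [div_le_one (by positivity)]; linarith
    have h2 : 0 ≤ 1 / (1 + C * X) := by positivity
    have h3 : (1 / (1 + C * X)) ^ 3 ≤ 1 / (1 + C * X) := by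
      calc (1 / (1 + C * X)) ^ 3 ≤ (1 / (1 + C * X)) ^ 1 := pow_le_pow_of_le_one h2 h1 (by norm_num)
        _ = _ := pow_one _
    calc C * ((1 / (1 + C * X)) ^ 3 * X) = (1 / (1 + C * X)) ^ 3 * (C * X) := by ring
      _ ≤ 1 / (1 + C * X) * (C * X) := by gcongr
      _ ≤ 1 := by rw [one_div_mul_eq_div, div_le_one (by positivity)]; linarith

theorem Sol.apb (S : Sol a θ b1 b2 b3) (γ : ℝ) (ha : a ≠ 0) (ha' : a < 1/4) (hθ : 0 < θ) (hγ0 : 0 < γ) (hγ : γ * b3 = -2 * b2) :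
    APB (fun t => max (nw 5 (S.f t)) (nw 5 (S.g t))) := by
  obtain ⟨C1, hC1, H⟩ := bootstrap 256 a θ b1 b2 b3 γ ha ha' hθ (by norm_num) hγ0 hγ
  intro M0
  set M := max M0 1 with hM
  have hM1 : 1 ≤ M := le_max_right _ _
  obtain ⟨l, hl0, hl1, hl⟩ := exists_l C1 (M ^ 2 + M ^ 3) (by linarith) (by positivity)
  have hσ0 : 0 < l ^ 4 := by positivity
  have hσ1 : l ^ 4 ≤ 1 := pow_le_one₀ hl0.le hl1
  refine ⟨(l ^ 4)⁻¹ ^ 10 * (C1 * M), fun t1 t2 s h12 hs ⟨n, hn⟩ hsM t ht => ?_⟩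
  have reg := S.reg n t1 t2 (fun t ht => (le_max_left _ _).trans (hn t ht)) (fun t ht => (le_max_right _ _).trans (hn t ht))
  have hfM : nw 5 (S.f s) ≤ M := ((le_max_left _ _).trans hsM).trans (le_max_left _ _)
  have hgM : nw 5 (S.g s) ≤ M := ((le_max_right _ _).trans hsM).trans (le_max_left _ _)
  have key : ∀ K : ℝ, 1 ≤ K → xn (l ^ 4) (fun s => (min s K) ^ 8) (S.f t) ≤ C1 * M ∧ xn (l ^ 4) (fun s => (min s K) ^ 8) (S.g t) ≤ C1 * M := by
    intro K hK
    refine H (K ^ 8) (l ^ 4) _ (BW_pow8 hσ0 hσ1 K hK) S.toSys l hl0 hl1 rfl t1 t2 s M hM1 hs reg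
      ((xn_pow8_le hσ0 hσ1 K hK _).trans hfM) ((xn_pow8_le hσ0 hσ1 K hK _).trans hgM) ?_ t ht
    refine le_trans ?_ hl
    have : l ^ 3 * (t2 - t1) * M ^ 3 ≤ l ^ 3 * 1 * M ^ 3 := by gcongr
    have e : l ^ 3 * M ^ 2 + l ^ 3 * (t2 - t1) * M ^ 3 ≤ l ^ 3 * (M ^ 2 + M ^ 3) := by linarith
    gcongr
  have hB : 0 ≤ C1 * M := by positivity
  exact max_le (nw5_le_of_xn hσ0 hσ1 _ _ hB (fun K hK => (key K hK).1)) (nw5_le_of_xn hσ0 hσ1 _ _ hB (fun K hK => (key K hK).2))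

theorem Sol.reg_all (S : Sol a θ b1 b2 b3) (γ : ℝ) (ha : a ≠ 0) (ha' : a < 1/4) (hθ : 0 < θ) (hγ0 : 0 < γ) (hγ : γ * b3 = -2 * b2)
    (t1 t2 : ℝ) : ∀ t ∈ Icc t1 t2, S.Reg (Icc t1 t2) t := by
  have cU : ∀ x, Continuous (fun τ => S.U τ x) := fun x => continuous_iff_continuousAt.2 fun t => (S.dU t x).continuousAt
  have cV : ∀ x, Continuous (fun τ => S.V τ x) := fun x => continuous_iff_continuousAt.2 fun t => (S.dV t x).continuousAt
  have hcl : ∀ B, IsClosed {t | max (nw 5 (S.f t)) (nw 5 (S.g t)) ≤ B} := by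
    intro B
    have := (nw_lsc S.U cU 5 (by norm_num) B).inter (nw_lsc S.V cV 5 (by norm_num) B)
    convert this using 1
    ext t
    rw [mem_ofPred_eq, max_le_iff, S.f_ft, S.g_ft]
    rfl
  obtain ⟨n, hn⟩ := baire_bdd _ hcl (S.apb γ ha ha' hθ hγ0 hγ) t1 t2
  exact S.reg n t1 t2 (fun t ht => (le_max_left _ _).trans (hn t ht)) (fun t ht => (le_max_right _ _).trans (hn t ht))

end HS

open MeasureTheory Set Filter
open scoped ENNReal

namespace HS

open scoped FourierTransform

noncomputable def mulS (U V : SchwartzMap ℝ ℂ) : SchwartzMap ℝ ℂ :=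
  SchwartzMap.pairing (ContinuousLinearMap.mul ℂ ℂ) U V

lemma mulS_apply (U V : SchwartzMap ℝ ℂ) (x : ℝ) : mulS U V x = U x * V x := by
  unfold mulS
  rw [SchwartzMap.pairing_apply_apply]
  rfl

lemma fourier_fourier_neg (U : SchwartzMap ℝ ℂ) (x : ℝ) : (𝓕 (𝓕 U : SchwartzMap ℝ ℂ) : SchwartzMap ℝ ℂ) x = U (-x) := by
  have h : (𝓕⁻ (𝓕 U : SchwartzMap ℝ ℂ) : SchwartzMap ℝ ℂ) = U := FourierTransform.fourierInv_fourier_eq U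
  have h2 := congrArg (fun g : SchwartzMap ℝ ℂ => g (-x)) h
  simp only [SchwartzMap.fourierInv_apply_eq] at h2
  rw [← h2]
  simp

lemma ft_mulS (V U : SchwartzMap ℝ ℂ) (ξ : ℝ) : ft (mulS V U) ξ = ∫ y, ft V y * ft U (ξ - y) := by
  set H := SchwartzMap.convolution (ContinuousLinearMap.mul ℂ ℂ) (𝓕 V : SchwartzMap ℝ ℂ) (𝓕 U) with hH
  have e : (𝓕 (mulS V U) : SchwartzMap ℝ ℂ) = H := by
    have e2 : (𝓕 (𝓕 (mulS V U) : SchwartzMap ℝ ℂ) : SchwartzMap ℝ ℂ) = 𝓕 H := by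
      ext x
      rw [hH, SchwartzMap.fourier_convolution, fourier_fourier_neg, mulS_apply, SchwartzMap.pairing_apply_apply,
        fourier_fourier_neg, fourier_fourier_neg]
      rfl
    have := congrArg (fun g : SchwartzMap ℝ ℂ => (𝓕⁻ g : SchwartzMap ℝ ℂ)) e2
    simpa only [FourierTransform.fourierInv_fourier_eq] using this
  change (𝓕 (mulS V U) : SchwartzMap ℝ ℂ) ξ = _
  rw [e, hH, SchwartzMap.convolution_apply]
  rfl

noncomputable def DS : SchwartzMap ℝ ℂ →L[ℂ] SchwartzMap ℝ ℂ := SchwartzMap.derivCLM ℂ ℂ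

lemma DS_hasDeriv (U : SchwartzMap ℝ ℂ) (x : ℝ) : HasDerivAt U (DS U x) x := U.hasDerivAt x

lemma ft_DS (U : SchwartzMap ℝ ℂ) (ξ : ℝ) : ft (DS U) ξ = (2 * Real.pi * ξ : ℝ) * Complex.I * ft U ξ := by
  change 𝓕 (fun x => deriv U x) ξ = _
  have := Real.fourier_deriv (f := U) U.integrable (fun x => (U.hasDerivAt x).differentiableAt) (DS U).integrable
  rw [show (fun x => deriv U x) = deriv U from rfl, this]
  change (2 * Real.pi * Complex.I * ξ) • ft U ξ = _
  rw [smul_eq_mul]; push_cast; ring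

lemma ft_add (U V : SchwartzMap ℝ ℂ) : ft (U + V) = ft U + ft V := FourierTransform.fourier_add U V
lemma ft_smul (c : ℂ) (U : SchwartzMap ℝ ℂ) (ξ : ℝ) : ft (c • U) ξ = c * ft U ξ := by
  change (𝓕 (c • U) : SchwartzMap ℝ ℂ) ξ = _
  rw [FourierTransform.fourier_smul]; rfl

lemma ft_eq_int (U : SchwartzMap ℝ ℂ) (ξ : ℝ) : ft U ξ = ∫ x : ℝ, Complex.exp (((-2 * Real.pi * x * ξ : ℝ) : ℂ) * Complex.I) * U x := by
  change 𝓕 (fun x => U x) ξ = _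
  rw [Real.fourier_real_eq_integral_exp_smul]
  simp only [smul_eq_mul]

lemma ft_conj (U : SchwartzMap ℝ ℂ) (hU : ∀ x, starRingEnd ℂ (U x) = U x) (ξ : ℝ) : ft U (-ξ) = starRingEnd ℂ (ft U ξ) := by
  rw [ft_eq_int, ft_eq_int, ← integral_conj]
  congr 1; ext x
  rw [map_mul, hU, ← Complex.exp_conj, map_mul, Complex.conj_ofReal, Complex.conj_I]
  congr 2; push_cast; ring

noncomputable def cpx : SchwartzMap ℝ ℝ →L[ℝ] SchwartzMap ℝ ℂ := SchwartzMap.postcompCLM Complex.ofRealCLM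

lemma cpx_apply (φ : SchwartzMap ℝ ℝ) (x : ℝ) : cpx φ x = (φ x : ℂ) := rfl

lemma DS_cpx (φ : SchwartzMap ℝ ℝ) : DS (cpx φ) = cpx (SchwartzMap.derivCLM ℝ ℝ φ) := by
  ext x
  have h1 := DS_hasDeriv (cpx φ) x
  have h2 := (φ.hasDerivAt x).ofReal_comp
  exact h1.unique h2

lemma DS_mulS (U V : SchwartzMap ℝ ℂ) (x : ℝ) : DS (mulS U V) x = DS U x * V x + U x * DS V x := by
  have h1 := DS_hasDeriv (mulS U V) x
  have h2 := (DS_hasDeriv U x).mul (DS_hasDeriv V x)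
  have e : (⇑(mulS U V) : ℝ → ℂ) = (⇑U * ⇑V) := by ext y; exact mulS_apply U V y
  rw [e] at h1
  exact h1.unique h2

/-- The Fourier side solution attached to a smooth Schwartz solution. -/
noncomputable def mkSol (a c : ℝ) (φ ψ : ℝ → SchwartzMap ℝ ℝ)
    (hφ : ∀ x t, HasDerivAt (fun τ => φ τ x) (-a * iteratedDeriv 3 (φ t) x + (-(6 * a) * φ t x * deriv (φ t) x + c * ψ t x * deriv (ψ t) x)) t)
    (hψ : ∀ x t, HasDerivAt (fun τ => ψ τ x) (- iteratedDeriv 3 (ψ t) x + (-3 * φ t x * deriv (ψ t) x)) t) :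
    Sol a (8 * Real.pi ^ 3) (-6 * Real.pi * a) (Real.pi * c) (-6 * Real.pi) where
  f t := ft (cpx (φ t))
  g t := ft (cpx (ψ t))
  Pf t := ft ((-a : ℂ) • DS (DS (DS (cpx (φ t)))))
  Nf t := ft (DS ((-3 * a : ℂ) • mulS (cpx (φ t)) (cpx (φ t)) + (c / 2 : ℂ) • mulS (cpx (ψ t)) (cpx (ψ t))))
  Pg t := ft ((-1 : ℂ) • DS (DS (DS (cpx (ψ t)))))
  Ng t := ft ((-3 : ℂ) • mulS (DS (cpx (ψ t))) (cpx (φ t)))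
  Pf_eq t ξ := by
    rw [ft_smul, ft_DS, ft_DS, ft_DS]
    push_cast
    linear_combination (-8 * (Real.pi : ℂ) ^ 3 * ξ ^ 3 * a * Complex.I * ft (cpx (φ t)) ξ) * Complex.I_sq
  Pg_eq t ξ := by
    rw [ft_smul, ft_DS, ft_DS, ft_DS]
    push_cast
    linear_combination (-8 * (Real.pi : ℂ) ^ 3 * ξ ^ 3 * Complex.I * ft (cpx (ψ t)) ξ) * Complex.I_sq
  Nf_eq t ξ := by
    rw [ft_DS, ft_add, S2.add_apply, ft_smul, ft_smul, ft_mulS, ft_mulS]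
    push_cast
    ring
  Ng_eq t ξ := by
    rw [ft_smul, ft_mulS]
    have : ∫ y, ft (DS (cpx (ψ t))) y * ft (cpx (φ t)) (ξ - y) =
        (2 * Real.pi * Complex.I) * ∫ y : ℝ, ((y : ℝ) : ℂ) * ft (cpx (ψ t)) y * ft (cpx (φ t)) (ξ - y) := by
      rw [← integral_const_mul]
      congr 1; ext y
      rw [ft_DS]; push_cast; ring
    rw [this]; push_cast; ring
  f_conj t ξ := ft_conj _ (fun x => by rw [cpx_apply, Complex.conj_ofReal]) ξ
  g_conj t ξ := ft_conj _ (fun x => by rw [cpx_apply, Complex.conj_ofReal]) ξ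
  U t := cpx (φ t)
  V t := cpx (ψ t)
  QU t := (-a : ℂ) • DS (DS (DS (cpx (φ t)))) +
    DS ((-3 * a : ℂ) • mulS (cpx (φ t)) (cpx (φ t)) + (c / 2 : ℂ) • mulS (cpx (ψ t)) (cpx (ψ t)))
  QV t := (-1 : ℂ) • DS (DS (DS (cpx (ψ t)))) + (-3 : ℂ) • mulS (DS (cpx (ψ t))) (cpx (φ t))
  f_ft t := rfl
  g_ft t := rfl
  QU_ft t := (ft_add _ _).symm
  QV_ft t := (ft_add _ _).symm
  dU t x := by
    have h := (hφ x t).ofReal_comp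
    refine (h.congr_deriv ?_)
    rw [map_add, map_smul, map_smul]
    simp only [SchwartzMap.add_apply, SchwartzMap.smul_apply, DS_mulS, DS_cpx, cpx_apply, smul_eq_mul]
    rw [iteratedDeriv_succ, iteratedDeriv_succ, iteratedDeriv_one]
    change _ = (-a : ℂ) * ((deriv (deriv (deriv (φ t))) x : ℝ) : ℂ) + ((-3 * a : ℂ) * (((deriv (φ t) x : ℝ) : ℂ) * (φ t x : ℂ) + (φ t x : ℂ) * ((deriv (φ t) x : ℝ) : ℂ)) +
      (c / 2 : ℂ) * (((deriv (ψ t) x : ℝ) : ℂ) * (ψ t x : ℂ) + (ψ t x : ℂ) * ((deriv (ψ t) x : ℝ) : ℂ)))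
    push_cast
    ring
  dV t x := by
    have h := (hψ x t).ofReal_comp
    refine (h.congr_deriv ?_)
    simp only [SchwartzMap.add_apply, SchwartzMap.smul_apply, mulS_apply, DS_cpx, cpx_apply, smul_eq_mul]
    rw [iteratedDeriv_succ, iteratedDeriv_succ, iteratedDeriv_one]
    change _ = (-1 : ℂ) * ((deriv (deriv (deriv (ψ t))) x : ℝ) : ℂ) + (-3 : ℂ) * (((deriv (ψ t) x : ℝ) : ℂ) * (φ t x : ℂ))
    push_cast
    ring

end HS

namespace HS

lemma poly_exp (p δ : ℝ) (hδ : 0 < δ) : ∃ C : ℝ, 0 < C ∧ ∀ x : ℝ, 0 ≤ x → (1 + x) ^ p ≤ C * Real.exp (δ * x) := by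
  obtain ⟨N, hN⟩ := exists_nat_ge p
  refine ⟨(N.factorial : ℝ) / δ ^ N * Real.exp δ, by positivity, fun x hx => ?_⟩
  have h1 : (1 + x) ^ p ≤ (1 + x) ^ N := by
    rw [← Real.rpow_natCast]
    exact Real.rpow_le_rpow_of_exponent_le (by linarith) hN
  have h2 := Real.pow_div_factorial_le_exp (δ * (1 + x)) (by positivity) N
  refine h1.trans ?_
  rw [div_le_iff₀ (by positivity), mul_pow] at h2
  rw [mul_assoc, ← Real.exp_add, show δ + δ * x = δ * (1 + x) by ring, div_mul_eq_mul_div, le_div_iff₀ (by positivity)]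
  linarith

lemma FT1_eq (φ : SchwartzMap ℝ ℝ) (g : ℝ → ℂ) (hg : ∀ x, g x = φ x) (ξ : ℝ) :
    FT1 g (2 * Real.pi * ξ) = ft (cpx φ) ξ := by
  rw [ft_eq_int]; unfold FT1
  congr 1; ext x
  rw [hg, cpx_apply]
  congr 2; push_cast; ring

lemma gev_iff (σ s : ℝ) (φ : SchwartzMap ℝ ℝ) (g : ℝ → ℂ) (hg : ∀ x, g x = φ x) :
    gevreyNorm σ s g ≠ ⊤ ↔ ∫⁻ ξ : ℝ, ENNReal.ofReal (Real.exp (2 * σ * |2 * Real.pi * ξ|) * (1 + |2 * Real.pi * ξ|) ^ (2 * s)) *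
      ‖ft (cpx φ) ξ‖ₑ ^ (2 : ℝ) ≠ ⊤ := by
  unfold gevreyNorm
  have hpi : 2 * Real.pi ≠ 0 := by positivity
  set F : ℝ → ℝ≥0∞ := fun ξ => ENNReal.ofReal
      (Real.exp (2 * σ * |ξ|) * (1 + |ξ|) ^ (2 * s) * ‖FT1 g ξ‖ ^ 2) with hF
  have e : ∀ ξ, ENNReal.ofReal (Real.exp (2 * σ * |2 * Real.pi * ξ|) * (1 + |2 * Real.pi * ξ|) ^ (2 * s)) *
      ‖ft (cpx φ) ξ‖ₑ ^ (2 : ℝ) = F (2 * Real.pi * ξ) := by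
    intro ξ
    rw [hF]; beta_reduce
    symm
    rw [FT1_eq φ g hg, ENNReal.ofReal_mul (by positivity), ENNReal.ofReal_pow (norm_nonneg _), ofReal_norm]
    congr 1
    exact (ENNReal.rpow_natCast _ 2).symm
  simp_rw [e]
  have cv : ∫⁻ ξ, F ξ = ENNReal.ofReal |2 * Real.pi| * ∫⁻ ξ, F (2 * Real.pi * ξ) := by
    conv_lhs => rw [← Real.smul_map_volume_mul_left hpi]
    rw [lintegral_smul_measure]
    congr 1
    exact (lintegral_map_equiv F (Homeomorph.mulLeft₀ _ hpi).toMeasurableEquiv)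
  have hp : ENNReal.ofReal |2 * Real.pi| ≠ 0 := by
    rw [Ne, ENNReal.ofReal_eq_zero, not_le]; positivity
  rw [cv]
  constructor
  · intro h h'
    apply h
    rw [h', ENNReal.mul_top hp, ENNReal.top_rpow_of_pos (by norm_num)]
  · intro h
    exact ENNReal.rpow_ne_top_of_nonneg (by norm_num) (ENNReal.mul_ne_top ENNReal.ofReal_ne_top h)

lemma BW_exp {σ : ℝ} (h0 : 0 < σ) (h1 : σ ≤ 1) (K : ℝ) (hK : 1 ≤ K) : BW 2 (Real.exp K) σ (fun s => Real.exp (min s K)) where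
  ok := WOK_exp K hK
  bd _ _ := Real.exp_le_exp.2 (min_le_right _ _)
  σ_pos := h0
  σ_le := h1

lemma mm_exp_le {σ : ℝ} (h0 : 0 < σ) (K : ℝ) (ξ : ℝ) :
    mm σ (fun s => Real.exp (min s K)) ξ ≤ 2 * Real.exp 2 * Real.exp (2 * σ * |ξ|) := by
  have hj := jb_pos σ ξ
  have hj1 : jb σ ξ ≤ 1 + σ * |ξ| := by
    unfold jb
    rw [Real.sqrt_le_left (by positivity)]
    have := abs_nonneg ξ
    have e : (σ * ξ) ^ 2 = (σ * |ξ|) ^ 2 := by rw [mul_pow, mul_pow, sq_abs]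
    rw [e]
    nlinarith [mul_nonneg h0.le this]
  have h2 : jb σ ξ ^ 2 ≤ 2 * Real.exp (jb σ ξ) := by
    have := Real.pow_div_factorial_le_exp (jb σ ξ) hj.le 2
    simp only [Nat.factorial] at this
    norm_num at this
    linarith
  unfold mm
  calc jb σ ξ ^ 2 * Real.exp (min (jb σ ξ) K) ≤ 2 * Real.exp (jb σ ξ) * Real.exp (jb σ ξ) := by
        gcongr; exact min_le_left _ _
    _ = 2 * Real.exp (2 * jb σ ξ) := by rw [mul_assoc, ← Real.exp_add]; ring_nf
    _ ≤ 2 * Real.exp (2 + 2 * σ * |ξ|) := by gcongr; linarith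
    _ = _ := by rw [Real.exp_add]; ring

/-- Initial bound. -/
lemma init_bd (σ0 s : ℝ) (h0 : 0 < σ0) (h : S2)
    (H : ∫⁻ ξ : ℝ, ENNReal.ofReal (Real.exp (2 * σ0 * |2 * Real.pi * ξ|) * (1 + |2 * Real.pi * ξ|) ^ (2 * s)) *
      ‖h ξ‖ₑ ^ (2 : ℝ) ≠ ⊤) : ∃ M : ℝ, ∀ σ, 0 < σ → σ ≤ 1 → σ ≤ σ0 / 2 → ∀ K, 1 ≤ K → xn σ (fun s => Real.exp (min s K)) h ≤ M := by
  obtain ⟨C, hC, hCb⟩ := poly_exp (-(2 * s)) σ0 h0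
  set I := ∫⁻ ξ : ℝ, ENNReal.ofReal (Real.exp (2 * σ0 * |2 * Real.pi * ξ|) * (1 + |2 * Real.pi * ξ|) ^ (2 * s)) *
      ‖h ξ‖ₑ ^ (2 : ℝ) with hI
  set D : ℝ := (2 * Real.exp 2) ^ 2 * C with hD
  set B : ℝ≥0∞ := (ENNReal.ofReal D * I) ^ (1/2 : ℝ) with hB
  have hBt : B ≠ ⊤ := ENNReal.rpow_ne_top_of_nonneg (by norm_num) (ENNReal.mul_ne_top ENNReal.ofReal_ne_top H)
  refine ⟨B.toReal, fun σ hσ hσ1 hσ0 K hK => ?_⟩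
  unfold xn
  apply ENNReal.toReal_mono hBt
  unfold wn
  apply L2n_le_of_sq
  rw [hB, ← ENNReal.rpow_mul, show (1/2 : ℝ) * 2 = 1 by norm_num, ENNReal.rpow_one, hI, ← lintegral_const_mul' _ _ ENNReal.ofReal_ne_top]
  apply lintegral_mono
  intro ξ
  beta_reduce
  rw [ENNReal.mul_rpow_of_nonneg _ _ (by norm_num), ← mul_assoc, ← ENNReal.ofReal_mul (by positivity)]
  gcongr
  have hm0 : 0 ≤ mm σ (fun s => Real.exp (min s K)) ξ := by unfold mm; positivity
  rw [ENNReal.ofReal_rpow_of_nonneg hm0 (by norm_num)]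
  apply ENNReal.ofReal_le_ofReal
  rw [Real.rpow_two]
  have hx : |ξ| ≤ |2 * Real.pi * ξ| := by
    rw [abs_mul, abs_of_pos (by positivity : 0 < 2 * Real.pi)]
    have := Real.pi_gt_three
    nlinarith [abs_nonneg ξ]
  set y := |2 * Real.pi * ξ| with hy
  have hy0 : 0 ≤ y := abs_nonneg _
  have c1 := hCb y hy0
  have c2 : 1 ≤ C * Real.exp (σ0 * y) * (1 + y) ^ (2 * s) := by
    have p : 0 < (1 + y) ^ (2 * s) := Real.rpow_pos_of_pos (by linarith) _
    rw [Real.rpow_neg (by linarith)] at c1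
    have := mul_le_mul_of_nonneg_right c1 p.le
    rwa [inv_mul_cancel₀ p.ne'] at this
  have c4 : Real.exp (2 * σ * |ξ|) ^ 2 ≤ Real.exp (σ0 * y) := by
    rw [← Real.exp_nat_mul, Real.exp_le_exp]
    push_cast
    have : |ξ| * 2 ≤ y := by
      rw [hy, abs_mul, abs_of_pos (by positivity : 0 < 2 * Real.pi)]
      have := Real.pi_gt_three
      nlinarith [abs_nonneg ξ]
    have : σ * (|ξ| * 2) ≤ σ0 / 2 * y := by gcongr
    linarith
  have e1 := mm_exp_le hσ K ξ
  calc mm σ (fun s => Real.exp (min s K)) ξ ^ 2 ≤ (2 * Real.exp 2 * Real.exp (2 * σ * |ξ|)) ^ 2 := by gcongr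
    _ = (2 * Real.exp 2) ^ 2 * Real.exp (2 * σ * |ξ|) ^ 2 * 1 := by ring
    _ ≤ (2 * Real.exp 2) ^ 2 * Real.exp (σ0 * y) * (C * Real.exp (σ0 * y) * (1 + y) ^ (2 * s)) := by gcongr
    _ = D * (Real.exp (σ0 * y + σ0 * y) * (1 + y) ^ (2 * s)) := by rw [Real.exp_add, hD]; ring
    _ = _ := by rw [show σ0 * y + σ0 * y = 2 * σ0 * y by ring]

/-- Final conversion. -/
lemma fin_bd (σ σ' s B : ℝ) (h0 : 0 < σ) (h1 : σ ≤ 1) (hs : 4 * Real.pi * σ' ≤ σ) (h : S2)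
    (H : ∀ K : ℝ, 1 ≤ K → xn σ (fun s => Real.exp (min s K)) h ≤ B) :
    ∫⁻ ξ : ℝ, ENNReal.ofReal (Real.exp (2 * σ' * |2 * Real.pi * ξ|) * (1 + |2 * Real.pi * ξ|) ^ (2 * s)) *
      ‖h ξ‖ₑ ^ (2 : ℝ) ≠ ⊤ := by
  have F : wn (fun ξ => jb σ ξ ^ 2 * Real.exp (jb σ ξ)) h ≤ ENNReal.ofReal B := by
    refine wn_fatou _ (fun k : ℕ => mm σ (fun s => Real.exp (min s ((k : ℝ) + 1)))) (fun k => ?_) (fun ξ => ?_) h h.measurable _ (fun k => ?_)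
    · exact mm_meas (WOK_exp _ (by linarith [k.cast_nonneg (α := ℝ)]))
    · obtain ⟨m, hm⟩ := exists_nat_ge (jb σ ξ)
      filter_upwards [eventually_ge_atTop m] with k hk
      have : (m : ℝ) ≤ k := by exact_mod_cast hk
      unfold mm
      beta_reduce
      rw [min_eq_left (by linarith)]
    · have hk : (1 : ℝ) ≤ k + 1 := by linarith [k.cast_nonneg (α := ℝ)]
      rw [← ofReal_xn (BW_exp h0 h1 _ hk)]
      exact ENNReal.ofReal_le_ofReal (H _ hk)
  obtain ⟨C, hC, hCb⟩ := poly_exp (2 * s) (σ / (2 * Real.pi)) (by positivity)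
  have F2 : ∫⁻ ξ, (ENNReal.ofReal (jb σ ξ ^ 2 * Real.exp (jb σ ξ)) * ‖h ξ‖ₑ) ^ (2 : ℝ) ≠ ⊤ := by
    rw [← L2n_sq]
    exact ENNReal.rpow_ne_top_of_nonneg (by norm_num) (ne_top_of_le_ne_top ENNReal.ofReal_ne_top F)
  refine ne_top_of_le_ne_top (ENNReal.mul_ne_top (ENNReal.ofReal_ne_top (r := C)) F2) ?_
  rw [← lintegral_const_mul' _ _ ENNReal.ofReal_ne_top]
  apply lintegral_mono
  intro ξ
  beta_reduce
  have hj := one_le_jb σ ξ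
  rw [ENNReal.mul_rpow_of_nonneg _ _ (by norm_num), ENNReal.ofReal_rpow_of_nonneg (by positivity) (by norm_num), ← mul_assoc,
    ← ENNReal.ofReal_mul hC.le]
  refine mul_le_mul' (ENNReal.ofReal_le_ofReal ?_) le_rfl
  have c1 := hCb |2 * Real.pi * ξ| (abs_nonneg _)
  have ey : |2 * Real.pi * ξ| = 2 * Real.pi * |ξ| := by rw [abs_mul, abs_of_pos (by positivity : 0 < 2 * Real.pi)]
  have c2 : Real.exp (2 * σ' * |2 * Real.pi * ξ|) ≤ Real.exp (σ * |ξ|) := by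
    rw [Real.exp_le_exp, ey]
    have := mul_le_mul_of_nonneg_right hs (abs_nonneg ξ)
    linarith
  have e3 : σ / (2 * Real.pi) * |2 * Real.pi * ξ| = σ * |ξ| := by rw [ey]; field_simp
  rw [e3] at c1
  have c4 : σ * |ξ| ≤ jb σ ξ := by
    have := abs_le_jb σ ξ
    rwa [abs_mul, abs_of_pos h0] at this
  calc Real.exp (2 * σ' * |2 * Real.pi * ξ|) * (1 + |2 * Real.pi * ξ|) ^ (2 * s) ≤ Real.exp (σ * |ξ|) * (C * Real.exp (σ * |ξ|)) := by gcongr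
    _ ≤ Real.exp (jb σ ξ) * (C * Real.exp (jb σ ξ)) := by gcongr
    _ = C * (1 * Real.exp (jb σ ξ)) ^ 2 := by ring
    _ ≤ C * (jb σ ξ ^ 2 * Real.exp (jb σ ξ)) ^ 2 := by gcongr; exact one_le_pow₀ hj
    _ = C * (jb σ ξ ^ 2 * Real.exp (jb σ ξ)) ^ (2 : ℝ) := by rw [Real.rpow_two]

end HS

/-- Persistence of spatial analyticity for the Hirota–Satsuma system
`u_t + a₁ u_{xxx} = −6a₁ u u_x + c₁₂ v v_x`, `v_t + v_{xxx} = −3 u v_x` with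
`a₁ ≠ 0`, `a₁ < 1/4` and `c₁₂ > 0`: if `(u,v)` is a real-valued smooth
solution, Schwartz in space, with `‖u(0)‖_{G^{σ₀,s}}, ‖v(0)‖_{G^{σ₀,s}}`
finite for some `σ₀ > 0`, then for every `ε > 0` there is `c > 0` such that
`‖u(t)‖_{G^{σ(t),s}}` and `‖v(t)‖_{G^{σ(t),s}}` are finite for all `t ∈ ℝ`,
where `σ(t) = c(1+|t|)^{−4/3−ε}`. -/
theorem persistence_of_analyticity_hirota_satsuma
    (a₁ c₁₂ : ℝ) (ha₁ : a₁ ≠ 0) (ha₁' : a₁ < 1/4) (hc₁₂ : 0 < c₁₂)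
    (σ₀ s : ℝ) (hσ₀ : 0 < σ₀)
    (u v : ℝ → ℝ → ℝ)
    (hu : ContDiff ℝ (⊤ : ℕ∞) (fun p : ℝ × ℝ => u p.1 p.2))
    (hv : ContDiff ℝ (⊤ : ℕ∞) (fun p : ℝ × ℝ => v p.1 p.2))
    (huS : ∀ t : ℝ, ∃ φ : SchwartzMap ℝ ℝ, ∀ x : ℝ, φ x = u t x)
    (hvS : ∀ t : ℝ, ∃ ψ : SchwartzMap ℝ ℝ, ∀ x : ℝ, ψ x = v t x)
    (hPDEu : ∀ t x : ℝ,
      deriv (fun τ => u τ x) t + a₁ * iteratedDeriv 3 (u t) x =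
        -(6 * a₁) * u t x * deriv (u t) x + c₁₂ * v t x * deriv (v t) x)
    (hPDEv : ∀ t x : ℝ,
      deriv (fun τ => v τ x) t + iteratedDeriv 3 (v t) x =
        -3 * u t x * deriv (v t) x)
    (hu0 : gevreyNorm σ₀ s (fun x => (u 0 x : ℂ)) ≠ ⊤)
    (hv0 : gevreyNorm σ₀ s (fun x => (v 0 x : ℂ)) ≠ ⊤) :
    ∀ ε : ℝ, 0 < ε → ∃ c : ℝ, 0 < c ∧
      ∀ t : ℝ,
        gevreyNorm (c * (1 + |t|) ^ (-(4/3 : ℝ) - ε)) s (fun x => (u t x : ℂ)) ≠ ⊤ ∧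
        gevreyNorm (c * (1 + |t|) ^ (-(4/3 : ℝ) - ε)) s (fun x => (v t x : ℂ)) ≠ ⊤ := by
  intro ε hε
  choose φ hφ using huS
  choose ψ hψ using hvS
  have eφ : ∀ t, (φ t : ℝ → ℝ) = u t := fun t => funext (hφ t)
  have eψ : ∀ t, (ψ t : ℝ → ℝ) = v t := fun t => funext (hψ t)
  have dU : ∀ x t, HasDerivAt (fun τ => φ τ x) (-a₁ * iteratedDeriv 3 (φ t) x +
      (-(6 * a₁) * φ t x * deriv (φ t) x + c₁₂ * ψ t x * deriv (ψ t) x)) t := by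
    intro x t
    have e1 : (fun τ => φ τ x) = fun τ => u τ x := funext fun τ => hφ τ x
    have d : DifferentiableAt ℝ (fun τ => u τ x) t := by
      have h1 : Differentiable ℝ (fun p : ℝ × ℝ => u p.1 p.2) := hu.differentiable (by simp)
      have h2 : Differentiable ℝ (fun τ : ℝ => ((τ, x) : ℝ × ℝ)) := by fun_prop
      exact (h1.comp h2) t
    rw [e1, eφ t, eψ t]
    refine d.hasDerivAt.congr_deriv ?_
    linear_combination hPDEu t x
  have dV : ∀ x t, HasDerivAt (fun τ => ψ τ x) (- iteratedDeriv 3 (ψ t) x + (-3 * φ t x * deriv (ψ t) x)) t := by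
    intro x t
    have e1 : (fun τ => ψ τ x) = fun τ => v τ x := funext fun τ => hψ τ x
    have d : DifferentiableAt ℝ (fun τ => v τ x) t := by
      have h1 : Differentiable ℝ (fun p : ℝ × ℝ => v p.1 p.2) := hv.differentiable (by simp)
      have h2 : Differentiable ℝ (fun τ : ℝ => ((τ, x) : ℝ × ℝ)) := by fun_prop
      exact (h1.comp h2) t
    rw [e1, eφ t, eψ t]
    refine d.hasDerivAt.congr_deriv ?_
    linear_combination hPDEv t x
  have hθ : 0 < 8 * Real.pi ^ 3 := by positivity
  have hγ : c₁₂ / 3 * (-6 * Real.pi) = -2 * (Real.pi * c₁₂) := by ring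
  have gφ : ∀ t x, ((u t x : ℝ) : ℂ) = φ t x := fun t x => by rw [hφ]
  have gψ : ∀ t x, ((v t x : ℝ) : ℂ) = ψ t x := fun t x => by rw [hψ]
  obtain ⟨M1, hM1⟩ := HS.init_bd σ₀ s hσ₀ _ ((HS.gev_iff σ₀ s (φ 0) _ (gφ 0)).1 hu0)
  obtain ⟨M2, hM2⟩ := HS.init_bd σ₀ s hσ₀ _ ((HS.gev_iff σ₀ s (ψ 0) _ (gψ 0)).1 hv0)
  set S := HS.mkSol a₁ c₁₂ φ ψ dU dV with hS
  have Sf : ∀ t, S.f t = HS.ft (HS.cpx (φ t)) := fun t => rfl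
  have Sg : ∀ t, S.g t = HS.ft (HS.cpx (ψ t)) := fun t => rfl
  obtain ⟨C1, hC1, H⟩ := HS.bootstrap 2 a₁ (8 * Real.pi ^ 3) (-6 * Real.pi * a₁) (Real.pi * c₁₂) (-6 * Real.pi) (c₁₂ / 3)
    ha₁ ha₁' hθ (by norm_num) (by positivity) hγ
  set M := max 1 (max M1 M2) with hM
  have hM0 : 1 ≤ M := le_max_left _ _
  have hMa : M1 ≤ M := (le_max_left _ _).trans (le_max_right _ _)
  have hMb : M2 ≤ M := (le_max_right _ _).trans (le_max_right _ _)
  have hD : 0 < C1 * (M ^ 2 + 2 * M ^ 3) := by positivity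
  set κ := min 1 (min (σ₀ / 2) (1 / (C1 * (M ^ 2 + 2 * M ^ 3)))) with hκ
  have k0 : 0 < κ := lt_min one_pos (lt_min (by positivity) (by positivity))
  have k1 : κ ≤ 1 := min_le_left _ _
  have k2 : κ ≤ σ₀ / 2 := (min_le_right _ _).trans (min_le_left _ _)
  have k3 : C1 * (M ^ 2 + 2 * M ^ 3) * κ ≤ 1 := by
    have : κ ≤ 1 / (C1 * (M ^ 2 + 2 * M ^ 3)) := (min_le_right _ _).trans (min_le_right _ _)
    rw [le_div_iff₀ hD] at this
    linarith
  refine ⟨κ ^ (4/3 : ℝ) / (4 * Real.pi), by positivity, fun t => ?_⟩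
  set T := 1 + |t| with hT
  have hT1 : 1 ≤ T := by linarith [abs_nonneg t]
  have hT0 : 0 < T := by linarith
  set l := (κ / T) ^ (1/3 : ℝ) with hl
  have q0 : 0 < κ / T := by positivity
  have q1 : κ / T ≤ κ := div_le_self k0.le hT1
  have l0 : 0 < l := Real.rpow_pos_of_pos q0 _
  have l1 : l ≤ 1 := Real.rpow_le_one q0.le (q1.trans k1) (by norm_num)
  have l3 : l ^ 3 = κ / T := by
    rw [hl, ← Real.rpow_natCast, ← Real.rpow_mul q0.le]; norm_num
  have l4 : l ^ 4 = κ ^ (4/3 : ℝ) * T ^ (-(4/3) : ℝ) := by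
    rw [hl, ← Real.rpow_natCast, ← Real.rpow_mul q0.le, Real.div_rpow k0.le hT0.le, Real.rpow_neg hT0.le, div_eq_mul_inv]
    norm_num
  have s0 : 0 < l ^ 4 := by positivity
  have s3 : l ^ 4 ≤ κ := by
    calc l ^ 4 = l ^ 3 * l := by ring
      _ ≤ l ^ 3 * 1 := by gcongr
      _ ≤ κ := by rw [mul_one, l3]; exact q1
  have s1 : l ^ 4 ≤ 1 := s3.trans k1
  have s2 : l ^ 4 ≤ σ₀ / 2 := s3.trans k2
  have htI : t ∈ Icc (-T) T := ⟨by linarith [neg_abs_le t], by linarith [le_abs_self t]⟩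
  have h0I : (0 : ℝ) ∈ Icc (-T) T := ⟨by linarith, by linarith⟩
  have reg := S.reg_all (c₁₂ / 3) ha₁ ha₁' hθ (by positivity) hγ (-T) T
  have key : ∀ K : ℝ, 1 ≤ K → HS.xn (l ^ 4) (fun s => Real.exp (min s K)) (S.f t) ≤ C1 * M ∧
      HS.xn (l ^ 4) (fun s => Real.exp (min s K)) (S.g t) ≤ C1 * M := by
    intro K hK
    refine H (Real.exp K) (l ^ 4) _ (HS.BW_exp s0 s1 K hK) S.toSys l l0 l1 rfl (-T) T 0 M hM0 h0I reg
      ((hM1 _ s0 s1 s2 K hK).trans hMa) ((hM2 _ s0 s1 s2 K hK).trans hMb) ?_ t htI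
    refine le_trans ?_ k3
    rw [l3]
    have e : κ / T * (T - -T) * M ^ 3 = 2 * κ * M ^ 3 := by field_simp; ring
    rw [e]
    have : κ / T * M ^ 2 ≤ κ * M ^ 2 := mul_le_mul_of_nonneg_right q1 (by positivity)
    have e2 : κ / T * M ^ 2 + 2 * κ * M ^ 3 ≤ (M ^ 2 + 2 * M ^ 3) * κ := by linarith
    have e3 := mul_le_mul_of_nonneg_left e2 (by linarith : (0 : ℝ) ≤ C1)
    linarith
  have hσ : 4 * Real.pi * (κ ^ (4/3 : ℝ) / (4 * Real.pi) * T ^ (-(4/3 : ℝ) - ε)) ≤ l ^ 4 := by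
    rw [l4]
    have e : 4 * Real.pi * (κ ^ (4/3 : ℝ) / (4 * Real.pi) * T ^ (-(4/3 : ℝ) - ε)) = κ ^ (4/3 : ℝ) * T ^ (-(4/3 : ℝ) - ε) := by
      field_simp
    rw [e]
    have : T ^ (-(4/3 : ℝ) - ε) ≤ T ^ (-(4/3) : ℝ) := Real.rpow_le_rpow_of_exponent_le hT1 (by linarith)
    gcongr
  exact ⟨(HS.gev_iff _ s (φ t) _ (gφ t)).2 (HS.fin_bd _ _ s _ s0 s1 hσ _ fun K hK => (key K hK).1),
    (HS.gev_iff _ s (ψ t) _ (gψ t)).2 (HS.fin_bd _ _ s _ s0 s1 hσ _ fun K hK => (key K hK).2)⟩
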